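/- arXiv:1706.00655 — 2 statements merged into one kernel-verified Lean document; each statement's English description precedes it below -/
import Mathlib

section
/- The set P of (H, G₁)-positive elements of the braid group B_{n+1} is equal to the set of s₁-positive elements of B_{n+1}. -/
namespace GarsideOrder

variable {G : Type*} [Group G]

/-- `a ≤_R b` iff `b * a⁻¹ ∈ M`. -/
def leR (M : Submonoid G) (a b : G) : Prop := b * a⁻¹ ∈ M

/-- `a ≤_L b` iff `a⁻¹ * b ∈ M`. -/
def leL (M : Submonoid G) (a b : G) : Prop := a⁻¹ * b ∈ M

/-- Right divisors (in `M`) of `a`. -/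
def DivR (M : Submonoid G) (a : G) : Set G := {b : G | b ∈ M ∧ leR M b a}

/-- Left divisors (in `M`) of `a`. -/
def DivL (M : Submonoid G) (a : G) : Set G := {b : G | b ∈ M ∧ leL M b a}

/-- `a` is balanced if its sets of right and left divisors coincide. -/
def Balanced (M : Submonoid G) (a : G) : Prop := DivR M a = DivL M a

open Classical in
/-- The `N`-tail of `a`: the unique `b ∈ N` having the same right divisors lying in `N`
as `a` (w.r.t. the divisibility of the ambient monoid `M`). -/
noncomputable def tail (M N : Submonoid G) (a : G) : G :=
  if h : ∃ b : G, b ∈ N ∧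
      {c : G | c ∈ N ∧ leR M c a} = {c : G | c ∈ N ∧ leR M c b} then
    h.choose
  else 1

/-- Iterated stripping of alternating tails: first the `M₁`-tail, then the `N`-tail, etc. -/
noncomputable def strip (M M₁ N : Submonoid G) : ℕ → G → G
  | 0, a => a
  | i + 1, a =>
      strip M M₁ N i a *
        (tail M (if i % 2 = 0 then M₁ else N) (strip M M₁ N i a))⁻¹

/-- The breadth of `a`: the length of the alternating form of `a`, i.e. the least `p ≥ 1`
such that stripping alternating tails `p` times reaches `1`. -/
noncomputable def bh (M M₁ N : Submonoid G) (a : G) : ℕ :=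
  sInf {p : ℕ | 1 ≤ p ∧ strip M M₁ N p a = 1}

/-- The depth of `a`: `(bh a - 1)/2` if `bh a` is odd, `bh a / 2` if `bh a` is even;
in both cases this is `bh a / 2` with natural division. -/
noncomputable def dpt (M M₁ N : Submonoid G) (a : G) : ℕ := bh M M₁ N a / 2

/-- `a ∈ M` is unmovable if `Δ` does not right-divide it. -/
def Unmovable (M : Submonoid G) (Δ a : G) : Prop := a ∈ M ∧ ¬ leR M Δ a

/-- `α` is `(H, G₁)`-negative: its `Δ`-form is `a Δ^{-k}` with `k ≥ 1` and
`dpt a < dpt (Δ^k)`. -/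
def Negative (M M₁ N : Submonoid G) (Δ : G) (α : G) : Prop :=
  ∃ a : G, ∃ k : ℕ, Unmovable M Δ a ∧ 1 ≤ k ∧ α = a * (Δ ^ k)⁻¹ ∧
    dpt M M₁ N a < dpt M M₁ N (Δ ^ k)

/-- `α` is `(H, G₁)`-positive if `α⁻¹` is `(H, G₁)`-negative. -/
def Positive (M M₁ N : Submonoid G) (Δ : G) (α : G) : Prop :=
  Negative M M₁ N Δ α⁻¹

/-- The set `Θ` of theta elements `θ^k a₀`, `k ≥ 1`, `a₀ ∈ M₁`. -/
def thetaSet (M₁ : Submonoid G) (θ : G) : Set G :=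
  {x : G | ∃ k : ℕ, 1 ≤ k ∧ ∃ a₀ ∈ M₁, x = θ ^ k * a₀}

/-- `Θ̄ = Θ ∪ M₁`. -/
def thetaBar (M₁ : Submonoid G) (θ : G) : Set G := thetaSet M₁ θ ∪ (M₁ : Set G)

/-- Condition A with constant `ζ`: `dpt (Δ^k) = ζ k + 1` for all `k ≥ 1`. -/
def CondA (M M₁ N : Submonoid G) (Δ : G) (ζ : ℕ) : Prop :=
  ∀ k : ℕ, 1 ≤ k → dpt M M₁ N (Δ ^ k) = ζ * k + 1

/-- Condition B with constant `ζ`. -/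
def CondB (M M₁ N : Submonoid G) (Δ θ : G) (ζ : ℕ) : Prop :=
  ∀ a b c : G, ∀ t : ℤ,
    Unmovable M Δ a → Unmovable M Δ b →
    ¬(a ∈ thetaBar M₁ θ ∧ b ∈ thetaBar M₁ θ) →
    Unmovable M Δ c → a * b = c * Δ ^ t →
    ∃ ε : ℕ, ε ≤ 1 ∧
      (dpt M M₁ N c : ℤ) =
        (dpt M M₁ N a : ℤ) + (dpt M M₁ N b : ℤ) - (ζ : ℤ) * t - (ε : ℤ) ∧
      ((a ∈ thetaSet M₁ θ ∨ b ∈ thetaSet M₁ θ ∨ c ∈ M₁) → ε = 1)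

/-- A Garside structure with group of fractions the subgroup `car`. -/
structure IsGarsideOn (car : Subgroup G) (M : Submonoid G) (Δ : G) : Prop where
  M_sub : (M : Set G) ⊆ (car : Set G)
  delta_mem : Δ ∈ M
  units_trivial : ∀ x : G, x ∈ M → x⁻¹ ∈ M → x = 1
  noetherian : ∀ a ∈ M, ∃ n : ℕ, 1 ≤ n ∧ ∀ l : List G,
      (∀ x ∈ l, x ∈ M ∧ x ≠ 1) → l.prod = a → l.length ≤ n
  balanced : Balanced M Δ
  div_finite : (DivR M Δ).Finite
  div_gen_monoid : Submonoid.closure (DivR M Δ) = M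
  div_gen_group : Subgroup.closure (DivR M Δ) = car
  meet : ∀ a ∈ car, ∀ b ∈ car, ∃ c ∈ car, leR M c a ∧ leR M c b ∧
      ∀ d ∈ car, leR M d a → leR M d b → leR M d c
  join : ∀ a ∈ car, ∀ b ∈ car, ∃ c ∈ car, leR M a c ∧ leR M b c ∧
      ∀ d ∈ car, leR M a d → leR M b d → leR M c d

/-- The parabolic submonoid determined by `δ`: the submonoid generated by `Div(δ)`. -/
def parM (M : Submonoid G) (δ : G) : Submonoid G := Submonoid.closure (DivR M δ)

/-- The parabolic subgroup determined by `δ`: the subgroup generated by `Div(δ)`. -/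
def parG (M : Submonoid G) (δ : G) : Subgroup G := Subgroup.closure (DivR M δ)

/-- `δ` determines a parabolic substructure of `(G, M, Δ)`. -/
structure IsParabolic (M : Submonoid G) (Δ δ : G) : Prop where
  mem : δ ∈ M
  balanced : Balanced M δ
  div_eq : DivR M δ = DivR M Δ ∩ (parM M δ : Set G)

/-- The setting of Section 3: a Garside structure `(car, M, Δ)` together with two
parabolic substructures `(H, N, Λ)` (given by `lam`) and `(G₁, M₁, Δ₁)` (given by `δ1`),
with `N ≠ M`, `M₁ ≠ M`, `N ∪ M₁` generating `M`, `Δ` central, `Δ₁` central in `G₁`. -/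
structure Setting (G : Type*) [Group G] where
  car : Subgroup G
  M : Submonoid G
  Δ : G
  δ1 : G
  lam : G
  garside : IsGarsideOn car M Δ
  par1 : IsParabolic M Δ δ1
  parH : IsParabolic M Δ lam
  N_ne : parM M lam ≠ M
  M1_ne : parM M δ1 ≠ M
  unionGen : Submonoid.closure ((parM M lam : Set G) ∪ (parM M δ1 : Set G)) = M
  delta_central : ∀ g ∈ car, Δ * g = g * Δ
  delta1_central : ∀ g ∈ parG M δ1, δ1 * g = g * δ1

namespace Setting

variable (S : Setting G)

/-- The parabolic submonoid `M₁`. -/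
def M₁ : Submonoid G := parM S.M S.δ1

/-- The parabolic submonoid `N`. -/
def Nsub : Submonoid G := parM S.M S.lam

/-- The parabolic subgroup `G₁`. -/
def G₁ : Subgroup G := parG S.M S.δ1

/-- `θ = Δ Δ₁⁻¹`. -/
def theta : G := S.Δ * S.δ1⁻¹

/-- The set of `(H, G₁)`-negative elements. -/
def Neg : Set G := {α : G | Negative S.M S.M₁ S.Nsub S.Δ α}

/-- The set of `(H, G₁)`-positive elements. -/
def Pos : Set G := {α : G | α⁻¹ ∈ S.Neg}

/-- Condition A. -/
def condA (ζ : ℕ) : Prop := CondA S.M S.M₁ S.Nsub S.Δ ζ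

/-- Condition B. -/
def condB (ζ : ℕ) : Prop := CondB S.M S.M₁ S.Nsub S.Δ S.theta ζ

/-- `(H, G₁)` is a Dehornoy structure: `PP ⊆ P`, `G₁ P G₁ ⊆ P`, and the group is the
disjoint union of `P`, `P⁻¹` and `G₁`. -/
def IsDehornoy : Prop :=
  (∀ α ∈ S.Pos, ∀ β ∈ S.Pos, α * β ∈ S.Pos) ∧
  (∀ g₁ ∈ S.G₁, ∀ α ∈ S.Pos, ∀ g₂ ∈ S.G₁, g₁ * α * g₂ ∈ S.Pos) ∧
  (∀ α ∈ S.car, α ∈ S.Pos ∨ α ∈ S.Neg ∨ α ∈ S.G₁) ∧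
  (∀ α : G, ¬(α ∈ S.Pos ∧ α ∈ S.Neg)) ∧
  (∀ α : G, ¬(α ∈ S.Pos ∧ α ∈ S.G₁)) ∧
  (∀ α : G, ¬(α ∈ S.Neg ∧ α ∈ S.G₁))

end Setting

end GarsideOrder


namespace BraidOrder

open GarsideOrder

/-- The braid relations on `n` generators `σ_0, …, σ_{n-1}` (representing `s_1, …, s_n`). -/
def braidRel (n : ℕ) : Set (FreeGroup (Fin n)) :=
  {r | ∃ i j : Fin n,
      ((i : ℕ) + 1 = (j : ℕ) ∧
        r = FreeGroup.of i * FreeGroup.of j * FreeGroup.of i *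
            (FreeGroup.of j * FreeGroup.of i * FreeGroup.of j)⁻¹) ∨
      ((i : ℕ) + 2 ≤ (j : ℕ) ∧
        r = FreeGroup.of i * FreeGroup.of j * (FreeGroup.of j * FreeGroup.of i)⁻¹)}

/-- The braid group `B_{n+1}` on `n+1` strands, presented with `n` generators. -/
abbrev Braid (n : ℕ) := PresentedGroup (braidRel n)

/-- `gen n i` is the generator `s_{i+1}` of `B_{n+1}` (for `i < n`). -/
def gen (n i : ℕ) : Braid n :=
  if h : i < n then PresentedGroup.of ⟨i, h⟩ else 1

/-- The product `gen a * gen (a+1) * ⋯ * gen (b-1)`, i.e. `s_{a+1} s_{a+2} ⋯ s_b`. -/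
def seg (n a b : ℕ) : Braid n := (((List.range b).drop a).map (gen n)).prod

/-- The product `gen (b-1) * ⋯ * gen (a+1) * gen a`, i.e. `s_b ⋯ s_{a+2} s_{a+1}`. -/
def segRev (n a b : ℕ) : Braid n := ((((List.range b).drop a).reverse).map (gen n)).prod

/-- The positive braid monoid `B_{n+1}^+`. -/
def Mb (n : ℕ) : Submonoid (Braid n) :=
  Submonoid.closure {x : Braid n | ∃ i : ℕ, i < n ∧ x = gen n i}

/-- The submonoid generated by `s_2, …, s_n`. -/
def M₁b (n : ℕ) : Submonoid (Braid n) :=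
  Submonoid.closure {x : Braid n | ∃ i : ℕ, 1 ≤ i ∧ i < n ∧ x = gen n i}

/-- The submonoid generated by `s_1, …, s_{n-1}`. -/
def Nb (n : ℕ) : Submonoid (Braid n) :=
  Submonoid.closure {x : Braid n | ∃ i : ℕ, i + 1 < n ∧ x = gen n i}

/-- The subgroup generated by `s_2, …, s_n`. -/
def G₁b (n : ℕ) : Subgroup (Braid n) :=
  Subgroup.closure {x : Braid n | ∃ i : ℕ, 1 ≤ i ∧ i < n ∧ x = gen n i}

/-- The subgroup generated by `s_1, …, s_{n-1}`. -/
def Hb (n : ℕ) : Subgroup (Braid n) :=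
  Subgroup.closure {x : Braid n | ∃ i : ℕ, i + 1 < n ∧ x = gen n i}

/-- The Garside element `Δ = (s_1 s_2 ⋯ s_n)^{n+1}`. -/
def Δb (n : ℕ) : Braid n := seg n 0 n ^ (n + 1)

/-- `Δ₁ = (s_2 ⋯ s_n)^n`. -/
def Δ₁b (n : ℕ) : Braid n := seg n 1 n ^ n

/-- `Λ = (s_1 ⋯ s_{n-1})^n`. -/
def Λb (n : ℕ) : Braid n := seg n 0 (n - 1) ^ n

/-- `θ = s_1 ⋯ s_{n-1} s_n² s_{n-1} ⋯ s_1` as an explicit word. -/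
def thetaWordb (n : ℕ) : Braid n := seg n 0 n * segRev n 0 n

end BraidOrder

namespace BraidOrder

/-- The set of `s₁`-positive elements of `B_{n+1}`: elements of the form
`α₀ s₁ α₁ ⋯ s₁ α_m` with `m ≥ 1` and `α₀, …, α_m ∈ G₁ = ⟨s₂, …, s_n⟩`. -/
def S1Pos (n : ℕ) : Set (Braid n) :=
  {α : Braid n | ∃ m : ℕ, 1 ≤ m ∧ ∃ b : Fin (m + 1) → Braid n,
      (∀ i, b i ∈ G₁b n) ∧
      α = (List.ofFn (fun i : Fin m => b i.castSucc * gen n 0)).prod * b (Fin.last m)}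

end BraidOrder

namespace ArtinMonoid

variable {ι : Type*} (Γ : SimpleGraph ι)

/-- The relations of the Artin monoid with labels `2` and `3` attached to the graph `Γ`. -/
def rel (u v : FreeMonoid ι) : Prop :=
  ∃ i j : ι, (Γ.Adj i j ∧ u = .of i * .of j * .of i ∧ v = .of j * .of i * .of j) ∨
    (¬ Γ.Adj i j ∧ u = .of i * .of j ∧ v = .of j * .of i)

/-- `CommonMul Γ s x i y j` says that `x * s i = y * s j` holds for the obvious reason, namely
that this element is a left multiple of the least common left multiple of `s i` and `s j`. -/
def CommonMul {Q : Type*} [Monoid Q] (s : ι → Q) (x : Q) (i : ι) (y : Q) (j : ι) : Prop :=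
  (i = j ∧ x = y) ∨ (Γ.Adj i j ∧ ∃ z, x = z * s i * s j ∧ y = z * s j * s i) ∨
    (i ≠ j ∧ ¬ Γ.Adj i j ∧ ∃ z, x = z * s j ∧ y = z * s i)

variable {Γ}

section Monoid

variable {Q : Type*} [Monoid Q] {s : ι → Q}

theorem CommonMul.symm {x y : Q} {i j : ι} (h : CommonMul Γ s x i y j) :
    CommonMul Γ s y j x i := by
  rcases h with ⟨rfl, rfl⟩ | ⟨h, z, h1, h2⟩ | ⟨h, h', z, h1, h2⟩
  · exact .inl ⟨rfl, rfl⟩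
  · exact .inr (.inl ⟨h.symm, z, h2, h1⟩)
  · exact .inr (.inr ⟨h.symm, fun h => h' h.symm, z, h2, h1⟩)

theorem CommonMul.mul_left {x y : Q} {i j : ι} (h : CommonMul Γ s x i y j) (w : Q) :
    CommonMul Γ s (w * x) i (w * y) j := by
  rcases h with ⟨rfl, rfl⟩ | ⟨h, z, rfl, rfl⟩ | ⟨h, h', z, rfl, rfl⟩
  · exact .inl ⟨rfl, rfl⟩
  · exact .inr (.inl ⟨h, w * z, by simp only [mul_assoc], by simp only [mul_assoc]⟩)
  · exact .inr (.inr ⟨h, h', w * z, by simp only [mul_assoc], by simp only [mul_assoc]⟩)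

theorem CommonMul.of_adj {x y : Q} {i j : ι} (h : CommonMul Γ s x i y j) (hij : Γ.Adj i j) :
    ∃ z, x = z * s i * s j ∧ y = z * s j * s i := by
  rcases h with ⟨rfl, -⟩ | ⟨-, h⟩ | ⟨-, h, -⟩
  · exact absurd hij (Γ.loopless.irrefl _)
  · exact h
  · exact absurd hij h

theorem CommonMul.of_not_adj {x y : Q} {i j : ι} (h : CommonMul Γ s x i y j) (hne : i ≠ j)
    (hij : ¬ Γ.Adj i j) : ∃ z, x = z * s j ∧ y = z * s i := by
  rcases h with ⟨rfl, -⟩ | ⟨h, -⟩ | ⟨-, -, h⟩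
  · exact absurd rfl hne
  · exact absurd h hij
  · exact h

theorem CommonMul.of_eq {x y : Q} {i : ι} (h : CommonMul Γ s x i y i) : x = y := by
  rcases h with ⟨-, h⟩ | ⟨h, -⟩ | ⟨h, -⟩
  · exact h
  · exact absurd h (Γ.loopless.irrefl _)
  · exact absurd rfl h

theorem CommonMul.trans (htri : ∀ i j k, Γ.Adj i j → Γ.Adj j k → ¬ Γ.Adj i k)
    (hcomm : ∀ i j, ¬ Γ.Adj i j → s i * s j = s j * s i)
    (hbraid : ∀ i j, Γ.Adj i j → s i * s j * s i = s j * s i * s j)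
    {len : Q → ℕ} (hlen : ∀ x i, len (x * s i) = len x + 1) {x y w : Q} {i j k : ι}
    (ih : ∀ x y i j, len x < len w → x * s i = y * s j → CommonMul Γ s x i y j)
    (h₁ : CommonMul Γ s x i w k) (h₂ : CommonMul Γ s w k y j) : CommonMul Γ s x i y j := by
  have comm' : ∀ i j, ¬ Γ.Adj i j → ∀ z, z * s i * s j = z * s j * s i := fun i j h z => by
    rw [mul_assoc, hcomm i j h, mul_assoc]
  have braid' : ∀ i j, Γ.Adj i j → ∀ z, z * s i * s j * s i = z * s j * s i * s j :=
    fun i j h z => by simpa only [mul_assoc] using congrArg (z * ·) (hbraid i j h)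
  -- the case where `k` is adjacent to `i` and not to `j`
  have mixed : ∀ x y i j, i ≠ j → j ≠ k → Γ.Adj i k → ¬ Γ.Adj k j →
      (∃ A, x = A * s i * s k ∧ w = A * s k * s i) → (∃ B, w = B * s j ∧ y = B * s k) →
      CommonMul Γ s x i y j := by
    rintro x y i j hij hjk hik hkj ⟨A, rfl, hA⟩ ⟨B, hB, rfl⟩
    have hl : len A + 2 = len w := by rw [hA, hlen, hlen]
    have hAB : A * s k * s i = B * s j := hA.symm.trans hB
    by_cases hadj : Γ.Adj i j
    · obtain ⟨C, hC, rfl⟩ := (ih _ _ _ _ (by rw [hlen]; omega) hAB).of_adj hadj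
      obtain ⟨E, rfl, hE⟩ := (ih _ _ _ _ (by omega) hC).of_not_adj hjk.symm hkj
      have hl' : len E + 1 = len C + 1 := by rw [← hlen E k, ← hE, hlen]
      rw [hlen] at hl
      obtain ⟨F, rfl, rfl⟩ := (ih _ _ _ _ (by omega) hE).of_adj hik
      refine .inr (.inl ⟨hadj, F * s j * s i * s k, ?_, ?_⟩)
      · rw [braid' i j hadj, comm' k j hkj F, ← comm' k j hkj (F * s j * s k * s i),
          braid' k i hik.symm]
      · rw [comm' k j hkj, braid' k i hik.symm, braid' i j hadj, ← comm' k j hkj]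
    · obtain ⟨C, hC, rfl⟩ := (ih _ _ _ _ (by rw [hlen]; omega) hAB).of_not_adj hij hadj
      obtain ⟨D, rfl, rfl⟩ := (ih _ _ _ _ (by omega) hC).of_not_adj hjk.symm hkj
      refine .inr (.inr ⟨hij, hadj, D * s i * s k, ?_, ?_⟩)
      · rw [← comm' i j hadj, ← comm' k j hkj]
      · rw [braid' _ _ hik]
  rcases eq_or_ne i k with rfl | hik
  · rwa [h₁.of_eq]
  rcases eq_or_ne k j with rfl | hkj
  · rwa [← h₂.of_eq]
  by_cases aik : Γ.Adj i k <;> by_cases akj : Γ.Adj k j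
  · have hij := htri i k j aik akj
    obtain ⟨A, rfl, hA⟩ := h₁.of_adj aik
    obtain ⟨B, hB, rfl⟩ := h₂.of_adj akj
    have hl : len A + 2 = len w := by rw [hA, hlen, hlen]
    have hl' : len B + 2 = len w := by rw [hB, hlen, hlen]
    have hAB := hA.symm.trans hB
    rcases eq_or_ne i j with rfl | hne
    · have h := (ih _ _ _ _ (by rw [hlen]; omega) hAB).of_eq
      exact .inl ⟨rfl, by rw [(ih _ _ _ _ (by omega) h).of_eq]⟩
    obtain ⟨C, hC, hC'⟩ := (ih _ _ _ _ (by rw [hlen]; omega) hAB).of_not_adj hne hij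
    obtain ⟨D, rfl, hD⟩ := (ih _ _ _ _ (by omega) hC).of_adj akj
    obtain ⟨E, rfl, hE⟩ := (ih _ _ _ _ (by omega) hC').of_adj aik.symm
    have h := hD.symm.trans hE
    simp only [hlen] at hl hl'
    have h := (ih _ _ _ _ (by rw [hlen]; omega) h).of_eq
    obtain ⟨F, rfl, rfl⟩ := (ih _ _ _ _ (by omega) h).of_not_adj hne.symm (fun h => hij h.symm)
    refine .inr (.inr ⟨hne, hij, F * s k * s i * s j * s k, ?_, ?_⟩)
    · rw [← comm' i j hij, braid' i k aik, braid' k j akj]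
    · rw [comm' i j hij, comm' i j hij, ← braid' k j akj, ← braid' i k aik]
  · rcases eq_or_ne i j with rfl | hne
    · exact absurd aik.symm akj
    exact mixed x y i j hne hkj.symm aik akj (h₁.of_adj aik) (h₂.of_not_adj hkj akj)
  · rcases eq_or_ne i j with rfl | hne
    · exact absurd akj.symm aik
    refine (mixed y x j i hne.symm hik akj.symm (fun h => aik h.symm) (h₂.symm.of_adj akj.symm)
      (h₁.symm.of_not_adj hik.symm fun h => aik h.symm)).symm
  · obtain ⟨A, rfl, hA⟩ := h₁.of_not_adj hik aik
    obtain ⟨B, hB, rfl⟩ := h₂.of_not_adj hkj akj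
    have hl : len A + 1 = len w := by rw [hA, hlen]
    have hl' : len B + 1 = len w := by rw [hB, hlen]
    rcases ih _ _ _ _ (by omega) (hA.symm.trans hB) with
      ⟨rfl, rfl⟩ | ⟨h, z, rfl, rfl⟩ | ⟨h, h', z, rfl, rfl⟩
    · exact .inl ⟨rfl, rfl⟩
    · refine .inr (.inl ⟨h, z * s k, ?_, ?_⟩)
      · rw [← comm' k j akj, comm' i k aik]
      · rw [comm' i k aik, ← comm' k j akj]
    · refine .inr (.inr ⟨h, h', z * s k, ?_, ?_⟩)
      · rw [← comm' k j akj]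
      · rw [comm' i k aik]

end Monoid

section Presented

variable (Γ) in
/-- The Artin monoid with labels `2` and `3` attached to the graph `Γ`. -/
abbrev Mon := PresentedMonoid (rel Γ)

variable (Γ) in
/-- The standard generators. -/
abbrev σ (i : ι) : Mon Γ := PresentedMonoid.of (rel Γ) i

theorem σ_comm {i j : ι} (h : ¬ Γ.Adj i j) : σ Γ i * σ Γ j = σ Γ j * σ Γ i := by
  have hr : rel Γ (.of i * .of j) (.of j * .of i) := ⟨i, j, .inr ⟨h, rfl, rfl⟩⟩
  exact PresentedMonoid.mk_eq_mk_of_rel hr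

theorem σ_braid {i j : ι} (h : Γ.Adj i j) :
    σ Γ i * σ Γ j * σ Γ i = σ Γ j * σ Γ i * σ Γ j := by
  have hr : rel Γ (.of i * .of j * .of i) (.of j * .of i * .of j) := ⟨i, j, .inl ⟨h, rfl, rfl⟩⟩
  exact PresentedMonoid.mk_eq_mk_of_rel hr

variable (Γ) in
/-- The length of an element, as a homomorphism. -/
def lenHom : Mon Γ →* Multiplicative ℕ :=
  PresentedMonoid.lift (fun _ => Multiplicative.ofAdd 1) <| by
    rintro u v ⟨i, j, ⟨-, rfl, rfl⟩ | ⟨-, rfl, rfl⟩⟩ <;> simp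

/-- The length of an element. -/
def len (x : Mon Γ) : ℕ := (lenHom Γ x).toAdd

theorem len_mul (x y : Mon Γ) : len (x * y) = len x + len y := by
  simp [len]

theorem len_σ (i : ι) : len (σ Γ i) = 1 := rfl

theorem len_mk (w : FreeMonoid ι) : len (PresentedMonoid.mk (rel Γ) w) = w.length := by
  induction w with
  | one => rfl
  | of i => rfl
  | mul x y hx hy => rw [map_mul, len_mul, hx, hy, FreeMonoid.length_mul]

theorem _root_.FreeMonoid.eq_one_or_eq_mul_of (w : FreeMonoid ι) :
    w = 1 ∨ ∃ x i, w = x * FreeMonoid.of i := by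
  rcases List.eq_nil_or_concat (FreeMonoid.toList w) with h | ⟨x, i, h⟩
  · exact .inl h
  · exact .inr ⟨FreeMonoid.ofList x, i, by
    rw [List.concat_eq_append] at h
    exact h⟩

theorem _root_.FreeMonoid.mul_of_inj {x y : FreeMonoid ι} {i j : ι}
    (h : x * FreeMonoid.of i = y * FreeMonoid.of j) : x = y ∧ i = j := by
  have h' : FreeMonoid.toList x ++ [i] = FreeMonoid.toList y ++ [j] := h
  simpa using List.append_inj' h' rfl

/-- Garside's theorem: two generators which right-divide an element do so through their least
common left multiple. -/
theorem commonMul_of_mul_eq (htri : ∀ i j k, Γ.Adj i j → Γ.Adj j k → ¬ Γ.Adj i k)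
    (x y : Mon Γ) (i j : ι) (h : x * σ Γ i = y * σ Γ j) : CommonMul Γ (σ Γ) x i y j := by
  induction hL : len x using Nat.strong_induction_on generalizing x y i j with
  | _ L ih =>
  have ih' : ∀ w : Mon Γ, len w ≤ L → ∀ x y i j, len x < len w → x * σ Γ i = y * σ Γ j →
      CommonMul Γ (σ Γ) x i y j := fun w hw x y i j hx h => ih _ (hx.trans_le hw) x y i j h rfl
  let mk := PresentedMonoid.mk (rel Γ)
  have key : ∀ u v : FreeMonoid ι, ConGen.Rel (rel Γ) u v → u.length ≤ L + 1 →
      ∀ x i y j, u = x * .of i → v = y * .of j → CommonMul Γ (σ Γ) (mk x) i (mk y) j := by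
    intro u v huv
    have hlen : ∀ {u v}, ConGen.Rel (rel Γ) u v → u.length = v.length := fun {u v} h => by
      rw [← len_mk (Γ := Γ), ← len_mk (Γ := Γ), PresentedMonoid.mk_eq_mk_iff.2 h]
    induction huv with
    | of u v h =>
      rintro - x i y j hu hv
      obtain ⟨a, b, ⟨hab, rfl, rfl⟩ | ⟨hab, rfl, rfl⟩⟩ := h
      · obtain ⟨rfl, rfl⟩ := FreeMonoid.mul_of_inj hu
        obtain ⟨rfl, rfl⟩ := FreeMonoid.mul_of_inj hv
        exact .inr (.inl ⟨hab, 1, by rw [one_mul]; exact map_mul mk _ _,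
          by rw [one_mul]; exact map_mul mk _ _⟩)
      · obtain ⟨rfl, rfl⟩ := FreeMonoid.mul_of_inj hu
        obtain ⟨rfl, rfl⟩ := FreeMonoid.mul_of_inj hv
        rcases eq_or_ne b a with rfl | hne
        · exact .inl ⟨rfl, rfl⟩
        · exact .inr (.inr ⟨hne, fun h => hab h.symm, 1, (one_mul _).symm, (one_mul _).symm⟩)
    | refl u =>
      rintro - x i y j rfl hv
      obtain ⟨rfl, rfl⟩ := FreeMonoid.mul_of_inj hv
      exact .inl ⟨rfl, rfl⟩
    | symm h ihh =>
      intro hl x i y j hu hv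
      exact (ihh (hlen h ▸ hl) y j x i hv hu).symm
    | @trans u v w h₁ h₂ ih₁ ih₂ =>
      rintro hl x i y j rfl rfl
      rcases FreeMonoid.eq_one_or_eq_mul_of v with rfl | ⟨z, k, rfl⟩
      · have := hlen h₁
        simp at this
      · have h3 := hlen h₁
        simp only [FreeMonoid.length_mul, FreeMonoid.length_of] at h3 hl
        refine CommonMul.trans htri (fun _ _ => σ_comm) (fun _ _ => σ_braid)
          (fun x i => by rw [len_mul, len_σ]) (ih' _ ?_)
          (ih₁ (by simpa using hl) x i z k rfl rfl)
          (ih₂ (by simp; omega) z k y j rfl rfl)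
        rw [len_mk]
        omega
    | @mul a b c d h₁ h₂ ih₁ ih₂ =>
      intro hl x i y j hu hv
      rw [FreeMonoid.length_mul] at hl
      rcases FreeMonoid.eq_one_or_eq_mul_of c with rfl | ⟨z, k, rfl⟩
      · have hd : d = 1 := FreeMonoid.length_eq_zero.1 ((hlen h₂).symm.trans (by simp))
        subst hd
        rw [mul_one] at hu hv
        exact ih₁ (by omega) x i y j hu hv
      · rcases FreeMonoid.eq_one_or_eq_mul_of d with rfl | ⟨z', k', rfl⟩
        · have := hlen h₂
          simp at this
        · rw [← mul_assoc] at hu hv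
          obtain ⟨rfl, rfl⟩ := FreeMonoid.mul_of_inj hu
          obtain ⟨rfl, rfl⟩ := FreeMonoid.mul_of_inj hv
          rw [map_mul, map_mul, show mk a = mk b from PresentedMonoid.mk_eq_mk_iff.2 h₁]
          exact (ih₂ (by omega) z k z' k' rfl rfl).mul_left _
  obtain ⟨x, rfl⟩ := PresentedMonoid.surjective_mk x
  obtain ⟨y, rfl⟩ := PresentedMonoid.surjective_mk y
  refine key (x * .of i) (y * .of j) ?_ ?_ x i y j rfl rfl
  · refine PresentedMonoid.mk_eq_mk_iff.1 ?_
    rw [map_mul, map_mul]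
    exact h
  · rw [len_mk] at hL
    simp [hL]

theorem mul_right_cancel' (htri : ∀ i j k, Γ.Adj i j → Γ.Adj j k → ¬ Γ.Adj i k)
    {x y z : Mon Γ} (h : x * z = y * z) : x = y := by
  have hz : z ∈ Submonoid.closure (Set.range (σ Γ)) := by
    rw [PresentedMonoid.closure_range_of]
    trivial
  induction hz using Submonoid.closure_induction_right with
  | one => simpa using h
  | mul_right z hz s hs ih =>
    obtain ⟨i, rfl⟩ := hs
    rw [← mul_assoc, ← mul_assoc] at h
    exact ih (commonMul_of_mul_eq htri _ _ _ _ h).of_eq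

end Presented

/-- A right cancellative monoid generated by divisors of a central element embeds into a group. -/
theorem exists_injective_hom_group.{u} {Q : Type u} [Monoid Q]
    (hcan : ∀ x y z : Q, x * z = y * z → x = y) {S : Set Q} (hS : Submonoid.closure S = ⊤)
    {Δ : Q} (hΔ : ∀ x, Δ * x = x * Δ) (hdiv : ∀ s ∈ S, ∃ y, s * y = Δ) :
    ∃ (K : Type u) (_ : Group K) (f : Q →* K), Function.Injective f := by
  have hdiv' : ∀ x : Q, ∃ (k : ℕ) (y : Q), y * x = Δ ^ k := by
    intro x
    have hx : x ∈ Submonoid.closure S := by rw [hS]; trivial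
    induction hx using Submonoid.closure_induction_right with
    | one => exact ⟨0, 1, by simp⟩
    | mul_right x hx s hs ih =>
      obtain ⟨k, y, hy⟩ := ih
      obtain ⟨z, hz⟩ := hdiv s hs
      have hz' : z * s = Δ := hcan _ _ z (by rw [mul_assoc, hz, hΔ])
      refine ⟨k + 1, z * y, ?_⟩
      calc z * y * (x * s) = z * (y * x) * s := by simp only [mul_assoc]
        _ = Δ ^ k * (z * s) := by
          rw [hy, ← mul_assoc, ((show Commute Δ z from hΔ z).pow_left k).eq]
        _ = Δ ^ (k + 1) := by rw [hz', pow_succ]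
  have hcan' : ∀ x y z : Q, z * x = z * y → x = y := by
    intro x y z h
    obtain ⟨k, u, hu⟩ := hdiv' z
    refine hcan _ _ (Δ ^ k) ?_
    rw [← ((show Commute Δ x from hΔ x).pow_left k).eq,
      ← ((show Commute Δ y from hΔ y).pow_left k).eq, ← hu, mul_assoc, h, mul_assoc]
  choose k u hu using hdiv'
  let _ : OreLocalization.OreSet (⊤ : Submonoid Q) :=
    { ore_right_cancel := fun x y s h => ⟨1, by rw [hcan _ _ _ h]⟩
      oreNum := fun r s => r * u s
      oreDenom := fun r s => ⟨Δ ^ k s, trivial⟩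
      ore_eq := fun r s => by
        rw [mul_assoc, hu]
        exact ((show Commute Δ r from hΔ r).pow_left _).eq }
  refine ⟨(OreLocalization (⊤ : Submonoid Q) Q)ˣ, inferInstance,
    IsUnit.liftRight OreLocalization.numeratorHom
      (fun x => OreLocalization.numerator_isUnit (⟨x, trivial⟩ : (⊤ : Submonoid Q))),
    fun x y h => ?_⟩
  have h' : (OreLocalization.numeratorHom x : OreLocalization (⊤ : Submonoid Q) Q) =
      OreLocalization.numeratorHom y := congrArg Units.val h
  obtain ⟨a, b, h1, h2⟩ := OreLocalization.oreDiv_eq_iff.1 h'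
  have hab : (a : Q) = b := by simpa using h2
  refine (hcan' _ _ b ?_).symm
  rw [← hab]
  exact h1.trans (by rw [hab]; rfl)

end ArtinMonoid

namespace BraidFamily

section Monoid

variable {Q : Type*} [Monoid Q]

/-- The elements `t 0, …, t (n - 1)` satisfy the braid relations. -/
structure IsBraidFamily (n : ℕ) (t : ℕ → Q) : Prop where
  comm : ∀ i j, i + 2 ≤ j → j < n → t i * t j = t j * t i
  braid : ∀ i, i + 1 < n → t i * t (i + 1) * t i = t (i + 1) * t i * t (i + 1)

/-- The product `t 0 * t 1 * ⋯ * t (m - 1)`. -/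
def up (t : ℕ → Q) : ℕ → Q
  | 0 => 1
  | m + 1 => up t m * t m

/-- The product `t (m - 1) * ⋯ * t 1 * t 0`. -/
def down (t : ℕ → Q) : ℕ → Q
  | 0 => 1
  | m + 1 => t m * down t m

/-- The family `t` with its first member deleted. -/
def shift (t : ℕ → Q) (i : ℕ) : Q := t (i + 1)

theorem up_succ (t : ℕ → Q) (m : ℕ) : up t (m + 1) = up t m * t m := rfl

theorem down_succ (t : ℕ → Q) (m : ℕ) : down t (m + 1) = t m * down t m := rfl

theorem up_succ' (t : ℕ → Q) (m : ℕ) : up t (m + 1) = t 0 * up (shift t) m := by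
  induction m with
  | zero => simp [up]
  | succ m ih => rw [up_succ, ih, up_succ (shift t), mul_assoc, shift]

theorem down_succ' (t : ℕ → Q) (m : ℕ) : down t (m + 1) = down (shift t) m * t 0 := by
  induction m with
  | zero => simp [down]
  | succ m ih => rw [down_succ, ih, down_succ (shift t), mul_assoc, shift]

theorem up_mem {t : ℕ → Q} {S : Submonoid Q} {m : ℕ} (h : ∀ i < m, t i ∈ S) : up t m ∈ S := by
  induction m with
  | zero => exact S.one_mem
  | succ m ih => exact S.mul_mem (ih fun i hi => h i (by omega)) (h m (by omega))

theorem down_mem {t : ℕ → Q} {S : Submonoid Q} {m : ℕ} (h : ∀ i < m, t i ∈ S) :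
    down t m ∈ S := by
  induction m with
  | zero => exact S.one_mem
  | succ m ih => exact S.mul_mem (h m (by omega)) (ih fun i hi => h i (by omega))

namespace IsBraidFamily

variable {t : ℕ → Q} {n r : ℕ}

theorem shift (h : IsBraidFamily (n + 1) t) : IsBraidFamily n (shift t) where
  comm i j hij hj := h.comm _ _ (by omega) (by omega)
  braid i hi := h.braid _ (by omega)

theorem up_comm (h : IsBraidFamily n t) {m i : ℕ} (hm : m + 1 ≤ i) (hi : i < n) :
    up t m * t i = t i * up t m := by
  induction m with
  | zero => simp [up]
  | succ m ih =>
    rw [up_succ, mul_assoc, h.comm m i (by omega) hi, ← mul_assoc, ih (by omega), mul_assoc]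

theorem down_comm (h : IsBraidFamily n t) {m i : ℕ} (hm : m + 1 ≤ i) (hi : i < n) :
    down t m * t i = t i * down t m := by
  induction m with
  | zero => simp [down]
  | succ m ih =>
    rw [down_succ, mul_assoc, ih (by omega), ← mul_assoc, h.comm m i (by omega) hi, mul_assoc]

theorem up_mul (h : IsBraidFamily n t) {m k : ℕ} (hk : k + 1 < m) (hm : m ≤ n) :
    up t m * t k = t (k + 1) * up t m := by
  induction m with
  | zero => omega
  | succ m ih =>
    rcases Nat.lt_or_ge (k + 1) m with hlt | hge
    · rw [up_succ, mul_assoc, ← h.comm k m (by omega) (by omega), ← mul_assoc,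
        ih hlt (by omega), mul_assoc]
    · obtain rfl : m = k + 1 := by omega
      rw [up_succ, up_succ]
      calc up t k * t k * t (k + 1) * t k = up t k * (t k * t (k + 1) * t k) := by
            simp only [mul_assoc]
        _ = up t k * t (k + 1) * t k * t (k + 1) := by
            rw [h.braid k (by omega)]; simp only [mul_assoc]
        _ = _ := by rw [h.up_comm le_rfl (by omega)]; simp only [mul_assoc]

theorem down_mul (h : IsBraidFamily n t) {m k : ℕ} (hk : k + 1 < m) (hm : m ≤ n) :
    down t m * t (k + 1) = t k * down t m := by
  induction m with
  | zero => omega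
  | succ m ih =>
    rcases Nat.lt_or_ge (k + 1) m with hlt | hge
    · rw [down_succ, mul_assoc, ih hlt (by omega), ← mul_assoc,
        ← h.comm k m (by omega) (by omega), mul_assoc]
    · obtain rfl : m = k + 1 := by omega
      rw [down_succ, down_succ]
      calc t (k + 1) * (t k * down t k) * t (k + 1)
          = t (k + 1) * t k * (down t k * t (k + 1)) := by simp only [mul_assoc]
        _ = t (k + 1) * t k * t (k + 1) * down t k := by
            rw [h.down_comm le_rfl (by omega)]; simp only [mul_assoc]
        _ = _ := by rw [← h.braid k (by omega)]; simp only [mul_assoc]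

theorem up_mul_down (h : IsBraidFamily n t) {k : ℕ} (hk : k < n) :
    up t n * down t k = down (BraidFamily.shift t) k * up t n := by
  induction k with
  | zero => simp [down]
  | succ k ih =>
    rw [down_succ, ← mul_assoc, h.up_mul hk le_rfl, mul_assoc, ih (by omega), down_succ,
      ← mul_assoc]
    rfl

theorem up_mul_up (h : IsBraidFamily n t) {k : ℕ} (hk : k < n) :
    up t n * up t k = up (BraidFamily.shift t) k * up t n := by
  induction k with
  | zero => simp [up]
  | succ k ih =>
    rw [up_succ, ← mul_assoc, ih (by omega), mul_assoc, h.up_mul hk le_rfl, up_succ, ← mul_assoc]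
    rfl

theorem up_pow (h : IsBraidFamily (r + 1) t) {k : ℕ} (hk : k ≤ r + 1) :
    up t (r + 1) ^ k = down t k * up (BraidFamily.shift t) r ^ k := by
  induction k with
  | zero => simp [down]
  | succ k ih =>
    rw [pow_succ', ih (by omega), ← mul_assoc, h.up_mul_down (by omega), up_succ' t r,
      down_succ', pow_succ']
    simp only [mul_assoc]

theorem up_pow_mul (h : IsBraidFamily n t) {i k : ℕ} (hik : i + k < n) :
    up t n ^ k * t i = t (i + k) * up t n ^ k := by
  induction k with
  | zero => simp
  | succ k ih =>
    rw [pow_succ', mul_assoc, ih (by omega), ← mul_assoc, h.up_mul (by omega) le_rfl, mul_assoc]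
    rfl

theorem up_sq_mul (h : IsBraidFamily (r + 1) t) :
    up t (r + 1) ^ 2 * t r = t 0 * up t (r + 1) ^ 2 := by
  have h2 : up t (r + 1) ^ 2 = up (BraidFamily.shift t) r * up t (r + 1) * t r := by
    rw [← h.up_mul_up (by omega), mul_assoc, ← up_succ, pow_two]
  conv_rhs => rw [h2, ← mul_assoc, ← mul_assoc, ← up_succ', ← pow_two]

theorem up_pow_comm (h : IsBraidFamily (r + 1) t) {i : ℕ} (hi : i ≤ r) :
    up t (r + 1) ^ (r + 2) * t i = t i * up t (r + 1) ^ (r + 2) := by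
  have h1 := h.up_pow_mul (i := i) (k := r - i) (by omega)
  have h2 := h.up_pow_mul (i := 0) (k := i) (by omega)
  rw [show i + (r - i) = r by omega] at h1
  rw [zero_add] at h2
  rw [show r + 2 = i + 2 + (r - i) by omega, pow_add _ (i + 2), pow_add, mul_assoc, h1,
    mul_assoc, ← mul_assoc (_ ^ 2), h.up_sq_mul]
  simp only [← mul_assoc]
  rw [h2]

theorem mul_eq_up_pow (h : IsBraidFamily (r + 1) t) {i k : ℕ} (hi : i ≤ r) (hk : i < k) :
    t i * (up t (r + 1) ^ i * up (BraidFamily.shift t) r * up t (r + 1) ^ (k - i - 1)) =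
      up t (r + 1) ^ k := by
  have h2 := h.up_pow_mul (i := 0) (k := i) (by omega)
  rw [zero_add] at h2
  rw [← mul_assoc, ← mul_assoc, ← h2, mul_assoc (_ ^ i), ← up_succ', ← pow_succ, ← pow_add]
  congr 1
  omega

theorem up_pow_eq (h : IsBraidFamily (r + 1) t) :
    up t (r + 1) ^ (r + 2) =
      up t (r + 1) * down t (r + 1) * up (BraidFamily.shift t) r ^ (r + 1) := by
  rw [pow_succ', h.up_pow le_rfl, mul_assoc]

theorem up_mul_down_comm (h : IsBraidFamily (r + 1) t) {i : ℕ} (hi : i < r) :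
    up t (r + 1) * down t (r + 1) * t (i + 1) = t (i + 1) * (up t (r + 1) * down t (r + 1)) := by
  rw [mul_assoc, h.down_mul (by omega) le_rfl, ← mul_assoc, h.up_mul (by omega) le_rfl, mul_assoc]

end IsBraidFamily

end Monoid

end BraidFamily

namespace BraidFamily

section Group

variable {G : Type*} [Group G]

/-- The submonoid generated by the `t i` with `i ∈ I`. -/
def W (t : ℕ → G) (I : Set ℕ) : Submonoid G := Submonoid.closure (t '' I)

/-- The submonoid generated by `t 0, …, t (n - 1)`. -/
abbrev Wfull (t : ℕ → G) (n : ℕ) : Submonoid G := W t {i | i < n}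

/-- The elements `t 0, …, t (n - 1)` of a group are weight one generators of a monoid which has
the divisibility properties of the braid monoid. -/
structure IsBraidBasis (n : ℕ) (t : ℕ → G) : Prop extends IsBraidFamily n t where
  deg : ∃ f : G → ℤ, (∀ x y, f (x * y) = f x + f y) ∧ ∀ i < n, f (t i) = 1
  far : ∀ i j x y, i + 2 ≤ j → j < n → x ∈ Wfull t n → y ∈ Wfull t n →
    x * t i = y * t j → ∃ z ∈ Wfull t n, x = z * t j ∧ y = z * t i
  near : ∀ i x y, i + 1 < n → x ∈ Wfull t n → y ∈ Wfull t n →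
    x * t i = y * t (i + 1) →
      ∃ z ∈ Wfull t n, x = z * t i * t (i + 1) ∧ y = z * t (i + 1) * t i

end Group

end BraidFamily

namespace BraidOrder

open ArtinMonoid BraidFamily

/-- The path graph, which is the Coxeter graph of the braid group. -/
def pathGraph (n : ℕ) : SimpleGraph (Fin n) where
  Adj i j := (i : ℕ) + 1 = j ∨ (j : ℕ) + 1 = i
  symm := ⟨fun _ _ h => h.symm⟩
  loopless := ⟨fun i h => by omega⟩

theorem gen_of_lt {n i : ℕ} (h : i < n) : gen n i = PresentedGroup.of ⟨i, h⟩ := dif_pos h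

theorem isBraidFamily_gen (n : ℕ) : IsBraidFamily n (gen n) where
  comm i j hij hj := by
    rw [gen_of_lt (show i < n by omega), gen_of_lt hj, ← mul_inv_eq_one]
    exact PresentedGroup.one_of_mem ⟨⟨i, by omega⟩, ⟨j, hj⟩, .inr ⟨hij, rfl⟩⟩
  braid i hi := by
    rw [gen_of_lt (show i < n by omega), gen_of_lt hi, ← mul_inv_eq_one]
    exact PresentedGroup.one_of_mem ⟨⟨i, by omega⟩, ⟨i + 1, hi⟩, .inl ⟨rfl, rfl⟩⟩

theorem lift_braidRel {K : Type*} [Group K] {n : ℕ} {t : ℕ → K}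
    (h : IsBraidFamily n t) : ∀ r ∈ braidRel n, FreeGroup.lift (fun i : Fin n => t i) r = 1 := by
  rintro r ⟨i, j, ⟨hij, rfl⟩ | ⟨hij, rfl⟩⟩
  · have := h.braid i (by omega)
    rw [hij] at this
    rw [map_mul, map_inv, mul_inv_eq_one]
    simpa using this
  · rw [map_mul, map_inv, mul_inv_eq_one]
    simpa using h.comm i j hij j.2

theorem exists_degree (n : ℕ) :
    ∃ f : Braid n → ℤ, (∀ x y, f (x * y) = f x + f y) ∧ ∀ i < n, f (gen n i) = 1 := by
  have h : IsBraidFamily n fun _ => Multiplicative.ofAdd (1 : ℤ) := ⟨by simp, by simp⟩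
  refine ⟨fun x => (PresentedGroup.toGroup (lift_braidRel h) x).toAdd,
    fun x y => by simp, fun i hi => ?_⟩
  simp [gen_of_lt hi]

/-- The generators of the braid monoid. -/
def monGen (n i : ℕ) : Mon (pathGraph n) := if h : i < n then σ (pathGraph n) ⟨i, h⟩ else 1

theorem monGen_of_lt {n i : ℕ} (h : i < n) : monGen n i = σ (pathGraph n) ⟨i, h⟩ := dif_pos h

theorem isBraidFamily_monGen (n : ℕ) : IsBraidFamily n (monGen n) where
  comm i j hij hj := by
    rw [monGen_of_lt (show i < n by omega), monGen_of_lt hj]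
    refine σ_comm ?_
    simp only [pathGraph]
    omega
  braid i hi := by
    rw [monGen_of_lt (show i < n by omega), monGen_of_lt hi]
    exact σ_braid (.inl rfl)

/-- The canonical map from the braid monoid to the braid group. -/
def monHom (n : ℕ) : Mon (pathGraph n) →* Braid n :=
  PresentedMonoid.lift (fun i : Fin n => gen n i) <| by
    rintro u v ⟨i, j, ⟨h, rfl, rfl⟩ | ⟨h, rfl, rfl⟩⟩
    · rcases h with h | h
      · simpa [h] using (isBraidFamily_gen n).braid i (by omega)
      · simpa [h] using ((isBraidFamily_gen n).braid j (by omega)).symm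
    · simp only [pathGraph] at h
      rcases lt_trichotomy (i : ℕ) j with hij | hij | hij
      · simpa using (isBraidFamily_gen n).comm i j (by omega) j.2
      · simp [hij]
      · simpa using ((isBraidFamily_gen n).comm j i (by omega) i.2).symm

theorem monHom_σ {n : ℕ} (i : Fin n) : monHom n (σ (pathGraph n) i) = gen n i :=
  PresentedMonoid.lift_of _ _

theorem pathGraph_triangle_free {n : ℕ} (i j k : Fin n) (hij : (pathGraph n).Adj i j)
    (hjk : (pathGraph n).Adj j k) : ¬ (pathGraph n).Adj i k := by
  simp only [pathGraph] at *
  omega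

theorem monHom_injective (n : ℕ) : Function.Injective (monHom n) := by
  obtain ⟨K, _, f, hf⟩ : ∃ (K : Type) (_ : Group K) (f : Mon (pathGraph n) →* K),
      Function.Injective f := by
    have hcl := PresentedMonoid.closure_range_of (rel (pathGraph n))
    cases n with
    | zero =>
      refine ⟨Unit, inferInstance, 1, fun x y _ => ?_⟩
      have h1 : ∀ z : Mon (pathGraph 0), z = 1 := fun z => by
        have hz : z ∈ Submonoid.closure (Set.range (σ (pathGraph 0))) := by
          rw [hcl]
          trivial
        rwa [Set.range_eq_empty, Submonoid.closure_empty, Submonoid.mem_bot] at hz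
      rw [h1 x, h1 y]
    | succ r =>
      have hQ := isBraidFamily_monGen (r + 1)
      refine exists_injective_hom_group
        (fun x y z h => ArtinMonoid.mul_right_cancel' pathGraph_triangle_free h) hcl
        (Δ := up (monGen (r + 1)) (r + 1) ^ (r + 2)) (fun x => ?_) ?_
      · have hx : x ∈ Submonoid.closure (Set.range (σ (pathGraph (r + 1)))) := by
          rw [hcl]
          trivial
        induction hx using Submonoid.closure_induction with
        | mem x hx =>
          obtain ⟨i, rfl⟩ := hx
          rw [← monGen_of_lt i.2]
          exact hQ.up_pow_comm (by omega)
        | one => simp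
        | mul x y _ _ hx hy => rw [← mul_assoc, hx, mul_assoc, hy, mul_assoc]
      · rintro _ ⟨i, rfl⟩
        have := hQ.mul_eq_up_pow (i := i) (k := r + 2) (by omega) (by omega)
        rw [monGen_of_lt i.2] at this
        exact ⟨_, this⟩
  have hK : IsBraidFamily n (fun i => f (monGen n i)) :=
    ⟨fun i j hij hj => by
      simpa only [map_mul] using congrArg f ((isBraidFamily_monGen n).comm i j hij hj),
     fun i hi => by
      simpa only [map_mul] using congrArg f ((isBraidFamily_monGen n).braid i hi)⟩
  have hcomp : (PresentedGroup.toGroup (lift_braidRel hK)).comp (monHom n) = f := by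
    refine PresentedMonoid.ext _ fun i => ?_
    rw [MonoidHom.comp_apply, monHom_σ, gen_of_lt i.2, PresentedGroup.toGroup.of,
      monGen_of_lt i.2]
  refine Function.Injective.of_comp (f := PresentedGroup.toGroup (lift_braidRel hK)) ?_
  rw [← MonoidHom.coe_comp, hcomp]
  exact hf

theorem W_gen_eq_mrange (n : ℕ) : Wfull (gen n) n = MonoidHom.mrange (monHom n) := by
  rw [MonoidHom.mrange_eq_map, ← PresentedMonoid.closure_range_of, MonoidHom.map_mclosure, Wfull,
    W, ← Set.range_comp]
  congr 1
  ext x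
  constructor
  · rintro ⟨i, hi, rfl⟩
    exact ⟨⟨i, hi⟩, monHom_σ _⟩
  · rintro ⟨i, rfl⟩
    exact ⟨i, i.2, (monHom_σ _).symm⟩

theorem commonMul_gen {n : ℕ} {x y : Braid n} (hx : x ∈ Wfull (gen n) n)
    (hy : y ∈ Wfull (gen n) n) (i j : Fin n) (h : x * gen n i = y * gen n j) :
    ∃ x' y', monHom n x' = x ∧ monHom n y' = y ∧
      CommonMul (pathGraph n) (σ (pathGraph n)) x' i y' j := by
  rw [W_gen_eq_mrange] at hx hy
  obtain ⟨x, rfl⟩ := hx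
  obtain ⟨y, rfl⟩ := hy
  refine ⟨x, y, rfl, rfl, commonMul_of_mul_eq pathGraph_triangle_free _ _ _ _ ?_⟩
  refine monHom_injective n ?_
  rw [map_mul, map_mul, monHom_σ, monHom_σ, h]

theorem isBraidBasis_gen (n : ℕ) : IsBraidBasis n (gen n) where
  toIsBraidFamily := isBraidFamily_gen n
  deg := exists_degree n
  far i j x y hij hj hx hy h := by
    obtain ⟨x, y, rfl, rfl, hc⟩ := commonMul_gen hx hy ⟨i, by omega⟩ ⟨j, hj⟩ h
    obtain ⟨z, rfl, rfl⟩ := hc.of_not_adj (by simp; omega) (by simp only [pathGraph]; omega)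
    rw [map_mul, map_mul, monHom_σ, monHom_σ]
    exact ⟨_, W_gen_eq_mrange n ▸ ⟨z, rfl⟩, rfl, rfl⟩
  near i x y hi hx hy h := by
    obtain ⟨x, y, rfl, rfl, hc⟩ := commonMul_gen hx hy ⟨i, by omega⟩ ⟨i + 1, hi⟩ h
    obtain ⟨z, rfl, rfl⟩ := hc.of_adj (.inl rfl)
    simp only [map_mul, monHom_σ]
    exact ⟨_, W_gen_eq_mrange n ▸ ⟨z, rfl⟩, rfl, rfl⟩

end BraidOrder

namespace BraidFamily

section Basis

variable {G : Type*} [Group G] {t : ℕ → G} {n : ℕ}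

theorem mem_W {I : Set ℕ} {i : ℕ} (hi : i ∈ I) : t i ∈ W t I :=
  Submonoid.subset_closure ⟨i, hi, rfl⟩

theorem W_mono {I J : Set ℕ} (h : I ⊆ J) : W t I ≤ W t J :=
  Submonoid.closure_mono (Set.image_mono h)

theorem W_induction {I : Set ℕ} {P : G → Prop} (one : P 1)
    (mul : ∀ x ∈ W t I, ∀ i ∈ I, P x → P (x * t i)) {x : G} (hx : x ∈ W t I) : P x := by
  induction hx using Submonoid.closure_induction_right with
  | one => exact one
  | mul_right x hx s hs ih =>
    obtain ⟨i, hi, rfl⟩ := hs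
    exact mul x hx i hi ih

theorem W_eq_one_or {I : Set ℕ} {x : G} (hx : x ∈ W t I) :
    x = 1 ∨ ∃ y ∈ W t I, ∃ i ∈ I, x = y * t i :=
  W_induction (P := fun x => x = 1 ∨ ∃ y ∈ W t I, ∃ i ∈ I, x = y * t i) (.inl rfl)
    (fun x hx i hi _ => .inr ⟨x, hx, i, hi, rfl⟩) hx

/-- No `t i` with `i ∈ I` right-divides `a`. -/
def Reduced (t : ℕ → G) (n : ℕ) (I : Set ℕ) (a : G) : Prop :=
  ∀ i ∈ I, ∀ x ∈ Wfull t n, a ≠ x * t i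

namespace IsBraidBasis

variable (h : IsBraidBasis n t)

/-- The degree of an element, with respect to which all generators have weight one. -/
noncomputable def degree : G → ℤ := h.deg.choose

theorem degree_mul (x y : G) : h.degree (x * y) = h.degree x + h.degree y :=
  h.deg.choose_spec.1 x y

theorem degree_gen {i : ℕ} (hi : i < n) : h.degree (t i) = 1 := h.deg.choose_spec.2 i hi

theorem degree_one : h.degree 1 = 0 := by
  have := h.degree_mul 1 1
  rw [mul_one] at this
  omega

theorem degree_nonneg {x : G} (hx : x ∈ Wfull t n) : 0 ≤ h.degree x :=
  W_induction (P := fun x => 0 ≤ h.degree x) h.degree_one.ge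
    (fun x _ i hi ih => by rw [h.degree_mul, h.degree_gen hi]; omega) hx

theorem mul_gen_ne_one (h : IsBraidBasis n t)
    {x : G} (hx : x ∈ Wfull t n) {i : ℕ} (hi : i < n) : x * t i ≠ 1 := by
  intro h1
  have h2 := congrArg h.degree h1
  rw [h.degree_mul, h.degree_gen hi, h.degree_one] at h2
  have := h.degree_nonneg hx
  omega

theorem eq_one_of_mul_eq_one (h : IsBraidBasis n t)
    {x y : G} (hx : x ∈ Wfull t n) (hy : y ∈ Wfull t n)
    (hxy : x * y = 1) : y = 1 := by
  rcases W_eq_one_or hy with rfl | ⟨z, hz, i, hi, rfl⟩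
  · rfl
  · rw [← mul_assoc] at hxy
    exact absurd hxy (h.mul_gen_ne_one (mul_mem hx hz) hi)

theorem far' (h : IsBraidBasis n t)
    {i j : ℕ} {x y : G} (hij : i + 2 ≤ j ∨ j + 2 ≤ i) (hi : i < n) (hj : j < n)
    (hx : x ∈ Wfull t n) (hy : y ∈ Wfull t n) (hxy : x * t i = y * t j) :
    ∃ z ∈ Wfull t n, x = z * t j ∧ y = z * t i := by
  rcases hij with hij | hij
  · exact h.far i j x y hij hj hx hy hxy
  · obtain ⟨z, hz, h1, h2⟩ := h.far j i y x hij hi hy hx hxy.symm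
    exact ⟨z, hz, h2, h1⟩

theorem exists_of_mul_gen_eq (h : IsBraidBasis n t)
    {I : Set ℕ} (hI : ∀ i ∈ I, i < n) {i j : ℕ} (hi : i ∈ I) (hj : j ∈ I)
    {x y : G} (hx : x ∈ Wfull t n) (hy : y ∈ Wfull t n) (hxy : x * t i = y * t j) :
    ∃ z ∈ Wfull t n, ∃ p ∈ W t I, ∃ q ∈ W t I, x = z * p ∧ y = z * q := by
  have hin := hI i hi
  have hjn := hI j hj
  have hti : t i ∈ W t I := mem_W hi
  have htj : t j ∈ W t I := mem_W hj
  rcases eq_or_ne i j with rfl | hne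
  · exact ⟨x, hx, 1, one_mem _, 1, one_mem _, by simp, by simpa using (mul_right_cancel hxy).symm⟩
  by_cases hfar : i + 2 ≤ j ∨ j + 2 ≤ i
  · obtain ⟨z, hz, h1, h2⟩ := h.far' hfar hin hjn hx hy hxy
    exact ⟨z, hz, _, htj, _, hti, h1, h2⟩
  obtain rfl | rfl : j = i + 1 ∨ i = j + 1 := by omega
  · obtain ⟨z, hz, h1, h2⟩ := h.near i x y hjn hx hy hxy
    exact ⟨z, hz, _, mul_mem hti htj, _, mul_mem htj hti, by rw [h1, mul_assoc],
      by rw [h2, mul_assoc]⟩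
  · obtain ⟨z, hz, h1, h2⟩ := h.near j y x hin hy hx hxy.symm
    exact ⟨z, hz, _, mul_mem hti htj, _, mul_mem htj hti, by rw [h2, mul_assoc],
      by rw [h1, mul_assoc]⟩

/-- Common multiples of elements of a parabolic submonoid may be formed within it. -/
theorem exists_of_mul_eq (h : IsBraidBasis n t) {I : Set ℕ} (hI : ∀ i ∈ I, i < n) {x y b c : G}
    (hx : x ∈ Wfull t n) (hy : y ∈ Wfull t n) (hb : b ∈ W t I) (hc : c ∈ W t I)
    (hxy : x * b = y * c) :
    ∃ u ∈ Wfull t n, ∃ e ∈ W t I, ∃ f ∈ W t I, x = u * e ∧ y = u * f := by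
  obtain ⟨N, hN⟩ : ∃ N : ℕ, h.degree (x * b) < N :=
    ⟨(h.degree (x * b)).toNat + 1, by push_cast; omega⟩
  have hsub : W t I ≤ Wfull t n := W_mono hI
  induction N generalizing x y b c with
  | zero =>
    have := h.degree_nonneg (mul_mem hx (hsub hb))
    push_cast at hN
    omega
  | succ N ih =>
    push_cast at hN
    rcases W_eq_one_or hb with rfl | ⟨b, hb', i, hi, rfl⟩
    · exact ⟨y, hy, c, hc, 1, one_mem _, by simpa using hxy, by simp⟩
    rcases W_eq_one_or hc with rfl | ⟨c, hc', j, hj, rfl⟩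
    · exact ⟨x, hx, 1, one_mem _, _, hb, by simp, by simpa using hxy.symm⟩
    rw [← mul_assoc] at hN hxy
    rw [← mul_assoc] at hxy
    rw [h.degree_mul, h.degree_gen (hI i hi)] at hN
    have hN' : h.degree (y * c) = h.degree (x * b) := by
      have := congrArg h.degree hxy
      rw [h.degree_mul, h.degree_gen (hI i hi), h.degree_mul _ (t j),
        h.degree_gen (hI j hj)] at this
      omega
    obtain ⟨z, hz, p, hp, q, hq, h1, h2⟩ := h.exists_of_mul_gen_eq hI hi hj
      (mul_mem hx (hsub hb')) (mul_mem hy (hsub hc')) hxy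
    obtain ⟨u₁, hu₁, e₁, he₁, f₁, hf₁, rfl, h3⟩ := ih hx hz hb' hp h1 (by omega)
    obtain ⟨u₂, hu₂, e₂, he₂, f₂, hf₂, rfl, h4⟩ := ih hy hz hc' hq h2 (by omega)
    obtain ⟨u, hu, e, he, f, hf, rfl, rfl⟩ := ih hu₁ hu₂ hf₁ hf₂ (h3.symm.trans h4) (by
      have := h.degree_nonneg (hsub hp)
      rw [h1, h.degree_mul] at hN
      rw [← h3]
      omega)
    exact ⟨u, hu, _, mul_mem he he₁, _, mul_mem hf he₂, by rw [mul_assoc], by rw [mul_assoc]⟩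

theorem exists_eq_mul_of_reduced (h : IsBraidBasis n t)
    {I : Set ℕ} (hI : ∀ i ∈ I, i < n) {a x b c : G}
    (ha : a ∈ Wfull t n) (hred : Reduced t n I a) (hx : x ∈ Wfull t n) (hb : b ∈ W t I)
    (hc : c ∈ W t I) (hab : a * b = x * c) : ∃ f ∈ W t I, x = a * f ∧ b = f * c := by
  obtain ⟨u, hu, e, he, f, hf, rfl, rfl⟩ := h.exists_of_mul_eq hI ha hx hb hc hab
  rcases W_eq_one_or he with rfl | ⟨e, he', i, hi, rfl⟩
  · refine ⟨f, hf, by rw [mul_one], ?_⟩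
    rw [mul_one, mul_assoc] at hab
    exact mul_left_cancel hab
  · exact absurd (mul_assoc _ _ _).symm (hred i hi (u * e) (mul_mem hu (W_mono hI he')))

theorem exists_reduced_mul (h : IsBraidBasis n t)
    {I : Set ℕ} (hI : ∀ i ∈ I, i < n) {z : G} (hz : z ∈ Wfull t n) :
    ∃ a ∈ Wfull t n, Reduced t n I a ∧ ∃ b ∈ W t I, z = a * b := by
  obtain ⟨N, hN⟩ : ∃ N : ℕ, h.degree z < N := ⟨(h.degree z).toNat + 1, by push_cast; omega⟩
  induction N generalizing z with
  | zero =>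
    have := h.degree_nonneg hz
    push_cast at hN
    omega
  | succ N ih =>
    by_cases hred : Reduced t n I z
    · exact ⟨z, hz, hred, 1, one_mem _, by simp⟩
    · simp only [Reduced, not_forall, not_not] at hred
      obtain ⟨i, hi, x, hx, rfl⟩ := hred
      rw [h.degree_mul, h.degree_gen (hI i hi)] at hN
      push_cast at hN
      obtain ⟨a, ha, hred, b, hb, rfl⟩ := ih hx (by omega)
      exact ⟨a, ha, hred, _, mul_mem hb (mem_W hi), by rw [mul_assoc]⟩

open GarsideOrder in
theorem tail_eq (h : IsBraidBasis n t)
    {I : Set ℕ} (hI : ∀ i ∈ I, i < n) {a b : G} (ha : a ∈ Wfull t n)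
    (hred : Reduced t n I a) (hb : b ∈ W t I) : tail (Wfull t n) (W t I) (a * b) = b := by
  have hsub : W t I ≤ Wfull t n := W_mono hI
  have hdiv : ∀ c ∈ W t I, leR (Wfull t n) c (a * b) → leR (Wfull t n) c b := by
    intro c hc hcab
    obtain ⟨f, hf, -, rfl⟩ := h.exists_eq_mul_of_reduced hI ha hred hcab hb hc (by simp)
    simpa [leR] using hsub hf
  have hex : ∃ b' : G, b' ∈ W t I ∧ {c : G | c ∈ W t I ∧ leR (Wfull t n) c (a * b)} =
      {c : G | c ∈ W t I ∧ leR (Wfull t n) c b'} := by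
    refine ⟨b, hb, Set.ext fun c => ⟨fun hc => ⟨hc.1, hdiv c hc.1 hc.2⟩, fun hc => ⟨hc.1, ?_⟩⟩⟩
    simpa [leR, mul_assoc] using mul_mem ha hc.2
  rw [tail, dif_pos hex]
  obtain ⟨hb', heq⟩ := hex.choose_spec
  set b' := hex.choose
  have h1 : b' ∈ {c : G | c ∈ W t I ∧ leR (Wfull t n) c b'} := ⟨hb', by simp [leR, one_mem]⟩
  have h2 : b ∈ {c : G | c ∈ W t I ∧ leR (Wfull t n) c (a * b)} := ⟨hb, by simpa [leR] using ha⟩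
  rw [← heq] at h1
  rw [heq] at h2
  have h3 := h.eq_one_of_mul_eq_one (hdiv _ hb' h1.2) h2.2 (by simp)
  exact mul_inv_eq_one.1 h3

/-- Divisors of the multiples of `t (m - 1) * ⋯ * t 0`. -/
theorem exists_of_mul_down_eq_far (h : IsBraidBasis n t)
    {m i : ℕ} (hmi : m + 1 ≤ i) (hi : i < n) {x z : G}
    (hx : x ∈ Wfull t n) (hz : z ∈ Wfull t n) (hxz : x * down t m = z * t i) :
    ∃ y ∈ Wfull t n, x = y * t i := by
  induction m generalizing x with
  | zero => exact ⟨z, hz, by simpa [down] using hxz⟩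
  | succ m ih =>
    have hm : m < n := by omega
    rw [down_succ, ← mul_assoc] at hxz
    obtain ⟨y, hy, hxy⟩ := ih (by omega) (mul_mem hx (mem_W hm)) hxz
    obtain ⟨w, hw, h1, -⟩ := h.far' (.inl (by omega)) hm hi hx hy hxy
    exact ⟨w, hw, h1⟩

theorem exists_of_mul_down_eq_near (h : IsBraidBasis n t) {m : ℕ} (hm : m + 1 < n) {x z : G}
    (hx : x ∈ Wfull t n) (hz : z ∈ Wfull t n) (hxz : x * down t (m + 1) = z * t (m + 1)) :
    ∃ y ∈ Wfull t n, x = y * t m * t (m + 1) := by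
  rw [down_succ, ← mul_assoc] at hxz
  obtain ⟨y, hy, hxy⟩ := h.exists_of_mul_down_eq_far le_rfl hm
    (mul_mem hx (mem_W (show m < n by omega))) hz hxz
  obtain ⟨w, hw, h1, -⟩ := h.near m x y hm hx hy hxy
  exact ⟨w, hw, h1⟩

theorem exists_of_mul_down_eq (h : IsBraidBasis n t)
    {m i : ℕ} (him : i + 1 < m) (hm : m ≤ n) {x z : G}
    (hx : x ∈ Wfull t n) (hz : z ∈ Wfull t n) (hxz : x * down t m = z * t (i + 1)) :
    ∃ y ∈ Wfull t n, x = y * t i := by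
  induction m generalizing x with
  | zero => omega
  | succ m ih =>
    have hmn : m < n := by omega
    rw [down_succ, ← mul_assoc] at hxz
    have hxm : x * t m ∈ Wfull t n := mul_mem hx (mem_W hmn)
    rcases Nat.lt_or_ge (i + 1) m with hlt | hge
    · obtain ⟨y, hy, hxy⟩ := ih hlt (by omega) hxm hxz
      obtain ⟨w, hw, h1, -⟩ := h.far' (.inr (by omega)) hmn (by omega) hx hy hxy
      exact ⟨w, hw, h1⟩
    · obtain rfl : m = i + 1 := by omega
      obtain ⟨y, hy, hxy⟩ := h.exists_of_mul_down_eq_near hmn hxm hz hxz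
      exact ⟨y, hy, mul_right_cancel hxy⟩

/-- Divisors of the multiples of `t 0 * ⋯ * t (m - 1)`. -/
theorem exists_of_mul_up_eq_far (h : IsBraidBasis n t)
    {m i : ℕ} (hmi : m + 1 ≤ i) (hi : i < n) {a x : G}
    (ha : a ∈ Wfull t n) (hx : x ∈ Wfull t n) (hax : a * up t m = x * t i) :
    ∃ y ∈ Wfull t n, a = y * t i := by
  induction m generalizing x with
  | zero => exact ⟨x, hx, by simpa [up] using hax⟩
  | succ m ih =>
    have hm : ∀ k < m, t k ∈ Wfull t n := fun k hk => mem_W (show k < n by omega)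
    rw [up_succ, ← mul_assoc] at hax
    obtain ⟨w, hw, h1, -⟩ := h.far' (.inl (by omega)) (by omega) hi (mul_mem ha (up_mem hm)) hx hax
    exact ih (by omega) hw h1

theorem exists_of_mul_up_eq (h : IsBraidBasis n t)
    {m k : ℕ} (hkm : k + 1 < m) (hm : m ≤ n) {a x : G}
    (ha : a ∈ Wfull t n) (hx : x ∈ Wfull t n) (hax : a * up t m = x * t k) :
    ∃ y ∈ Wfull t n, a = y * t (k + 1) := by
  induction m generalizing x with
  | zero => omega
  | succ m ih =>
    have hmem : a * up t m ∈ Wfull t n :=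
      mul_mem ha (up_mem fun k hk => mem_W (show k < n by omega))
    rw [up_succ, ← mul_assoc] at hax
    rcases Nat.lt_or_ge (k + 1) m with hlt | hge
    · obtain ⟨w, hw, h1, -⟩ := h.far' (.inr (by omega)) (by omega) (by omega) hmem hx hax
      exact ih hlt (by omega) hw h1
    · obtain rfl : m = k + 1 := by omega
      obtain ⟨w, hw, -, h1⟩ := h.near k x _ hm hx hmem hax.symm
      rw [up_succ, ← mul_assoc] at h1
      exact h.exists_of_mul_up_eq_far le_rfl hm ha hw (mul_right_cancel h1)

end IsBraidBasis

end Basis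

end BraidFamily

namespace BraidFamily

open scoped Pointwise

section Alternating

variable {G : Type*} [Group G]

/-- Products of `p` factors taken alternately from `X` and `Y`, the rightmost one from `X`. -/
def alt : ℕ → Submonoid G → Submonoid G → Set G
  | 0, _, _ => {1}
  | p + 1, X, Y => alt p Y X * (X : Set G)

variable {X Y : Submonoid G} {p q : ℕ} {a b x : G}

theorem mul_mem_alt_succ (ha : a ∈ alt p Y X) (hx : x ∈ X) : a * x ∈ alt (p + 1) X Y :=
  ⟨a, ha, x, hx, rfl⟩

theorem mem_alt_succ_of_mem (ha : a ∈ alt p Y X) : a ∈ alt (p + 1) X Y :=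
  ⟨a, ha, 1, X.one_mem, mul_one a⟩

theorem alt_mul_mem (ha : a ∈ alt (p + 1) X Y) (hx : x ∈ X) : a * x ∈ alt (p + 1) X Y := by
  obtain ⟨c, hc, y, hy, rfl⟩ := ha
  exact ⟨c, hc, y * x, X.mul_mem hy hx, (mul_assoc _ _ _).symm⟩

theorem alt_subset_succ : alt p X Y ⊆ alt (p + 1) X Y := by
  induction p generalizing X Y with
  | zero =>
    rintro _ rfl
    exact ⟨1, rfl, 1, X.one_mem, mul_one 1⟩
  | succ p ih => exact Set.mul_subset_mul_right ih

theorem alt_mono (hpq : p ≤ q) : alt p X Y ⊆ alt q X Y := by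
  induction hpq with
  | refl => exact subset_rfl
  | step _ ih => exact ih.trans alt_subset_succ

theorem alt_subset {M : Submonoid G} (hX : X ≤ M) (hY : Y ≤ M) : alt p X Y ⊆ M := by
  induction p generalizing X Y with
  | zero =>
    rintro _ rfl
    exact M.one_mem
  | succ p ih =>
    rintro _ ⟨c, hc, x, hx, rfl⟩
    exact M.mul_mem (ih hY hX hc) (hX hx)

end Alternating

section Basis

variable {G : Type*} [Group G]

/-- The submonoid generated by `t 1, …, t (n - 1)`. -/
abbrev Whigh (t : ℕ → G) (n : ℕ) : Submonoid G := W t {i | 1 ≤ i ∧ i < n}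

/-- The submonoid generated by `t 0, …, t (n - 2)`. -/
abbrev Wlow (t : ℕ → G) (n : ℕ) : Submonoid G := W t {i | i + 1 < n}

/-- The family `t 0, …, t (n - 1)` in reverse order. -/
def flip (t : ℕ → G) (n i : ℕ) : G := t (n - 1 - i)

variable {t : ℕ → G} {n : ℕ}

theorem W_flip {I J : Set ℕ} (hIJ : ∀ i ∈ I, n - 1 - i ∈ J)
    (hJI : ∀ j ∈ J, n - 1 - j ∈ I ∧ j < n) : W (flip t n) I = W t J := by
  unfold W
  congr 1
  ext x
  constructor
  · rintro ⟨i, hi, rfl⟩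
    exact ⟨_, hIJ i hi, rfl⟩
  · rintro ⟨j, hj, rfl⟩
    obtain ⟨h1, h2⟩ := hJI j hj
    refine ⟨_, h1, ?_⟩
    rw [flip]
    congr 1
    omega

theorem Wfull_flip : Wfull (flip t n) n = Wfull t n :=
  W_flip (fun i hi => by simp only [Set.mem_ofPred_eq] at *; omega)
    (fun i hi => by simp only [Set.mem_ofPred_eq] at *; omega)

theorem Whigh_flip : Whigh (flip t n) n = Wlow t n :=
  W_flip (fun i hi => by simp only [Set.mem_ofPred_eq] at *; omega)
    (fun i hi => by simp only [Set.mem_ofPred_eq] at *; omega)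

theorem Wlow_flip : Wlow (flip t n) n = Whigh t n :=
  W_flip (fun i hi => by simp only [Set.mem_ofPred_eq] at *; omega)
    (fun i hi => by simp only [Set.mem_ofPred_eq] at *; omega)

theorem Whigh_le : Whigh t n ≤ Wfull t n := W_mono fun _ hi => hi.2

theorem Wlow_le : Wlow t n ≤ Wfull t n := W_mono fun i hi => by
  simp only [Set.mem_ofPred_eq] at *; omega

theorem mem_of_forall_mul_gen_mem {C : Set G}
    (hC : ∀ x ∈ Wfull t n, ∀ i < n, x * t i ∈ C → x ∈ C) {x b : G} (hx : x ∈ Wfull t n)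
    (hb : b ∈ Wfull t n) (hxb : x * b ∈ C) : x ∈ C := by
  refine W_induction (P := fun b => x * b ∈ C → x ∈ C) (by simp) (fun b hb i hi ih hxb => ?_)
    hb hxb
  rw [← mul_assoc] at hxb
  exact ih (hC _ (mul_mem hx hb) i hi hxb)

namespace IsBraidBasis

theorem flip (h : IsBraidBasis n t) : IsBraidBasis n (flip t n) where
  comm i j hij hj := (h.comm _ _ (by omega) (by omega)).symm
  braid i hi := by
    have := h.braid (n - 1 - (i + 1)) (by omega)
    rw [show n - 1 - (i + 1) + 1 = n - 1 - i by omega] at this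
    exact this.symm
  deg := by
    obtain ⟨f, hf, hf'⟩ := h.deg
    exact ⟨f, hf, fun i hi => hf' _ (by omega)⟩
  far i j x y hij hj hx hy hxy := by
    rw [Wfull_flip] at *
    exact h.far' (.inr (by omega)) (by omega) (by omega) hx hy hxy
  near i x y hi hx hy hxy := by
    rw [Wfull_flip] at *
    have hi' : n - 1 - (i + 1) + 1 = n - 1 - i := by omega
    obtain ⟨z, hz, h1, h2⟩ := h.near (n - 1 - (i + 1)) y x (by omega) hy hx
      (by rw [hi']; exact hxy.symm)
    rw [hi'] at h1 h2
    exact ⟨z, hz, h2, h1⟩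

theorem gen_mul_comm (h : IsBraidBasis n t) {j i : ℕ} (hj : j + 1 ≤ i) (hi : i < n) {v : G}
    (hv : v ∈ W t {k | k < j}) : t i * v = v * t i :=
  W_induction (P := fun v => t i * v = v * t i) (by simp) (fun v _ k hk ih => by
    simp only [Set.mem_ofPred_eq] at hk
    rw [← mul_assoc, ih, mul_assoc, ← h.comm k i (by omega) hi, mul_assoc]) hv

theorem gen_mul_gen_mul_down (h : IsBraidBasis n t) {j : ℕ} (hj : j + 1 < n) :
    t j * t (j + 1) * down t (j + 1) = down t (j + 2) * t (j + 1) := by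
  rw [h.down_mul (by omega) (by omega), down_succ t (j + 1), mul_assoc]

theorem mul_mem_of_mul_eq_mul_down (h : IsBraidBasis n t) {C : Set G} (hCM : C ⊆ Wfull t n)
    (hdiv : ∀ x ∈ Wfull t n, ∀ b ∈ Wfull t n, x * b ∈ C → x ∈ C)
    (hC : (∀ x ∈ C, ∀ y ∈ Wlow t n, x * y ∈ C) ∨ C = {1}) {y c x v₀ v₁ : G} {j : ℕ} (hj : j < n)
    (hy : y ∈ Whigh t n) (hc : c ∈ C) (hx : x ∈ Wfull t n) (hv₀ : v₀ ∈ W t {k | k < j})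
    (hv₁ : v₁ ∈ Whigh t n) (hcy : c * y = x * down t (j + 1)) :
    x * (v₀ * v₁) ∈ C * (Whigh t n : Set G) := by
  refine W_induction (P := fun y => ∀ x j v₀ v₁, j < n → x ∈ Wfull t n → v₀ ∈ W t {k | k < j} →
    v₁ ∈ Whigh t n → c * y = x * down t (j + 1) → x * (v₀ * v₁) ∈ C * (Whigh t n : Set G))
    ?_ ?_ hy x j v₀ v₁ hj hx hv₀ hv₁ hcy
  · intro x j v₀ v₁ hj hx hv₀ hv₁ hcy
    have hd : down t (j + 1) ∈ Wfull t n := down_mem fun i hi => mem_W (show i < n by omega)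
    rcases hC with hC | rfl
    · rw [← mul_assoc]
      refine ⟨_, hC x (hdiv x hx _ hd ?_) v₀ (W_mono ?_ hv₀), v₁, hv₁, rfl⟩
      · rwa [← hcy, mul_one]
      · intro k hk
        simp only [Set.mem_ofPred_eq] at *
        omega
    · rw [mul_one, Set.mem_singleton_iff.1 hc, down_succ', ← mul_assoc] at hcy
      exact absurd hcy.symm (h.mul_gen_ne_one
        (mul_mem hx (down_mem fun i hi => mem_W (show i + 1 < n by omega))) (by omega))
  · rintro y hy i ⟨hi1, hi⟩ ih x j v₀ v₁ hj hx hv₀ hv₁ hcy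
    obtain ⟨i, rfl⟩ : ∃ k, i = k + 1 := ⟨i - 1, by omega⟩
    have hti : t (i + 1) ∈ Whigh t n := mem_W ⟨by omega, hi⟩
    have hz : c * y ∈ Wfull t n := mul_mem (hCM hc) (Whigh_le hy)
    rw [← mul_assoc] at hcy
    rcases lt_trichotomy i j with hij | rfl | hij
    · obtain ⟨x, hx', rfl⟩ := h.exists_of_mul_down_eq (by omega) hj hx hz hcy.symm
      rw [mul_assoc x, ← mul_assoc (t i)]
      refine ih x j _ v₁ hj hx' (mul_mem (mem_W hij) hv₀) hv₁ ?_
      rw [mul_assoc x, ← h.down_mul (by omega) hj, ← mul_assoc x] at hcy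
      exact mul_right_cancel hcy
    · obtain ⟨x, hx', rfl⟩ := h.exists_of_mul_down_eq_near hi hx hz hcy.symm
      rw [show x * t i * t (i + 1) * (v₀ * v₁) = x * (t i * v₀ * (t (i + 1) * v₁)) by
        rw [mul_assoc, ← mul_assoc (t (i + 1)), h.gen_mul_comm le_rfl hi hv₀]
        simp only [mul_assoc]]
      refine ih x (i + 1) _ _ hi hx' (mul_mem (mem_W (Nat.lt_succ_self i))
        (W_mono (fun k hk => Nat.lt_succ_of_lt hk) hv₀)) (mul_mem hti hv₁) ?_
      rw [mul_assoc x, mul_assoc x, h.gen_mul_gen_mul_down hi, ← mul_assoc x] at hcy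
      exact mul_right_cancel hcy
    · obtain ⟨x, hx', rfl⟩ := h.exists_of_mul_down_eq_far (by omega) hi hx hz hcy.symm
      rw [mul_assoc x, ← mul_assoc (t _), h.gen_mul_comm (by omega) hi hv₀, mul_assoc v₀]
      refine ih x j _ _ hj hx' hv₀ (mul_mem hti hv₁) ?_
      rw [mul_assoc x, ← h.down_comm (by omega) hi, ← mul_assoc x] at hcy
      exact mul_right_cancel hcy

theorem mem_alt_high_of_mul_gen_mem (h : IsBraidBasis n t) (p : ℕ) : ∀ x ∈ Wfull t n, ∀ i < n,
    x * t i ∈ alt p (Whigh t n) (Wlow t n) → x ∈ alt p (Whigh t n) (Wlow t n) := by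
  induction p generalizing t with
  | zero => exact fun x hx i hi hxi => absurd hxi (h.mul_gen_ne_one hx hi)
  | succ p ih =>
    rintro x hx i hi ⟨c, hc, y, hy, hcy⟩
    have hdiv : ∀ x ∈ Wfull t n, ∀ b ∈ Wfull t n,
        x * b ∈ alt p (Wlow t n) (Whigh t n) → x ∈ alt p (Wlow t n) (Whigh t n) := by
      have := ih h.flip
      rw [Wfull_flip, Whigh_flip, Wlow_flip] at this
      intro x hx b hb
      rw [← Wfull_flip] at hx hb
      refine mem_of_forall_mul_gen_mem ?_ hx hb
      rw [Wfull_flip]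
      exact this
    have hsub : alt p (Wlow t n) (Whigh t n) ⊆ (Wfull t n : Set G) := alt_subset Wlow_le Whigh_le
    rcases Nat.eq_zero_or_pos i with rfl | hpos
    · have := h.mul_mem_of_mul_eq_mul_down hsub hdiv ?_ hi hy hc hx (one_mem _) (one_mem _)
        (by simpa [down] using hcy)
      · simpa [alt] using this
      · cases p with
        | zero => exact .inr rfl
        | succ p => exact .inl fun x hx y hy => alt_mul_mem hx hy
    · obtain ⟨u, hu, e, he, f, hf, rfl, rfl⟩ := h.exists_of_mul_eq (fun i hi => hi.2)
        (hsub hc) hx hy (mem_W ⟨hpos, hi⟩) hcy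
      exact mul_mem_alt_succ (hdiv u hu e (Whigh_le he) hc) hf

theorem mem_alt_high_of_mul_mem (h : IsBraidBasis n t)
    {p : ℕ} {x b : G} (hx : x ∈ Wfull t n) (hb : b ∈ Wfull t n)
    (hxb : x * b ∈ alt p (Whigh t n) (Wlow t n)) : x ∈ alt p (Whigh t n) (Wlow t n) :=
  mem_of_forall_mul_gen_mem (h.mem_alt_high_of_mul_gen_mem p) hx hb hxb

theorem mem_alt_low_of_mul_mem (h : IsBraidBasis n t)
    {p : ℕ} {x b : G} (hx : x ∈ Wfull t n) (hb : b ∈ Wfull t n)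
    (hxb : x * b ∈ alt p (Wlow t n) (Whigh t n)) : x ∈ alt p (Wlow t n) (Whigh t n) := by
  have := h.flip.mem_alt_high_of_mul_mem (p := p) (x := x) (b := b)
  rw [Wfull_flip, Whigh_flip, Wlow_flip] at this
  exact this hx hb hxb

theorem mem_alt_low_of_reduced (h : IsBraidBasis n t) {p : ℕ} {x y : G} (hx : x ∈ Wfull t n)
    (hred : Reduced t n {i | 1 ≤ i ∧ i < n} x) (hy : y ∈ Whigh t n)
    (hxy : x * y ∈ alt (p + 1) (Whigh t n) (Wlow t n)) : x ∈ alt p (Wlow t n) (Whigh t n) := by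
  obtain ⟨c, hc, z, hz, hcz⟩ := hxy
  obtain ⟨f, hf, rfl, -⟩ := h.exists_eq_mul_of_reduced (fun i hi => hi.2) hx hred
    (alt_subset Wlow_le Whigh_le hc) hy hz hcz.symm
  exact h.mem_alt_low_of_mul_mem hx (Whigh_le hf) hc

theorem mem_alt_high_of_reduced (h : IsBraidBasis n t) {p : ℕ} {x y : G} (hx : x ∈ Wfull t n)
    (hred : Reduced t n {i | i + 1 < n} x) (hy : y ∈ Wlow t n)
    (hxy : x * y ∈ alt (p + 1) (Wlow t n) (Whigh t n)) : x ∈ alt p (Whigh t n) (Wlow t n) := by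
  obtain ⟨c, hc, z, hz, hcz⟩ := hxy
  obtain ⟨f, hf, rfl, -⟩ := h.exists_eq_mul_of_reduced (fun i hi => Nat.lt_of_succ_lt hi) hx hred
    (alt_subset Whigh_le Wlow_le hc) hy hz hcz.symm
  exact h.mem_alt_high_of_mul_mem hx (Wlow_le hf) hc

end IsBraidBasis

end Basis

end BraidFamily

namespace BraidFamily

open GarsideOrder

section Basis

variable {G : Type*} [Group G] {t : ℕ → G} {n r : ℕ}

theorem exists_alt_mem (hn : 2 ≤ n) {a : G} (ha : a ∈ Wfull t n) :
    ∃ p, a ∈ alt p (Whigh t n) (Wlow t n) := by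
  refine W_induction (P := fun a => ∃ p, a ∈ alt p (Whigh t n) (Wlow t n)) ⟨0, rfl⟩ ?_ ha
  rintro a ha i hi ⟨p, hp⟩
  simp only [Set.mem_ofPred_eq] at hi
  refine ⟨p + 2, ?_⟩
  rcases Nat.eq_zero_or_pos i with rfl | hpos
  · exact mem_alt_succ_of_mem (mul_mem_alt_succ hp (mem_W (show 0 + 1 < n by omega)))
  · exact mul_mem_alt_succ (mem_alt_succ_of_mem hp) (mem_W ⟨hpos, hi⟩)

namespace IsBraidBasis

section Depth

theorem strip_high (h : IsBraidBasis n t) {z : G} (hz : z ∈ Wfull t n) :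
    z * (tail (Wfull t n) (Whigh t n) z)⁻¹ ∈ Wfull t n ∧ ∀ p,
      (z * (tail (Wfull t n) (Whigh t n) z)⁻¹ ∈ alt p (Wlow t n) (Whigh t n) ↔
        z ∈ alt (p + 1) (Whigh t n) (Wlow t n)) := by
  obtain ⟨a, ha, hred, b, hb, rfl⟩ := h.exists_reduced_mul
    (I := {i | 1 ≤ i ∧ i < n}) (fun i hi => hi.2) hz
  rw [h.tail_eq (fun i hi => hi.2) ha hred hb, mul_inv_cancel_right]
  exact ⟨ha, fun p => ⟨fun h' => mul_mem_alt_succ h' hb, h.mem_alt_low_of_reduced ha hred hb⟩⟩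

theorem strip_low (h : IsBraidBasis n t) {z : G} (hz : z ∈ Wfull t n) :
    z * (tail (Wfull t n) (Wlow t n) z)⁻¹ ∈ Wfull t n ∧ ∀ p,
      (z * (tail (Wfull t n) (Wlow t n) z)⁻¹ ∈ alt p (Whigh t n) (Wlow t n) ↔
        z ∈ alt (p + 1) (Wlow t n) (Whigh t n)) := by
  have hI : ∀ i ∈ {i | i + 1 < n}, i < n := fun i hi => Nat.lt_of_succ_lt hi
  obtain ⟨a, ha, hred, b, hb, rfl⟩ := h.exists_reduced_mul hI hz
  rw [h.tail_eq hI ha hred hb, mul_inv_cancel_right]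
  exact ⟨ha, fun p => ⟨fun h' => mul_mem_alt_succ h' hb, h.mem_alt_high_of_reduced ha hred hb⟩⟩

theorem strip_mem (h : IsBraidBasis n t) {a : G} (ha : a ∈ Wfull t n) (j : ℕ) :
    strip (Wfull t n) (Whigh t n) (Wlow t n) j a ∈ Wfull t n := by
  induction j with
  | zero => exact ha
  | succ j ih =>
    rw [strip]
    split_ifs
    · exact (h.strip_high ih).1
    · exact (h.strip_low ih).1

theorem strip_eq_one_iff (h : IsBraidBasis n t) {a : G} (ha : a ∈ Wfull t n) (p : ℕ) :
    strip (Wfull t n) (Whigh t n) (Wlow t n) p a = 1 ↔ a ∈ alt p (Whigh t n) (Wlow t n) := by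
  have key : ∀ p j,
      (j % 2 = 0 → (strip (Wfull t n) (Whigh t n) (Wlow t n) (j + p) a = 1 ↔
        strip (Wfull t n) (Whigh t n) (Wlow t n) j a ∈ alt p (Whigh t n) (Wlow t n))) ∧
      (j % 2 = 1 → (strip (Wfull t n) (Whigh t n) (Wlow t n) (j + p) a = 1 ↔
        strip (Wfull t n) (Whigh t n) (Wlow t n) j a ∈ alt p (Wlow t n) (Whigh t n))) := by
    intro p
    induction p with
    | zero => exact fun j => ⟨fun _ => Iff.rfl, fun _ => Iff.rfl⟩
    | succ p ih =>
      refine fun j => ⟨fun hj => ?_, fun hj => ?_⟩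
      · rw [← add_assoc, add_right_comm, (ih (j + 1)).2 (by omega), strip, if_pos hj,
          (h.strip_high (h.strip_mem ha j)).2]
      · rw [← add_assoc, add_right_comm, (ih (j + 1)).1 (by omega), strip, if_neg (by omega),
          (h.strip_low (h.strip_mem ha j)).2]
  have := (key p 0).1 rfl
  rwa [zero_add] at this

theorem dpt_le_iff (h : IsBraidBasis n t) (hn : 2 ≤ n) {a : G} (ha : a ∈ Wfull t n) (d : ℕ) :
    dpt (Wfull t n) (Whigh t n) (Wlow t n) a ≤ d ↔
      a ∈ alt (2 * d + 1) (Whigh t n) (Wlow t n) := by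
  have hset : {p : ℕ | 1 ≤ p ∧ strip (Wfull t n) (Whigh t n) (Wlow t n) p a = 1} =
      {p : ℕ | 1 ≤ p ∧ a ∈ alt p (Whigh t n) (Wlow t n)} := by
    simp only [h.strip_eq_one_iff ha]
  rw [dpt, bh, hset]
  obtain ⟨q, hq⟩ := exists_alt_mem hn ha
  have hmem := Nat.sInf_mem (s := {p : ℕ | 1 ≤ p ∧ a ∈ alt p (Whigh t n) (Wlow t n)})
    ⟨q + 1, by omega, alt_subset_succ hq⟩
  constructor
  · intro hd
    exact alt_mono (by omega) hmem.2
  · intro hd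
    have : sInf {p : ℕ | 1 ≤ p ∧ a ∈ alt p (Whigh t n) (Wlow t n)} ≤ 2 * d + 1 :=
      Nat.sInf_le ⟨by omega, hd⟩
    omega

end Depth

section Delta

theorem up_mul_down_mul_comm (h : IsBraidBasis (r + 1) t) {b : G} (hb : b ∈ Whigh t (r + 1)) :
    b * (up t (r + 1) * down t (r + 1)) = up t (r + 1) * down t (r + 1) * b := by
  refine W_induction (P := fun b => b * (up t (r + 1) * down t (r + 1)) =
    up t (r + 1) * down t (r + 1) * b) (by simp) ?_ hb
  rintro b hb i ⟨hi, hi'⟩ ih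
  obtain ⟨i, rfl⟩ : ∃ k, i = k + 1 := ⟨i - 1, by omega⟩
  rw [mul_assoc, ← h.up_mul_down_comm (by omega), ← mul_assoc, ih, mul_assoc]

/-- Multiplication by `Δ` increases the depth. -/
theorem exists_reduced_of_mul_mem (h : IsBraidBasis (r + 1) t)
    (hr : 1 ≤ r) {a : G} (haM : a ∈ Wfull t (r + 1)) {q : ℕ}
    (hmem : a * up t (r + 1) ^ (r + 2) ∈ alt (q + 3) (Whigh t (r + 1)) (Wlow t (r + 1))) :
    ∃ a' ∈ Wfull t (r + 1), ∃ a₁ ∈ Whigh t (r + 1), a = a' * a₁ ∧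
      a' * t 0 ∈ alt q (Wlow t (r + 1)) (Whigh t (r + 1)) := by
  obtain ⟨a, ha, hred, a₁, ha₁, rfl⟩ := h.exists_reduced_mul
    (I := {i | 1 ≤ i ∧ i < r + 1}) (fun i hi => hi.2) haM
  refine ⟨a, ha, a₁, ha₁, rfl, ?_⟩
  have hup : up t (r + 1) ∈ Wfull t (r + 1) := up_mem fun i hi => mem_W hi
  have hV : up (shift t) r ∈ Whigh t (r + 1) :=
    up_mem fun i hi => mem_W ⟨by omega, by omega⟩
  have hr' : t r ∈ Whigh t (r + 1) := mem_W ⟨hr, by omega⟩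
  have haU : a * up t (r + 1) ∈ Wfull t (r + 1) := mul_mem ha hup
  have hredU : ∀ k < r, ∀ x ∈ Wfull t (r + 1), a * up t (r + 1) ≠ x * t k := by
    intro k hk x hx hax
    obtain ⟨y, hy, hay⟩ := h.exists_of_mul_up_eq (by omega) le_rfl ha hx hax
    exact hred (k + 1) ⟨by omega, by omega⟩ y hy hay
  have hred1 : Reduced t (r + 1) {i | 1 ≤ i ∧ i < r + 1}
      (a * (up t (r + 1) * down t (r + 1))) := by
    rintro i ⟨hi, hi'⟩ x hx hax
    obtain ⟨i, rfl⟩ : ∃ k, i = k + 1 := ⟨i - 1, by omega⟩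
    rw [← mul_assoc] at hax
    obtain ⟨y, hy, hay⟩ := h.exists_of_mul_down_eq hi' le_rfl haU hx hax
    exact hredU i (by omega) y hy hay
  have hred2 : Reduced t (r + 1) {i | i + 1 < r + 1} (a * up t (r + 1) * t r) := by
    intro k hk x hx hax
    simp only [Set.mem_ofPred_eq] at hk
    rcases Nat.lt_or_ge (k + 1) r with hlt | hge
    · obtain ⟨z, hz, h1, -⟩ := h.far' (.inr (by omega)) (by omega) (by omega) haU hx hax
      exact hredU k (by omega) z hz h1
    · obtain rfl : r = k + 1 := by omega
      obtain ⟨z, hz, -, h1⟩ := h.near k _ _ (by omega) hx haU hax.symm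
      exact hredU k (by omega) _ (mul_mem hz (mem_W (show k + 1 < k + 1 + 1 by omega))) h1
  have hred3 : Reduced t (r + 1) {i | 1 ≤ i ∧ i < r + 1} (a * t 0) := by
    rintro i ⟨hi, hi'⟩ x hx hax
    obtain ⟨i, rfl⟩ : ∃ k, i = k + 1 := ⟨i - 1, by omega⟩
    rcases Nat.eq_zero_or_pos i with rfl | hpos
    · obtain ⟨z, hz, h1, -⟩ := h.near 0 _ _ hi' ha hx hax
      exact hred 1 ⟨le_rfl, hi'⟩ _ (mul_mem hz (mem_W (Nat.succ_pos r))) h1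
    · obtain ⟨z, hz, h1, -⟩ := h.far' (.inl (by omega)) (by omega) hi' ha hx hax
      exact hred (i + 1) ⟨by omega, hi'⟩ z hz h1
  have hθ : up t (r + 1) * down t (r + 1) ∈ Wfull t (r + 1) :=
    mul_mem hup (down_mem fun i hi => mem_W hi)
  have ht0 : t 0 ∈ Wfull t (r + 1) := mem_W (Nat.succ_pos r)
  rw [show a * a₁ * up t (r + 1) ^ (r + 2) =
      a * (up t (r + 1) * down t (r + 1)) * (a₁ * up (shift t) r ^ (r + 1)) by
    rw [h.up_pow_eq, mul_assoc a, ← mul_assoc a₁, h.up_mul_down_mul_comm ha₁]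
    simp only [mul_assoc]] at hmem
  have h1 := h.mem_alt_low_of_reduced (mul_mem ha hθ) hred1 (mul_mem ha₁ (pow_mem hV _)) hmem
  rw [down_succ, ← mul_assoc, ← mul_assoc] at h1
  have h2 := h.mem_alt_high_of_reduced (mul_mem haU (Whigh_le hr')) hred2
    (down_mem fun i hi => mem_W (show i + 1 < r + 1 by omega)) h1
  rw [up_succ', ← mul_assoc, mul_assoc] at h2
  exact h.mem_alt_low_of_reduced (mul_mem ha ht0) hred3 (mul_mem hV hr') h2

theorem mul_up_pow_notMem (h : IsBraidBasis (r + 1) t)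
    (hr : 1 ≤ r) {a : G} (ha : a ∈ Wfull t (r + 1)) :
    a * up t (r + 1) ^ (r + 2) ∉ alt 3 (Whigh t (r + 1)) (Wlow t (r + 1)) := by
  intro hmem
  obtain ⟨a', ha', -, -, -, h0⟩ := h.exists_reduced_of_mul_mem hr ha (q := 0) hmem
  exact h.mul_gen_ne_one ha' (Nat.succ_pos r) h0

theorem mem_of_mul_up_pow_mem (h : IsBraidBasis (r + 1) t)
    (hr : 1 ≤ r) {a : G} (ha : a ∈ Wfull t (r + 1)) {d : ℕ}
    (hmem : a * up t (r + 1) ^ (r + 2) ∈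
      alt (2 * (d + 1) + 1) (Whigh t (r + 1)) (Wlow t (r + 1))) :
    a ∈ alt (2 * d + 1) (Whigh t (r + 1)) (Wlow t (r + 1)) := by
  obtain ⟨a', ha', a₁, ha₁, rfl, h0⟩ := h.exists_reduced_of_mul_mem hr ha (q := 2 * d) hmem
  exact mul_mem_alt_succ (h.mem_alt_low_of_mul_mem ha' (mem_W (Nat.succ_pos r)) h0) ha₁

theorem up_pow_pow_notMem (h : IsBraidBasis (r + 1) t)
    (hr : 1 ≤ r) (k : ℕ) : (up t (r + 1) ^ (r + 2)) ^ (k + 1) ∉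
    alt (2 * (k + 1) + 1) (Whigh t (r + 1)) (Wlow t (r + 1)) := by
  induction k with
  | zero => simpa using h.mul_up_pow_notMem hr (one_mem _)
  | succ k ih =>
    intro hmem
    rw [pow_succ] at hmem
    exact ih (h.mem_of_mul_up_pow_mem hr
      (pow_mem (pow_mem (up_mem fun i hi => mem_W hi) _) _) hmem)

end Delta

end IsBraidBasis

end Basis

end BraidFamily

namespace BraidFamily

open GarsideOrder

section Alternating

variable {G : Type*} [Group G] {X Y : Submonoid G}

theorem alt_mul_alt_mem {k l : ℕ} {a b : G} (ha : a ∈ alt (2 * k + 1) X Y)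
    (hb : b ∈ alt (2 * l + 1) X Y) : a * b ∈ alt (2 * (k + l) + 1) X Y := by
  induction l generalizing b with
  | zero =>
    obtain ⟨_, rfl, y, hy, rfl⟩ := hb
    simpa using alt_mul_mem ha hy
  | succ l ih =>
    obtain ⟨_, ⟨c, hc, z, hz, rfl⟩, y, hy, rfl⟩ := hb
    rw [← mul_assoc, ← mul_assoc]
    exact mul_mem_alt_succ (mul_mem_alt_succ (ih hc) hz) hy

theorem mem_alt_one {a : G} : a ∈ alt 1 X Y ↔ a ∈ X := by
  constructor
  · rintro ⟨_, rfl, y, hy, rfl⟩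
    simpa using hy
  · intro ha
    exact ⟨1, rfl, a, ha, one_mul a⟩

end Alternating

section Basis

variable {G : Type*} [Group G] {t : ℕ → G} {r : ℕ}

/-- The subgroup generated by `t 1, …, t (n - 1)`. -/
abbrev Ghigh (t : ℕ → G) (n : ℕ) : Subgroup G := Subgroup.closure (t '' {i | 1 ≤ i ∧ i < n})

/-- The submonoid of the products of factors `t 0` and factors in the group generated by
`t 1, …, t (n - 1)`. -/
def nonneg (t : ℕ → G) (n : ℕ) : Submonoid G := Submonoid.closure ({t 0} ∪ Ghigh t n)

theorem gen_zero_mem_nonneg {n : ℕ} : t 0 ∈ nonneg t n := Submonoid.subset_closure (.inl rfl)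

theorem mem_nonneg_of_mem {n : ℕ} {g : G} (hg : g ∈ Ghigh t n) : g ∈ nonneg t n :=
  Submonoid.subset_closure (.inr hg)

theorem Whigh_le_Ghigh {n : ℕ} : Whigh t n ≤ (Ghigh t n).toSubmonoid :=
  Submonoid.closure_le.2 Subgroup.subset_closure

theorem up_mem_low (m : ℕ) : up t m ∈ Wlow t (m + 1) :=
  up_mem fun i hi => mem_W (show i + 1 < m + 1 by omega)

theorem down_mem_low (m : ℕ) : down t m ∈ Wlow t (m + 1) :=
  down_mem fun i hi => mem_W (show i + 1 < m + 1 by omega)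

/-- The elements `α` such that `α⁻¹ * Δ ^ k` is positive of depth at most `k` for some
`k ≥ 1`. -/
def shallow (t : ℕ → G) (r : ℕ) : Set G :=
  {α | ∃ k, α⁻¹ * (up t (r + 1) ^ (r + 2)) ^ (k + 1) ∈
    alt (2 * (k + 1) + 1) (Whigh t (r + 1)) (Wlow t (r + 1))}

namespace IsBraidBasis

theorem mul_inv_eq_gen_zero_mul (h : IsBraidBasis (r + 1) t) {v : G} (hv : v ∈ Wlow t (r + 1)) :
    ∃ x ∈ nonneg t (r + 1), up t (r + 1) ^ (r + 2) * v⁻¹ = t 0 * x := by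
  have hv' : up t (r + 1) * v * (up t (r + 1))⁻¹ ∈ Whigh t (r + 1) := by
    refine W_induction (P := fun v => up t (r + 1) * v * (up t (r + 1))⁻¹ ∈ Whigh t (r + 1))
      (by simp [one_mem]) (fun v hv i hi ih => ?_) hv
    simp only [Set.mem_ofPred_eq] at hi
    have h1 : t (i + 1) = up t (r + 1) * t i * (up t (r + 1))⁻¹ := by
      rw [h.up_mul hi le_rfl, mul_inv_cancel_right]
    have h2 : t (i + 1) ∈ Whigh t (r + 1) := mem_W ⟨by omega, hi⟩
    rw [h1] at h2
    simpa [mul_assoc] using mul_mem ih h2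
  have hV : up (shift t) r ∈ nonneg t (r + 1) := mem_nonneg_of_mem
    (Whigh_le_Ghigh (up_mem fun i hi => mem_W ⟨by omega, by omega⟩))
  have hU : up t (r + 1) ∈ nonneg t (r + 1) := by
    rw [up_succ']
    exact mul_mem gen_zero_mem_nonneg hV
  refine ⟨up (shift t) r * (up t (r + 1) ^ r * (up t (r + 1) * v * (up t (r + 1))⁻¹)⁻¹ *
    up t (r + 1)), mul_mem hV (mul_mem (mul_mem (pow_mem hU r)
      (mem_nonneg_of_mem (inv_mem (Whigh_le_Ghigh hv')))) hU), ?_⟩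
  rw [← mul_assoc, ← up_succ', pow_succ, pow_succ']
  group

theorem up_pow_mul_inv_mem (h : IsBraidBasis (r + 1) t)
    (hΔ : ∀ x, up t (r + 1) ^ (r + 2) * x = x * up t (r + 1) ^ (r + 2)) {d : ℕ} {a : G}
    (ha : a ∈ alt (2 * d + 1) (Whigh t (r + 1)) (Wlow t (r + 1))) :
    (up t (r + 1) ^ (r + 2)) ^ d * a⁻¹ ∈ nonneg t (r + 1) ∧ (1 ≤ d →
      ∃ x ∈ nonneg t (r + 1), ∃ y ∈ nonneg t (r + 1),
        (up t (r + 1) ^ (r + 2)) ^ d * a⁻¹ = x * t 0 * y) := by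
  induction d generalizing a with
  | zero =>
    refine ⟨?_, by omega⟩
    rw [pow_zero, one_mul]
    exact mem_nonneg_of_mem (inv_mem (Whigh_le_Ghigh (mem_alt_one.1 ha)))
  | succ d ih =>
    obtain ⟨_, ⟨c, hc, v, hv, rfl⟩, y, hy, rfl⟩ := ha
    obtain ⟨x, hx, hxv⟩ := h.mul_inv_eq_gen_zero_mul hv
    have hy' : y⁻¹ ∈ nonneg t (r + 1) := mem_nonneg_of_mem (inv_mem (Whigh_le_Ghigh hy))
    have heq : (up t (r + 1) ^ (r + 2)) ^ (d + 1) * (c * v * y)⁻¹ =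
        y⁻¹ * t 0 * (x * ((up t (r + 1) ^ (r + 2)) ^ d * c⁻¹)) := by
      rw [show y⁻¹ * t 0 * (x * ((up t (r + 1) ^ (r + 2)) ^ d * c⁻¹)) =
          y⁻¹ * (t 0 * x) * ((up t (r + 1) ^ (r + 2)) ^ d * c⁻¹) by simp only [mul_assoc], ← hxv]
      generalize up t (r + 1) ^ (r + 2) = D at hΔ ⊢
      have hΔ' : ∀ x, D ^ d * x = x * D ^ d := fun x =>
        ((show Commute D x from hΔ x).pow_left d).eq
      rw [mul_inv_rev, mul_inv_rev, pow_succ, mul_assoc (D ^ d), ← mul_assoc D, hΔ y⁻¹, hΔ']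
      simp only [mul_assoc]
      rw [hΔ' c⁻¹]
    have hz := mul_mem hx (ih hc).1
    rw [heq]
    exact ⟨mul_mem (mul_mem hy' gen_zero_mem_nonneg) hz, fun _ => ⟨_, hy', _, hz, rfl⟩⟩

theorem alt_mul_up_mul_down_mem (h : IsBraidBasis (r + 1) t) (hr : 1 ≤ r) {d : ℕ} {a : G}
    (ha : a ∈ alt (2 * (d + 1) + 1) (Whigh t (r + 1)) (Wlow t (r + 1))) :
    a * (up t (r + 1) * down t (r + 1)) ∈
      alt (2 * (d + 2) + 1) (Whigh t (r + 1)) (Wlow t (r + 1)) := by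
  have hr' : t r ∈ Whigh t (r + 1) := mem_W ⟨hr, by omega⟩
  obtain ⟨_, ⟨c, hc, v, hv, rfl⟩, y, hy, rfl⟩ := ha
  rw [show c * v * y * (up t (r + 1) * down t (r + 1)) =
      c * (v * up t r) * (t r * t r) * down t r * y by
    rw [mul_assoc _ y, h.up_mul_down_mul_comm hy, up_succ, down_succ]
    simp only [mul_assoc]]
  exact mul_mem_alt_succ (mul_mem_alt_succ (mul_mem_alt_succ (mul_mem_alt_succ hc
    (mul_mem hv (up_mem_low r))) (mul_mem hr' hr')) (down_mem_low r)) hy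

theorem up_mul_down_mul_alt_mem (h : IsBraidBasis (r + 1) t) (hr : 1 ≤ r) {d : ℕ} {a : G}
    (ha : a ∈ alt (2 * (d + 1) + 1) (Whigh t (r + 1)) (Wlow t (r + 1))) :
    up t (r + 1) * down t (r + 1) * a ∈
      alt (2 * (d + 2) + 1) (Whigh t (r + 1)) (Wlow t (r + 1)) := by
  have hr' : t r ∈ Whigh t (r + 1) := mem_W ⟨hr, by omega⟩
  induction d generalizing a with
  | zero =>
    obtain ⟨_, ⟨c, hc, v, hv, rfl⟩, y, hy, rfl⟩ := ha
    rw [show up t (r + 1) * down t (r + 1) * (c * v * y) =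
        c * up t r * (t r * t r) * (down t r * v) * y by
      rw [mul_assoc c, ← mul_assoc _ c, ← h.up_mul_down_mul_comm (mem_alt_one.1 hc), up_succ,
        down_succ]
      simp only [mul_assoc]]
    exact mul_mem_alt_succ (mul_mem_alt_succ (mul_mem_alt_succ (mul_mem_alt_succ hc
      (up_mem_low r)) (mul_mem hr' hr')) (mul_mem (down_mem_low r) hv)) hy
  | succ d ih =>
    obtain ⟨_, ⟨c, hc, v, hv, rfl⟩, y, hy, rfl⟩ := ha
    rw [← mul_assoc, ← mul_assoc]
    exact mul_mem_alt_succ (mul_mem_alt_succ (ih hc) hv) hy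

theorem up_pow_pow_mem (h : IsBraidBasis (r + 1) t)
    (hr : 1 ≤ r) (k : ℕ) : (up t (r + 1) ^ (r + 2)) ^ (k + 1) ∈
    alt (2 * (k + 2) + 1) (Whigh t (r + 1)) (Wlow t (r + 1)) := by
  have hV : up (shift t) r ∈ Whigh t (r + 1) := up_mem fun i hi => mem_W ⟨by omega, by omega⟩
  induction k with
  | zero =>
    rw [pow_one, h.up_pow_eq]
    refine alt_mul_mem ?_ (pow_mem hV _)
    rw [← one_mul (up t (r + 1) * _)]
    exact alt_mul_up_mul_down_mem h hr (alt_mono (Nat.zero_le _) rfl)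
  | succ k ih =>
    rw [pow_succ _ (k + 1)]
    nth_rw 2 [h.up_pow_eq]
    rw [← mul_assoc]
    exact alt_mul_mem (h.alt_mul_up_mul_down_mem hr ih) (pow_mem hV _)

theorem exists_inv_mul_up_pow (h : IsBraidBasis (r + 1) t) {i : ℕ} (hi : 1 ≤ i) (hir : i ≤ r)
    (hΔ : ∀ x, up t (r + 1) ^ (r + 2) * x = x * up t (r + 1) ^ (r + 2)) :
    ∃ y ∈ Whigh t (r + 1),
      (t i)⁻¹ * up t (r + 1) ^ (r + 2) = y * (up t (r + 1) * down t (r + 1)) := by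
  obtain ⟨i, rfl⟩ : ∃ k, i = k + 1 := ⟨i - 1, by omega⟩
  obtain ⟨r, rfl⟩ : ∃ k, r = k + 1 := ⟨r - 1, by omega⟩
  have hy := h.shift.mul_eq_up_pow (i := i) (k := r + 2) (by omega) (by omega)
  have hV : up (shift t) (r + 1) ∈ Whigh t (r + 1 + 1) :=
    up_mem fun i hi => mem_W ⟨by omega, by omega⟩
  have hV' : up (shift (shift t)) r ∈ Whigh t (r + 1 + 1) :=
    up_mem fun i hi => mem_W ⟨by omega, by omega⟩
  refine ⟨_, mul_mem (mul_mem (pow_mem hV i) hV') (pow_mem hV (r + 2 - i - 1)), ?_⟩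
  rw [show t (i + 1) = shift t i from rfl, inv_mul_eq_iff_eq_mul, ← mul_assoc, hy, h.up_pow_eq,
    h.up_mul_down_mul_comm (pow_mem hV _)]

theorem gen_zero_inv_mul_up_pow_mem (h : IsBraidBasis (r + 1) t) (hr : 1 ≤ r) :
    (t 0)⁻¹ * up t (r + 1) ^ (r + 2) ∈ alt (2 * 1 + 1) (Whigh t (r + 1)) (Wlow t (r + 1)) := by
  have hr' : t r ∈ Whigh t (r + 1) := mem_W ⟨hr, by omega⟩
  have hV : up (shift t) r ∈ Whigh t (r + 1) := up_mem fun i hi => mem_W ⟨by omega, by omega⟩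
  rw [show (t 0)⁻¹ * up t (r + 1) ^ (r + 2) =
      1 * (up (shift t) r * t r) * down t r * up (shift t) r ^ (r + 1) by
    rw [h.up_pow_eq, up_succ', down_succ]
    group]
  exact mul_mem_alt_succ (mul_mem_alt_succ (mul_mem_alt_succ rfl (mul_mem hV hr'))
    (down_mem_low r)) (pow_mem hV _)

theorem mul_gen_zero_mul_mem_shallow (h : IsBraidBasis (r + 1) t) (hr : 1 ≤ r)
    (hΔ : ∀ x, up t (r + 1) ^ (r + 2) * x = x * up t (r + 1) ^ (r + 2)) {x y : G}
    (hx : x ∈ nonneg t (r + 1)) (hy : y ∈ nonneg t (r + 1)) :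
    x * t 0 * y ∈ shallow t r := by
  have h0 : t 0 ∈ shallow t r := ⟨0, by simpa using h.gen_zero_inv_mul_up_pow_mem hr⟩
  have hΔ' : ∀ k x, (up t (r + 1) ^ (r + 2)) ^ k * x = x * (up t (r + 1) ^ (r + 2)) ^ k :=
    fun k x => ((show Commute (up t (r + 1) ^ (r + 2)) x from hΔ x).pow_left k).eq
  have hmul : ∀ a ∈ shallow t r, ∀ b ∈ shallow t r, a * b ∈ shallow t r := by
    rintro a ⟨k, hk⟩ b ⟨l, hl⟩
    refine ⟨l + 1 + k, ?_⟩
    rw [show (a * b)⁻¹ * (up t (r + 1) ^ (r + 2)) ^ (l + 1 + k + 1) =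
        b⁻¹ * (up t (r + 1) ^ (r + 2)) ^ (l + 1) * (a⁻¹ * (up t (r + 1) ^ (r + 2)) ^ (k + 1)) by
      rw [add_assoc (l + 1), pow_add, mul_inv_rev, mul_assoc b⁻¹, ← mul_assoc a⁻¹, ← hΔ' _ a⁻¹]
      simp only [mul_assoc]]
    exact alt_mul_alt_mem (k := l + 1) (l := k + 1) hl hk
  have hgen : ∀ i, 1 ≤ i → i ≤ r → t i ∈ Whigh t (r + 1) := fun i hi hir =>
    mem_W ⟨hi, by omega⟩
  have hG : ∀ g ∈ Ghigh t (r + 1), ∀ q ∈ shallow t r,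
      g * q ∈ shallow t r ∧ q * g ∈ shallow t r := by
    intro g hg
    induction hg using Subgroup.closure_induction'' with
    | mem g hg =>
      obtain ⟨i, ⟨hi, hi'⟩, rfl⟩ := hg
      obtain ⟨y, hy, hiy⟩ := h.exists_inv_mul_up_pow hi (by omega) hΔ
      rintro q ⟨k, hk⟩
      refine ⟨⟨k + 1, ?_⟩, ⟨k + 1, ?_⟩⟩
      · rw [show (t i * q)⁻¹ * (up t (r + 1) ^ (r + 2)) ^ (k + 1 + 1) =
            q⁻¹ * (up t (r + 1) ^ (r + 2)) ^ (k + 1) * y * (up t (r + 1) * down t (r + 1)) by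
          rw [mul_assoc _ y, ← hiy, pow_succ _ (k + 1), mul_inv_rev, mul_assoc, mul_assoc,
            ← mul_assoc (t i)⁻¹, ← hΔ']
          simp only [mul_assoc]]
        exact h.alt_mul_up_mul_down_mem hr (alt_mul_mem hk hy)
      · rw [show (q * t i)⁻¹ * (up t (r + 1) ^ (r + 2)) ^ (k + 1 + 1) =
            y * (up t (r + 1) * down t (r + 1) * (q⁻¹ * (up t (r + 1) ^ (r + 2)) ^ (k + 1))) by
          rw [← mul_assoc, ← hiy, pow_succ' _ (k + 1), mul_inv_rev, mul_assoc, mul_assoc,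
            ← mul_assoc q⁻¹, ← hΔ]
          simp only [mul_assoc]]
        simpa using alt_mul_alt_mem (k := 0) (mem_alt_one.2 hy) (h.up_mul_down_mul_alt_mem hr hk)
    | inv_mem g hg =>
      obtain ⟨i, ⟨hi, hi'⟩, rfl⟩ := hg
      have hi := hgen i hi (by omega)
      rintro q ⟨k, hk⟩
      refine ⟨⟨k, ?_⟩, ⟨k, ?_⟩⟩
      · rw [mul_inv_rev, inv_inv, mul_assoc, ← hΔ', ← mul_assoc]
        exact alt_mul_mem hk hi
      · rw [mul_inv_rev, inv_inv, mul_assoc]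
        simpa using alt_mul_alt_mem (k := 0) (mem_alt_one.2 hi) hk
    | one => exact fun q hq => by simpa using hq
    | mul a b _ _ iha ihb =>
      intro q hq
      exact ⟨mul_assoc a b q ▸ (iha _ (ihb q hq).1).1, mul_assoc q a b ▸ (ihb _ (iha q hq).2).2⟩
  have hN : ∀ x ∈ nonneg t (r + 1), ∀ q ∈ shallow t r,
      x * q ∈ shallow t r ∧ q * x ∈ shallow t r := by
    intro x hx
    induction hx using Submonoid.closure_induction with
    | mem x hx =>
      rcases hx with rfl | hx
      · exact fun q hq => ⟨hmul _ h0 _ hq, hmul _ hq _ h0⟩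
      · exact hG x hx
    | one => exact fun q hq => by simpa using hq
    | mul a b _ _ iha ihb =>
      intro q hq
      exact ⟨mul_assoc a b q ▸ (iha _ (ihb q hq).1).1, mul_assoc q a b ▸ (ihb _ (iha q hq).2).2⟩
  exact (hN y hy _ (hN x hx _ h0).1).2

theorem negative_of_mem (h : IsBraidBasis (r + 1) t) (hr : 1 ≤ r) {k : ℕ} {x : G}
    (hx : x ∈ alt (2 * (k + 1) + 1) (Whigh t (r + 1)) (Wlow t (r + 1))) :
    Negative (Wfull t (r + 1)) (Whigh t (r + 1)) (Wlow t (r + 1)) (up t (r + 1) ^ (r + 2))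
      (x * ((up t (r + 1) ^ (r + 2)) ^ (k + 1))⁻¹) := by
  have hU : up t (r + 1) ^ (r + 2) ∈ Wfull t (r + 1) := pow_mem (up_mem fun i hi => mem_W hi) _
  induction k generalizing x with
  | zero =>
    have hxM : x ∈ Wfull t (r + 1) := alt_subset Whigh_le Wlow_le hx
    refine ⟨x, 1, ⟨hxM, fun hle => ?_⟩, le_rfl, rfl, ?_⟩
    · refine h.mul_up_pow_notMem hr hle ?_
      rwa [inv_mul_cancel_right]
    · refine lt_of_le_of_lt ((h.dpt_le_iff (by omega) hxM 1).2 hx) (not_le.1 fun hle => ?_)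
      exact h.up_pow_pow_notMem hr 0 ((h.dpt_le_iff (by omega) (pow_mem hU _) _).1 hle)
  | succ k ih =>
    have hxM : x ∈ Wfull t (r + 1) := alt_subset Whigh_le Wlow_le hx
    by_cases hle : leR (Wfull t (r + 1)) (up t (r + 1) ^ (r + 2)) x
    · have := ih (x := x * (up t (r + 1) ^ (r + 2))⁻¹)
        (h.mem_of_mul_up_pow_mem hr hle (by rwa [inv_mul_cancel_right]))
      rwa [mul_assoc, ← mul_inv_rev, ← pow_succ] at this
    · refine ⟨x, k + 1 + 1, ⟨hxM, hle⟩, by omega, rfl, ?_⟩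
      refine lt_of_le_of_lt ((h.dpt_le_iff (by omega) hxM _).2 hx) (not_le.1 fun hle => ?_)
      exact h.up_pow_pow_notMem hr _ ((h.dpt_le_iff (by omega) (pow_mem hU _) _).1 hle)

/-- The elements whose inverse is negative are the products which involve `t 0` with positive
exponents only, at least once. -/
theorem negative_inv_iff (h : IsBraidBasis (r + 1) t) (hr : 1 ≤ r)
    (hΔ : ∀ x, up t (r + 1) ^ (r + 2) * x = x * up t (r + 1) ^ (r + 2)) {α : G} :
    Negative (Wfull t (r + 1)) (Whigh t (r + 1)) (Wlow t (r + 1)) (up t (r + 1) ^ (r + 2)) α⁻¹ ↔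
      ∃ x ∈ nonneg t (r + 1), ∃ y ∈ nonneg t (r + 1), α = x * t 0 * y := by
  constructor
  · rintro ⟨a, k, ⟨ha, -⟩, hk, hα, hlt⟩
    obtain ⟨k, rfl⟩ : ∃ l, k = l + 1 := ⟨k - 1, by omega⟩
    have hU : up t (r + 1) ^ (r + 2) ∈ Wfull t (r + 1) := pow_mem (up_mem fun i hi => mem_W hi) _
    have hle := (h.dpt_le_iff (by omega) (pow_mem hU _) _).2 (h.up_pow_pow_mem hr k)
    obtain ⟨x, hx, y, hy, hxy⟩ := (h.up_pow_mul_inv_mem hΔ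
      ((h.dpt_le_iff (by omega) ha (k + 1)).1 (by omega))).2 hk
    refine ⟨x, hx, y, hy, ?_⟩
    rw [← hxy, ← inv_inv α, hα, mul_inv_rev, inv_inv]
  · rintro ⟨x, hx, y, hy, rfl⟩
    obtain ⟨k, hk⟩ := h.mul_gen_zero_mul_mem_shallow hr hΔ hx hy
    have := h.negative_of_mem hr hk
    rwa [mul_inv_cancel_right] at this

end IsBraidBasis

end Basis

end BraidFamily

namespace BraidOrder

open GarsideOrder BraidFamily

theorem Mb_eq (n : ℕ) : Mb n = Wfull (gen n) n := by
  unfold Mb Wfull W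
  congr 1
  ext x
  constructor
  · rintro ⟨i, hi, rfl⟩
    exact ⟨i, hi, rfl⟩
  · rintro ⟨i, hi, rfl⟩
    exact ⟨i, hi, rfl⟩

theorem exists_eq_gen_iff {n : ℕ} {x : Braid n} :
    (∃ i, 1 ≤ i ∧ i < n ∧ x = gen n i) ↔ x ∈ gen n '' {i | 1 ≤ i ∧ i < n} := by
  constructor
  · rintro ⟨i, hi, hi', rfl⟩
    exact ⟨i, ⟨hi, hi'⟩, rfl⟩
  · rintro ⟨i, ⟨hi, hi'⟩, rfl⟩
    exact ⟨i, hi, hi', rfl⟩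

theorem M₁b_eq (n : ℕ) : M₁b n = Whigh (gen n) n :=
  congrArg Submonoid.closure (Set.ext fun _ => exists_eq_gen_iff)

theorem G₁b_eq (n : ℕ) : G₁b n = Ghigh (gen n) n :=
  congrArg Subgroup.closure (Set.ext fun _ => exists_eq_gen_iff)

theorem Nb_eq (n : ℕ) : Nb n = Wlow (gen n) n := by
  unfold Nb Wlow W
  congr 1
  ext x
  constructor
  · rintro ⟨i, hi, rfl⟩
    exact ⟨i, hi, rfl⟩
  · rintro ⟨i, hi, rfl⟩
    exact ⟨i, hi, rfl⟩

theorem seg_zero_eq_up (n m : ℕ) : seg n 0 m = up (gen n) m := by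
  induction m with
  | zero => rfl
  | succ m ih =>
    rw [up_succ, ← ih]
    simp [seg, List.range_succ]

theorem up_pow_central (r : ℕ) (x : Braid (r + 1)) :
    up (gen (r + 1)) (r + 1) ^ (r + 2) * x = x * up (gen (r + 1)) (r + 1) ^ (r + 2) := by
  have hx : x ∈ Subgroup.closure (Set.range (PresentedGroup.of (rels := braidRel (r + 1)))) := by
    rw [PresentedGroup.closure_range_of]
    exact Subgroup.mem_top x
  change Commute _ _
  induction hx using Subgroup.closure_induction with
  | mem x hx =>
    obtain ⟨i, rfl⟩ := hx
    have := (isBraidFamily_gen (r + 1)).up_pow_comm (show (i : ℕ) ≤ r by omega)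
    rwa [gen_of_lt i.2] at this
  | one => exact Commute.one_right _
  | mul x y _ _ hx hy => exact hx.mul_right hy
  | inv x _ hx => exact hx.inv_right

/-- `Expressible d z` means that the elements of the coset of `z` modulo `⟨s₂, …, s_n⟩` are of the
form `α₀ s₁ α₁ ⋯ s₁ α_m` with `m ≥ d` and `α₀, …, α_m` in `⟨s₂, …, s_n⟩`. -/
def Expressible {n : ℕ} (d : ℕ) (z : Braid n) : Prop :=
  ∀ g ∈ G₁b n, ∃ m, d ≤ m ∧ ∃ b : Fin (m + 1) → Braid n, (∀ i, b i ∈ G₁b n) ∧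
    g * z = (List.ofFn fun i : Fin m => b i.castSucc * gen n 0).prod * b (Fin.last m)

theorem expressible_one (n : ℕ) : Expressible 0 (1 : Braid n) :=
  fun g hg => ⟨0, le_rfl, fun _ => g, fun _ => hg, by simp⟩

theorem Expressible.gen_zero_mul {n d : ℕ} {z : Braid n} (hz : Expressible d z) :
    Expressible (d + 1) (gen n 0 * z) := by
  intro g hg
  obtain ⟨m, hm, b, hb, hy⟩ := hz 1 (one_mem _)
  refine ⟨m + 1, by omega, Fin.cons g b, fun i => ?_, ?_⟩
  · cases i using Fin.cases with
    | zero => exact hg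
    | succ i => exact hb i
  · rw [one_mul] at hy
    rw [hy, List.ofFn_succ, List.prod_cons, ← Fin.succ_last, Fin.cons_succ, Fin.castSucc_zero,
      Fin.cons_zero]
    simp only [← Fin.succ_castSucc, Fin.cons_succ, mul_assoc]

theorem Expressible.mono {n c d : ℕ} {z : Braid n} (hz : Expressible d z) (hcd : c ≤ d) :
    Expressible c z := fun g hg =>
  let ⟨m, hm, hb⟩ := hz g hg
  ⟨m, hcd.trans hm, hb⟩

theorem Expressible.nonneg_mul {n d : ℕ} {x z : Braid n} (hz : Expressible d z)
    (hx : x ∈ nonneg (gen n) n) : Expressible d (x * z) := by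
  induction hx using Submonoid.closure_induction_left with
  | one => rwa [one_mul]
  | mul_left x hx y _ ih =>
    rw [mul_assoc]
    rcases hx with rfl | hx
    · exact ih.gen_zero_mul.mono (Nat.le_succ d)
    · intro g hg
      rw [← mul_assoc]
      exact ih _ (mul_mem hg (G₁b_eq n ▸ hx))

theorem mem_S1Pos_iff {n : ℕ} {α : Braid n} : α ∈ S1Pos n ↔
    ∃ x ∈ nonneg (gen n) n, ∃ y ∈ nonneg (gen n) n, α = x * gen n 0 * y := by
  have hG : ∀ g ∈ G₁b n, g ∈ nonneg (gen n) n := fun g hg => mem_nonneg_of_mem (G₁b_eq n ▸ hg)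
  constructor
  · rintro ⟨m, hm, b, hb, rfl⟩
    obtain ⟨m, rfl⟩ : ∃ l, m = l + 1 := ⟨m - 1, by omega⟩
    rw [List.ofFn_succ, List.prod_cons, mul_assoc]
    refine ⟨_, hG _ (hb _), _, mul_mem (list_prod_mem ?_) (hG _ (hb _)), rfl⟩
    intro x hx
    obtain ⟨i, rfl⟩ := (List.mem_ofFn' _ _).1 hx
    exact mul_mem (hG _ (hb _)) gen_zero_mem_nonneg
  · rintro ⟨x, hx, y, hy, rfl⟩
    have hxy := (((expressible_one n).nonneg_mul hy).gen_zero_mul.nonneg_mul hx) 1 (one_mem _)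
    rw [one_mul, mul_one, ← mul_assoc] at hxy
    exact hxy

end BraidOrder

open GarsideOrder BraidOrder in
/-- The set `P` of `(H, G₁)`-positive elements of `B_{n+1}` is equal to the set of
`s₁`-positive elements of `B_{n+1}`. -/
theorem statement12 (n : ℕ) (hn : 2 ≤ n) :
    {α : Braid n | Negative (Mb n) (M₁b n) (Nb n) (Δb n) α⁻¹} = S1Pos n := by
  obtain ⟨r, rfl⟩ : ∃ r, n = r + 1 := ⟨n - 1, by omega⟩
  ext α
  rw [Set.mem_ofPred_eq, mem_S1Pos_iff, Mb_eq, M₁b_eq, Nb_eq, Δb, seg_zero_eq_up]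
  exact (isBraidBasis_gen (r + 1)).negative_inv_iff (by omega) (up_pow_central r)
end

section
/- For every a ∈ M, dpt(rev(a)) = dpt(a). -/
/-- The defining relations of the simply laced Artin monoid of a graph: adjacent generators braid,
distinct non-adjacent generators commute. -/
def ArtinMonoid.rels {S : Type*} (Γ : SimpleGraph S) (u v : FreeMonoid S) : Prop :=
  ∃ a b : S,
    (Γ.Adj a b ∧ u = .of a * .of b * .of a ∧ v = .of b * .of a * .of b) ∨
    (a ≠ b ∧ ¬Γ.Adj a b ∧ u = .of a * .of b ∧ v = .of b * .of a)

/-- The simply laced Artin monoid of a graph. -/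
abbrev ArtinMonoid {S : Type*} (Γ : SimpleGraph S) := PresentedMonoid (ArtinMonoid.rels Γ)

namespace ArtinMonoid

variable {S : Type*} {Γ : SimpleGraph S}

/-- No three vertices are pairwise adjacent. -/
def TriangleFree (Γ : SimpleGraph S) : Prop := ∀ a b c, Γ.Adj a b → Γ.Adj b c → ¬Γ.Adj a c

/-- The generator of the Artin monoid attached to a vertex. -/
def atom (Γ : SimpleGraph S) (a : S) : ArtinMonoid Γ := PresentedMonoid.of (rels Γ) a

theorem atom_braid {a b : S} (h : Γ.Adj a b) :
    atom Γ a * atom Γ b * atom Γ a = atom Γ b * atom Γ a * atom Γ b :=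
  PresentedMonoid.mk_eq_mk_of_rel (rels := rels Γ)
    (x := FreeMonoid.of a * FreeMonoid.of b * FreeMonoid.of a)
    (y := FreeMonoid.of b * FreeMonoid.of a * FreeMonoid.of b) ⟨a, b, Or.inl ⟨h, rfl, rfl⟩⟩

theorem atom_comm {a b : S} (h : ¬Γ.Adj a b) : atom Γ a * atom Γ b = atom Γ b * atom Γ a := by
  by_cases hab : a = b
  · rw [hab]
  · exact PresentedMonoid.mk_eq_mk_of_rel (rels := rels Γ)
      (x := FreeMonoid.of a * FreeMonoid.of b) (y := FreeMonoid.of b * FreeMonoid.of a)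
      ⟨a, b, Or.inr ⟨hab, h, rfl, rfl⟩⟩

theorem atom_braid_mul {a b : S} (h : Γ.Adj a b) (x : ArtinMonoid Γ) :
    atom Γ a * (atom Γ b * (atom Γ a * x)) = atom Γ b * (atom Γ a * (atom Γ b * x)) := by
  simp only [← mul_assoc, atom_braid h]

theorem atom_comm_mul {a b : S} (h : ¬Γ.Adj a b) (x : ArtinMonoid Γ) :
    atom Γ a * (atom Γ b * x) = atom Γ b * (atom Γ a * x) := by
  simp only [← mul_assoc, atom_comm h]

theorem atom_induction {p : ArtinMonoid Γ → Prop} (one : p 1)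
    (mul : ∀ a x, p x → p (atom Γ a * x)) (x : ArtinMonoid Γ) : p x := by
  induction x using PresentedMonoid.inductionOn with | _ w
  induction w using FreeMonoid.recOn with
  | one => exact one
  | of_mul a w hw => exact mul a _ hw

/-- A map on generators compatible with the braid and commutation relations extends to the Artin
monoid. -/
def lift {A : Type*} [Monoid A] (f : S → A)
    (braid : ∀ a b, Γ.Adj a b → f a * f b * f a = f b * f a * f b)
    (comm : ∀ a b, a ≠ b → ¬Γ.Adj a b → f a * f b = f b * f a) : ArtinMonoid Γ →* A :=
  PresentedMonoid.lift f <| by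
    rintro u v ⟨a, b, ⟨h, rfl, rfl⟩ | ⟨hab, h, rfl, rfl⟩⟩
    · simpa using braid a b h
    · simpa using comm a b hab h

theorem lift_atom {A : Type*} [Monoid A] (f : S → A)
    (braid : ∀ a b, Γ.Adj a b → f a * f b * f a = f b * f a * f b)
    (comm : ∀ a b, a ≠ b → ¬Γ.Adj a b → f a * f b = f b * f a) (a : S) :
    lift f braid comm (atom Γ a) = f a := rfl

/-- The word length, as a homomorphism. -/
def lengthHom (Γ : SimpleGraph S) : ArtinMonoid Γ →* Multiplicative ℕ :=
  lift (fun _ => Multiplicative.ofAdd 1) (fun _ _ _ => rfl) (fun _ _ _ _ => rfl)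

/-- The word length of an element of an Artin monoid. -/
def length (x : ArtinMonoid Γ) : ℕ := (lengthHom Γ x).toAdd

@[simp]
theorem length_one : length (1 : ArtinMonoid Γ) = 0 := by simp [length]

@[simp]
theorem length_mul (x y : ArtinMonoid Γ) : length (x * y) = length x + length y := by
  simp [length]

@[simp]
theorem length_atom (a : S) : length (atom Γ a) = 1 := rfl

theorem length_mk (w : FreeMonoid S) :
    length (PresentedMonoid.mk (rels Γ) w) = FreeMonoid.length w := by
  induction w using FreeMonoid.recOn with
  | one => exact length_one
  | of_mul a w hw =>
    rw [map_mul, length_mul, hw, FreeMonoid.length_mul, FreeMonoid.length_of]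
    rfl

theorem eq_one_of_length_eq_zero {x : ArtinMonoid Γ} (h : length x = 0) : x = 1 := by
  induction x using atom_induction with
  | one => rfl
  | mul a x _ => simp at h

/-- The conclusion of the lcm property for `a x = b y`: the common value factors through the least
common multiple of the generators `a` and `b`. -/
def Compat (Γ : SimpleGraph S) (a b : S) (x y : ArtinMonoid Γ) : Prop :=
  (a = b ∧ x = y) ∨
  (Γ.Adj a b ∧ ∃ z, x = atom Γ b * (atom Γ a * z) ∧ y = atom Γ a * (atom Γ b * z)) ∨
  (a ≠ b ∧ ¬Γ.Adj a b ∧ ∃ z, x = atom Γ b * z ∧ y = atom Γ a * z)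

namespace Compat

variable {a b c : S} {x y w : ArtinMonoid Γ}

theorem symm (h : Compat Γ a b x y) : Compat Γ b a y x := by
  rcases h with ⟨rfl, rfl⟩ | ⟨h, z, rfl, rfl⟩ | ⟨hab, h, z, rfl, rfl⟩
  · exact Or.inl ⟨rfl, rfl⟩
  · exact Or.inr (Or.inl ⟨h.symm, z, rfl, rfl⟩)
  · exact Or.inr (Or.inr ⟨hab.symm, fun h' => h h'.symm, z, rfl, rfl⟩)

theorem mul_right (h : Compat Γ a b x y) (v : ArtinMonoid Γ) : Compat Γ a b (x * v) (y * v) := by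
  rcases h with ⟨rfl, rfl⟩ | ⟨h, z, rfl, rfl⟩ | ⟨hab, h, z, rfl, rfl⟩
  · exact Or.inl ⟨rfl, rfl⟩
  · exact Or.inr (Or.inl ⟨h, z * v, by simp only [mul_assoc], by simp only [mul_assoc]⟩)
  · exact Or.inr (Or.inr ⟨hab, h, z * v, by simp only [mul_assoc], by simp only [mul_assoc]⟩)

theorem eq (h : Compat Γ a a x y) : x = y := by
  rcases h with ⟨_, h⟩ | ⟨h, _⟩ | ⟨h, _⟩
  · exact h
  · exact absurd h (Γ.loopless.irrefl a)
  · exact absurd rfl h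

theorem of_adj (h : Compat Γ a b x y) (hab : Γ.Adj a b) :
    ∃ z, x = atom Γ b * (atom Γ a * z) ∧ y = atom Γ a * (atom Γ b * z) := by
  rcases h with ⟨rfl, _⟩ | ⟨_, h⟩ | ⟨_, h, _⟩
  · exact absurd hab (Γ.loopless.irrefl a)
  · exact h
  · exact absurd hab h

theorem of_not_adj (h : Compat Γ a b x y) (hne : a ≠ b) (hab : ¬Γ.Adj a b) :
    ∃ z, x = atom Γ b * z ∧ y = atom Γ a * z := by
  rcases h with ⟨rfl, _⟩ | ⟨h, _⟩ | ⟨_, _, h⟩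
  · exact absurd rfl hne
  · exact absurd h hab
  · exact h

/-- Transitivity when one of the two pairs of generators commutes, assuming the lcm property for
shorter elements. -/
theorem trans_of_not_adj
    (ih : ∀ a b (x' y' : ArtinMonoid Γ), length x' < length x →
      atom Γ a * x' = atom Γ b * y' → Compat Γ a b x' y')
    (hac : a ≠ c) (hcb : c ≠ b) (hab : a ≠ b) (hcb' : ¬Γ.Adj c b)
    (h₁ : Compat Γ a c x w) (h₂ : Compat Γ c b w y) : Compat Γ a b x y := by
  obtain ⟨z₂, rfl, rfl⟩ := h₂.of_not_adj hcb hcb'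
  by_cases hac' : Γ.Adj a c
  · obtain ⟨z₁, rfl, hw⟩ := h₁.of_adj hac'
    have h := ih a b (atom Γ c * z₁) z₂ (by simp) hw.symm
    have hl := congrArg length hw
    by_cases hab' : Γ.Adj a b
    · obtain ⟨z₃, h₃, rfl⟩ := h.of_adj hab'
      obtain ⟨z₄, rfl, h₄⟩ :=
        (ih c b z₁ (atom Γ a * z₃) (by simp at *; omega) h₃).of_not_adj hcb hcb'
      obtain ⟨z₅, rfl, rfl⟩ := (ih a c z₃ z₄ (by simp at *; omega) h₄).of_adj hac'
      refine Or.inr (Or.inl ⟨hab', atom Γ c * (atom Γ a * (atom Γ b * z₅)), ?_, ?_⟩)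
      · rw [atom_braid_mul hab', atom_comm_mul hcb', atom_comm_mul (a := b) (b := c)
          (fun h => hcb' h.symm), atom_comm_mul (a := b) (b := c) (fun h => hcb' h.symm),
          atom_comm_mul (a := c) (b := b) hcb', atom_braid_mul hac'.symm]
      · rw [atom_comm_mul (a := b) (b := c) (fun h => hcb' h.symm), atom_braid_mul hac'.symm,
          atom_braid_mul hab'.symm.symm, atom_comm_mul (a := c) (b := b) hcb']
    · obtain ⟨z₃, h₃, rfl⟩ := h.of_not_adj hab hab'
      obtain ⟨z₄, rfl, rfl⟩ := (ih c b z₁ z₃ (by simp; omega) h₃).of_not_adj hcb hcb'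
      refine Or.inr (Or.inr ⟨hab, hab', atom Γ c * (atom Γ a * z₄), ?_, ?_⟩)
      · rw [atom_comm_mul hab', atom_comm_mul hcb']
      · rw [atom_braid_mul hac'.symm]
  · obtain ⟨z₁, rfl, hw⟩ := h₁.of_not_adj hac hac'
    have h := ih a b z₁ z₂ (by simp) hw.symm
    have hca' : ¬Γ.Adj c a := fun h => hac' h.symm
    by_cases hab' : Γ.Adj a b
    · obtain ⟨z, rfl, rfl⟩ := h.of_adj hab'
      refine Or.inr (Or.inl ⟨hab', atom Γ c * z, ?_, ?_⟩)
      · rw [atom_comm_mul hcb', atom_comm_mul hca']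
      · rw [atom_comm_mul hca', atom_comm_mul hcb']
    · obtain ⟨z, rfl, rfl⟩ := h.of_not_adj hab hab'
      exact Or.inr (Or.inr ⟨hab, hab', atom Γ c * z, atom_comm_mul hcb' z, atom_comm_mul hca' z⟩)

theorem length_eq (h : Compat Γ a b x y) : length x = length y := by
  rcases h with ⟨rfl, rfl⟩ | ⟨h, z, rfl, rfl⟩ | ⟨hab, h, z, rfl, rfl⟩ <;> simp

theorem trans (hΓ : TriangleFree Γ)
    (ih : ∀ a b (x' y' : ArtinMonoid Γ), length x' < length x →
      atom Γ a * x' = atom Γ b * y' → Compat Γ a b x' y')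
    (h₁ : Compat Γ a c x w) (h₂ : Compat Γ c b w y) : Compat Γ a b x y := by
  by_cases hac : a = c
  · obtain rfl := hac
    rwa [h₁.eq]
  by_cases hcb : c = b
  · obtain rfl := hcb
    rwa [← h₂.eq]
  by_cases hab : a = b
  · obtain rfl := hab
    refine Or.inl ⟨rfl, ?_⟩
    by_cases hac' : Γ.Adj a c
    · obtain ⟨z₁, rfl, rfl⟩ := h₁.of_adj hac'
      obtain ⟨z₂, h, rfl⟩ := h₂.of_adj hac'.symm
      rw [(ih c c z₁ z₂ (by simp at *; omega) (ih a a _ _ (by simp) h).eq).eq]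
    · obtain ⟨z₁, rfl, rfl⟩ := h₁.of_not_adj hac hac'
      obtain ⟨z₂, h, rfl⟩ := h₂.of_not_adj hcb (fun h => hac' h.symm)
      rw [(ih a a z₁ z₂ (by simp) h).eq]
  by_cases hcb' : Γ.Adj c b
  · by_cases hac' : Γ.Adj a c
    · have hab' := hΓ a c b hac' hcb'
      obtain ⟨z₁, rfl, rfl⟩ := h₁.of_adj hac'
      obtain ⟨z₂, h, rfl⟩ := h₂.of_adj hcb'
      obtain ⟨z₃, h₃, h₄⟩ := (ih a b _ _ (by simp) h).of_not_adj hab hab'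
      have hl := congrArg length h
      have hl' := congrArg length h₃
      simp only [length_mul, length_atom] at hl hl'
      obtain ⟨z₄, rfl, rfl⟩ := (ih c b z₁ z₃ (by simp; omega) h₃).of_adj hcb'
      obtain ⟨z₅, rfl, h₅⟩ := (ih c a z₂ _ (by simp at hl ⊢; omega) h₄).of_adj hac'.symm
      have h₆ := (ih c c _ _ (by simp; omega) h₅).eq
      obtain ⟨z₆, rfl, rfl⟩ :=
        (ih b a z₄ z₅ (by simp at *; omega) h₆).of_not_adj (Ne.symm hab) (fun h => hab' h.symm)
      refine Or.inr (Or.inr ⟨hab, hab',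
        atom Γ c * (atom Γ b * (atom Γ a * (atom Γ c * z₆))), ?_, ?_⟩)
      · rw [atom_comm_mul hab', atom_braid_mul hac', atom_braid_mul hcb']
      · rw [atom_comm_mul (a := b) (b := a) (fun h => hab' h.symm), atom_braid_mul hcb'.symm,
          atom_braid_mul hac'.symm, atom_comm_mul hab']
    · refine (trans_of_not_adj ?_ (Ne.symm hcb) (Ne.symm hac) (Ne.symm hab)
        (fun h => hac' h.symm) h₂.symm h₁.symm).symm
      rwa [← h₂.length_eq, ← h₁.length_eq]
  · exact trans_of_not_adj ih hac hcb hab hcb' h₁ h₂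

end Compat

theorem of_mul_inj {a b : S} {u v : FreeMonoid S} (h : FreeMonoid.of a * u = .of b * v) :
    a = b ∧ u = v := List.cons.inj h

theorem length_eq_of_conGen {u v : FreeMonoid S} (h : conGen (rels Γ) u v) :
    u.length = v.length := by
  rw [← length_mk (Γ := Γ), ← length_mk (Γ := Γ), PresentedMonoid.mk_eq_mk_iff.2 h]

theorem compat_of_conGen (hΓ : TriangleFree Γ) {k : ℕ}
    (ih : ∀ a b (x y : ArtinMonoid Γ), length x < k →
      atom Γ a * x = atom Γ b * y → Compat Γ a b x y)
    {u v : FreeMonoid S} (h : conGen (rels Γ) u v) (a b : S) (u' v' : FreeMonoid S)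
    (hk : u'.length ≤ k) (hu : u = .of a * u') (hv : v = .of b * v') :
    Compat Γ a b (PresentedMonoid.mk _ u') (PresentedMonoid.mk _ v') := by
  induction (h : ConGen.Rel (rels Γ) u v) generalizing a b u' v' with
  | of u v h =>
    obtain ⟨c, d, ⟨h, rfl, rfl⟩ | ⟨hcd, h, rfl, rfl⟩⟩ := h
    · rw [mul_assoc] at hu hv
      obtain ⟨rfl, rfl⟩ := of_mul_inj hu
      obtain ⟨rfl, rfl⟩ := of_mul_inj hv
      exact Or.inr (Or.inl ⟨h, 1, by rw [mul_one]; rfl, by rw [mul_one]; rfl⟩)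
    · obtain ⟨rfl, rfl⟩ := of_mul_inj hu
      obtain ⟨rfl, rfl⟩ := of_mul_inj hv
      exact Or.inr (Or.inr ⟨hcd, h, 1, by rw [mul_one]; rfl, by rw [mul_one]; rfl⟩)
  | refl w =>
    obtain ⟨rfl, rfl⟩ := of_mul_inj (hu.symm.trans hv)
    exact Or.inl ⟨rfl, rfl⟩
  | symm h hi =>
    refine (hi b a v' u' ?_ hv hu).symm
    have := length_eq_of_conGen h
    rw [hu, hv, FreeMonoid.length_mul, FreeMonoid.length_mul, FreeMonoid.length_of,
      FreeMonoid.length_of] at this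
    omega
  | @trans u w v h₁ h₂ hi₁ hi₂ =>
    have hl := length_eq_of_conGen h₁
    induction w using FreeMonoid.casesOn with
    | one => simp [hu] at hl
    | of_mul c w =>
      rw [hu, FreeMonoid.length_mul, FreeMonoid.length_mul, FreeMonoid.length_of,
        FreeMonoid.length_of] at hl
      refine (hi₁ a c u' w hk hu rfl).trans hΓ (fun a b x y hx => ih a b x y ?_)
        (hi₂ c b w v' (by omega) rfl hv)
      rw [length_mk] at hx
      omega
  | @mul u₁ v₁ u₂ v₂ h₁ h₂ hi₁ hi₂ =>
    have hl := length_eq_of_conGen h₁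
    induction u₁ using FreeMonoid.casesOn with
    | one =>
      rw [FreeMonoid.length_one] at hl
      obtain rfl := FreeMonoid.length_eq_zero.1 hl.symm
      rw [one_mul] at hu hv
      exact hi₂ a b u' v' hk hu hv
    | of_mul c u₁ =>
      induction v₁ using FreeMonoid.casesOn with
      | one => simp at hl
      | of_mul d v₁ =>
        rw [mul_assoc] at hu hv
        obtain ⟨rfl, rfl⟩ := of_mul_inj hu
        obtain ⟨rfl, rfl⟩ := of_mul_inj hv
        have := (hi₁ c d u₁ v₁ (by rw [FreeMonoid.length_mul] at hk; omega) rfl rfl).mul_right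
          (PresentedMonoid.mk _ u₂)
        rwa [map_mul, map_mul, ← PresentedMonoid.mk_eq_mk_iff.2 h₂]

/-- The lcm property of generators in Artin monoids of triangle-free simply laced type. -/
theorem compat_of_mul_eq (hΓ : TriangleFree Γ) {a b : S}
    {x y : ArtinMonoid Γ} (h : atom Γ a * x = atom Γ b * y) : Compat Γ a b x y := by
  induction hk : length x using Nat.strong_induction_on generalizing a b x y with
  | _ k ih =>
    induction x using PresentedMonoid.inductionOn with | _ u
    induction y using PresentedMonoid.inductionOn with | _ v
    refine compat_of_conGen hΓ (k := k) (fun a b x y hx hxy => ih _ hx hxy rfl)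
      (PresentedMonoid.mk_eq_mk_iff.1 h) a b u v ?_ rfl rfl
    rw [← hk, length_mk]

end ArtinMonoid

namespace ArtinMonoid

variable {S : Type*} {Γ : SimpleGraph S}

theorem mul_left_cancel_of_triangleFree (hΓ : TriangleFree Γ) {x y z : ArtinMonoid Γ}
    (h : x * y = x * z) : y = z := by
  induction x using atom_induction with
  | one => simpa using h
  | mul a x ih => exact ih (compat_of_mul_eq hΓ (by simpa only [mul_assoc] using h)).eq

/-- Word reversal, as a homomorphism to the opposite monoid. -/
def revHom (Γ : SimpleGraph S) : ArtinMonoid Γ →* (ArtinMonoid Γ)ᵐᵒᵖ :=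
  lift (fun a => MulOpposite.op (atom Γ a))
    (fun a b h => MulOpposite.unop_injective <| by simp [← mul_assoc, atom_braid h])
    (fun a b _ h => MulOpposite.unop_injective <| by simp [atom_comm h])

/-- Word reversal on an Artin monoid. -/
def rev (x : ArtinMonoid Γ) : ArtinMonoid Γ := (revHom Γ x).unop

@[simp]
theorem rev_one : rev (1 : ArtinMonoid Γ) = 1 := by simp [rev]

@[simp]
theorem rev_mul (x y : ArtinMonoid Γ) : rev (x * y) = rev y * rev x := by simp [rev]

@[simp]
theorem rev_atom (a : S) : rev (atom Γ a) = atom Γ a := rfl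

@[simp]
theorem rev_rev (x : ArtinMonoid Γ) : rev (rev x) = x := by
  induction x using atom_induction with
  | one => simp
  | mul a x ih => simp [ih]

theorem rev_injective : Function.Injective (rev : ArtinMonoid Γ → ArtinMonoid Γ) :=
  Function.LeftInverse.injective rev_rev

theorem mul_right_cancel_of_triangleFree (hΓ : TriangleFree Γ) {x y z : ArtinMonoid Γ}
    (h : y * x = z * x) : y = z :=
  rev_injective <| mul_left_cancel_of_triangleFree hΓ (x := rev x) <| by
    rw [← rev_mul, ← rev_mul, h]

/-- The parabolic submonoid generated by a set of generators. -/
def parabolic (Γ : SimpleGraph S) (I : Set S) : Submonoid (ArtinMonoid Γ) :=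
  Submonoid.closure (atom Γ '' I)

theorem atom_mem_parabolic {I : Set S} {a : S} (h : a ∈ I) : atom Γ a ∈ parabolic Γ I :=
  Submonoid.subset_closure ⟨a, h, rfl⟩

theorem parabolic_mono {I J : Set S} (h : I ⊆ J) : parabolic Γ I ≤ parabolic Γ J :=
  Submonoid.closure_mono (Set.image_mono h)

open Classical in
/-- The homomorphism sending an element to `1` if all letters of its words lie in `I`, and to `0`
otherwise. -/
noncomputable def supportedHom (Γ : SimpleGraph S) (I : Set S) : ArtinMonoid Γ →* ℕ :=
  lift (fun a => if a ∈ I then 1 else 0) (fun a b _ => by split_ifs <;> rfl)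
    (fun a b _ _ => mul_comm _ _)

theorem supportedHom_atom_eq_one {I : Set S} {a : S} :
    supportedHom Γ I (atom Γ a) = 1 ↔ a ∈ I := by
  rw [supportedHom, lift_atom]
  split_ifs with h <;> simp [h]

theorem mem_parabolic_iff {I : Set S} {x : ArtinMonoid Γ} :
    x ∈ parabolic Γ I ↔ supportedHom Γ I x = 1 := by
  constructor
  · intro h
    induction h using Submonoid.closure_induction with
    | mem x h =>
      obtain ⟨a, ha, rfl⟩ := h
      exact supportedHom_atom_eq_one.2 ha
    | one => exact map_one _
    | mul x y _ _ hx hy => rw [map_mul, hx, hy]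
  · intro h
    induction x using atom_induction with
    | one => exact one_mem _
    | mul a x ih =>
      rw [map_mul, mul_eq_one] at h
      exact mul_mem (atom_mem_parabolic (supportedHom_atom_eq_one.1 h.1)) (ih h.2)

theorem mul_mem_parabolic_iff {I : Set S} {x y : ArtinMonoid Γ} :
    x * y ∈ parabolic Γ I ↔ x ∈ parabolic Γ I ∧ y ∈ parabolic Γ I := by
  simp only [mem_parabolic_iff, map_mul, mul_eq_one]

theorem rev_mem_parabolic {I : Set S} {x : ArtinMonoid Γ} (h : x ∈ parabolic Γ I) :
    rev x ∈ parabolic Γ I := by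
  induction x using atom_induction with
  | one => simp
  | mul a x ih =>
    rw [mul_mem_parabolic_iff] at h
    rw [rev_mul, rev_atom]
    exact mul_mem (ih h.2) h.1

theorem commute_of_mem_parabolic {I : Set S} {a : S} (h : ∀ b ∈ I, ¬Γ.Adj a b)
    {x : ArtinMonoid Γ} (hx : x ∈ parabolic Γ I) : Commute (atom Γ a) x := by
  induction hx using Submonoid.closure_induction with
  | mem x hx =>
    obtain ⟨b, hb, rfl⟩ := hx
    exact atom_comm (h b hb)
  | one => exact Commute.one_right _
  | mul x y _ _ hx hy => exact hx.mul_right hy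

/-- Two left divisors of `x` lying in a parabolic submonoid have a common right multiple in that
submonoid which still left divides `x`. -/
theorem exists_common_multiple_dvd (hΓ : TriangleFree Γ) {I : Set S} {u v x : ArtinMonoid Γ}
    (hu : u ∈ parabolic Γ I) (hv : v ∈ parabolic Γ I) (hux : u ∣ x) (hvx : v ∣ x) :
    ∃ m ∈ parabolic Γ I, u ∣ m ∧ v ∣ m ∧ m ∣ x := by
  induction hk : length x using Nat.strong_induction_on generalizing u v x with
  | _ k ih =>
    induction u using atom_induction with
    | one => exact ⟨v, hv, one_dvd v, dvd_rfl, hvx⟩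
    | mul a u _ =>
    induction v using atom_induction with
    | one => exact ⟨atom Γ a * u, hu, dvd_rfl, one_dvd _, hux⟩
    | mul b v _ =>
    obtain ⟨x₁, rfl⟩ := hux
    obtain ⟨x₂, hx⟩ := hvx
    rw [mul_mem_parabolic_iff] at hu hv
    obtain ⟨ha, hu⟩ := hu
    obtain ⟨hb, hv⟩ := hv
    rw [mul_assoc, mul_assoc] at hx
    rw [mul_assoc] at hk ⊢
    have hlen := congrArg length hx
    simp only [length_mul, length_atom] at hk hlen
    have combine : ∀ c d z : ArtinMonoid Γ, c ∈ parabolic Γ I → d ∈ parabolic Γ I →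
        u * x₁ = c * z → v * x₂ = d * z → atom Γ a * c = atom Γ b * d →
        ∃ m ∈ parabolic Γ I, atom Γ a * u ∣ m ∧ atom Γ b * v ∣ m ∧
          m ∣ atom Γ a * (u * x₁) := by
      intro c d z hc hd hcz hdz hcd
      obtain ⟨m₁, hm₁, hum₁, ⟨n₁, rfl⟩, hm₁x⟩ :=
        ih _ (by simp only [length_mul]; omega) hu hc (Dvd.intro x₁ rfl) (Dvd.intro z hcz.symm) rfl
      obtain ⟨m₂, hm₂, hvm₂, ⟨n₂, rfl⟩, hm₂x⟩ :=
        ih _ (by simp only [length_mul]; omega) hv hd (Dvd.intro x₂ rfl) (Dvd.intro z hdz.symm) rfl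
      rw [mul_mem_parabolic_iff] at hm₁ hm₂
      have hn₁ : n₁ ∣ z := by
        obtain ⟨w, hw⟩ := hm₁x
        exact ⟨w, mul_left_cancel_of_triangleFree hΓ (x := c) (by rw [← hcz, hw, mul_assoc])⟩
      have hn₂ : n₂ ∣ z := by
        obtain ⟨w, hw⟩ := hm₂x
        exact ⟨w, mul_left_cancel_of_triangleFree hΓ (x := d) (by rw [← hdz, hw, mul_assoc])⟩
      have hlen' := congrArg length hcz
      simp only [length_mul] at hlen'
      obtain ⟨m, hm, hn₁m, hn₂m, hmz⟩ := ih _ (by omega) hm₁.2 hm₂.2 hn₁ hn₂ rfl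
      refine ⟨atom Γ a * (c * m), mul_mem ha (mul_mem hc hm),
        mul_dvd_mul_left _ (hum₁.trans (mul_dvd_mul_left _ hn₁m)), ?_, ?_⟩
      · rw [← mul_assoc, hcd, mul_assoc]
        exact mul_dvd_mul_left _ (hvm₂.trans (mul_dvd_mul_left _ hn₂m))
      · rw [hcz]
        exact mul_dvd_mul_left _ (mul_dvd_mul_left _ hmz)
    rcases compat_of_mul_eq hΓ hx with ⟨rfl, h⟩ | ⟨hab, z, h₁, h₂⟩ | ⟨hne, hab, z, h₁, h₂⟩
    · exact combine 1 1 (u * x₁) (one_mem _) (one_mem _) (one_mul _).symm (by rw [one_mul, h]) rfl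
    · exact combine (atom Γ b * atom Γ a) (atom Γ a * atom Γ b) z (mul_mem hb ha) (mul_mem ha hb)
        (by rw [h₁, mul_assoc]) (by rw [h₂, mul_assoc])
        (by rw [← mul_assoc, ← mul_assoc, atom_braid hab])
    · exact combine (atom Γ b) (atom Γ a) z hb ha h₁ h₂ (atom_comm hab)

/-- The right-handed version of `exists_common_multiple_dvd`. -/
theorem exists_common_left_multiple (hΓ : TriangleFree Γ) {I : Set S} {u v x : ArtinMonoid Γ}
    (hu : u ∈ parabolic Γ I) (hv : v ∈ parabolic Γ I) (hux : ∃ w, x = w * u)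
    (hvx : ∃ w, x = w * v) :
    ∃ m ∈ parabolic Γ I, (∃ w, m = w * u) ∧ (∃ w, m = w * v) ∧ ∃ w, x = w * m := by
  have rev_dvd : ∀ y z : ArtinMonoid Γ, rev y ∣ rev z ↔ ∃ w, z = w * y := fun y z =>
    ⟨fun ⟨w, hw⟩ => ⟨rev w, rev_injective (by simpa using hw)⟩,
      fun ⟨w, hw⟩ => ⟨rev w, by rw [hw, rev_mul]⟩⟩
  obtain ⟨m, hm, h₁, h₂, h₃⟩ := exists_common_multiple_dvd hΓ (rev_mem_parabolic hu)
    (rev_mem_parabolic hv) ((rev_dvd _ _).2 hux) ((rev_dvd _ _).2 hvx)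
  rw [← rev_rev m, rev_dvd] at h₁ h₂ h₃
  exact ⟨rev m, rev_mem_parabolic hm, h₁, h₂, h₃⟩

/-- The product of the generators attached to `t a, t (a + 1), …, t (a + m - 1)`. -/
def chain (Γ : SimpleGraph S) (t : ℕ → S) : ℕ → ℕ → ArtinMonoid Γ
  | _, 0 => 1
  | a, m + 1 => atom Γ (t a) * chain Γ t (a + 1) m

theorem chain_succ_right (t : ℕ → S) (a m : ℕ) :
    chain Γ t a (m + 1) = chain Γ t a m * atom Γ (t (a + m)) := by
  induction m generalizing a with
  | zero => simp [chain]
  | succ m ih => rw [chain, ih, chain, mul_assoc, Nat.add_right_comm, add_assoc]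

/-- The vertices `t 0, …, t (n - 1)` enumerate a graph that is a path, in order. -/
structure IsPath (Γ : SimpleGraph S) (t : ℕ → S) (n : ℕ) : Prop where
  adj : ∀ i j, i < n → j < n → (Γ.Adj (t i) (t j) ↔ i + 1 = j ∨ j + 1 = i)
  inj : ∀ i j, i < n → j < n → t i = t j → i = j
  surj : ∀ a, ∃ i < n, t i = a

namespace IsPath

variable {t : ℕ → S} {n : ℕ}

theorem not_adj (ht : IsPath Γ t n) {i j : ℕ} (hi : i < n) (hj : j < n)
    (h₁ : i + 1 ≠ j) (h₂ : j + 1 ≠ i) :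
    ¬Γ.Adj (t i) (t j) := by
  rw [ht.adj i j hi hj]
  omega

theorem ne (ht : IsPath Γ t n) {i j : ℕ} (hi : i < n) (hj : j < n) (h : i ≠ j) : t i ≠ t j :=
  fun h' => h (ht.inj i j hi hj h')

theorem triangleFree (ht : IsPath Γ t n) : TriangleFree Γ := by
  intro a b c
  obtain ⟨i, hi, rfl⟩ := ht.surj a
  obtain ⟨j, hj, rfl⟩ := ht.surj b
  obtain ⟨k, hk, rfl⟩ := ht.surj c
  rw [ht.adj _ _ hi hj, ht.adj _ _ hj hk, ht.adj _ _ hi hk]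
  omega

theorem commute_chain (ht : IsPath Γ t n) {a m j : ℕ} (hm : a + m ≤ n) (hj : j < n)
    (h : j + 1 < a ∨ a + m < j) :
    atom Γ (t j) * chain Γ t a m = chain Γ t a m * atom Γ (t j) := by
  induction m generalizing a with
  | zero => simp [chain]
  | succ m ih =>
    rw [chain, ← mul_assoc, atom_comm (ht.not_adj hj (by omega) (by omega) (by omega)), mul_assoc,
      ih (by omega) (by omega), mul_assoc]

theorem chain_mul_atom (ht : IsPath Γ t n) {a m j : ℕ} (hm : a + m ≤ n) (haj : a ≤ j)
    (hj : j + 1 < a + m) :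
    chain Γ t a m * atom Γ (t j) = atom Γ (t (j + 1)) * chain Γ t a m := by
  induction m generalizing a with
  | zero => omega
  | succ m ih =>
    rcases haj.eq_or_lt with rfl | haj
    · obtain ⟨m, rfl⟩ : ∃ k, m = k + 1 := ⟨m - 1, by omega⟩
      rw [chain, chain, mul_assoc, mul_assoc,
        ← ht.commute_chain (by omega) (by omega) (by omega), atom_braid_mul
          ((ht.adj _ _ (by omega) (by omega)).2 (by omega))]
    · rw [chain, mul_assoc, ih (by omega) (by omega) (by omega),
        atom_comm_mul (ht.not_adj (by omega) (by omega) (by omega) (by omega))]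

theorem chain_dvd_of_far (ht : IsPath Γ t n) {a m j : ℕ} (hm : a + m ≤ n) (hj : j < n)
    (h : j + 1 < a ∨ a + m < j)
    {r r' : ArtinMonoid Γ} (hr : atom Γ (t j) * r = chain Γ t a m * r') :
    chain Γ t a m ∣ r := by
  induction m generalizing a r with
  | zero => exact one_dvd r
  | succ m ih =>
    rw [chain, mul_assoc] at hr
    obtain ⟨z, rfl, hz⟩ := (compat_of_mul_eq ht.triangleFree hr).of_not_adj
      (ht.ne hj (by omega) (by omega)) (ht.not_adj hj (by omega) (by omega) (by omega))
    exact mul_dvd_mul_left _ (ih (by omega) (by omega) hz.symm)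

theorem chain_succ_dvd (ht : IsPath Γ t n) {a m : ℕ} (hm₀ : 1 ≤ m) (hm : a + m < n)
    {r r' : ArtinMonoid Γ} (hr : atom Γ (t (a + m)) * r = chain Γ t a m * r') :
    chain Γ t a (m + 1) ∣ r := by
  induction m, hm₀ using Nat.le_induction generalizing a r with
  | base =>
    rw [chain, mul_assoc] at hr
    obtain ⟨z, rfl, -⟩ := (compat_of_mul_eq ht.triangleFree hr).of_adj
      ((ht.adj _ _ hm (by omega)).2 (by omega))
    exact ⟨z, by simp [chain, mul_assoc]⟩
  | succ m hm₀ ih =>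
    rw [chain, mul_assoc] at hr
    obtain ⟨z, rfl, hz⟩ := (compat_of_mul_eq ht.triangleFree hr).of_not_adj
      (ht.ne hm (by omega) (by omega)) (ht.not_adj hm (by omega) (by omega) (by omega))
    rw [← add_assoc, Nat.add_right_comm] at hz
    exact mul_dvd_mul_left _ (ih (by omega) hz.symm)

theorem chain_dvd_of_mem (ht : IsPath Γ t n) {a m j : ℕ} (hm : a + m ≤ n) (haj : a < j)
    (hj : j < a + m)
    {r r' : ArtinMonoid Γ} (hr : atom Γ (t j) * r = chain Γ t a m * r') :
    chain Γ t a m ∣ r := by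
  induction m generalizing a r with
  | zero => exact one_dvd r
  | succ m ih =>
    rw [chain, mul_assoc] at hr
    have hcompat := compat_of_mul_eq ht.triangleFree hr
    rcases (Nat.succ_le_iff.2 haj).eq_or_lt with rfl | haj'
    · obtain ⟨m, rfl⟩ : ∃ k, m = k + 1 := ⟨m - 1, by omega⟩
      obtain ⟨z, rfl, hz⟩ := hcompat.of_adj ((ht.adj _ _ (by omega) (by omega)).2 (by omega))
      rw [chain, mul_assoc] at hz
      have hz' := mul_left_cancel_of_triangleFree ht.triangleFree hz
      rw [chain, chain]
      exact mul_dvd_mul_left _ (mul_dvd_mul_left _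
        (ht.chain_dvd_of_far (by omega) (by omega) (by omega) hz'.symm))
    · obtain ⟨z, rfl, hz⟩ := hcompat.of_not_adj
        (ht.ne (by omega) (by omega) (by omega))
        (ht.not_adj (by omega) (by omega) (by omega) (by omega))
      exact mul_dvd_mul_left _ (ih (by omega) haj' (by omega) hz.symm)

/-- If the first generator of the path left divides `q r`, where `q` avoids this generator, then
`r` is divisible by an initial chain `s₁ ⋯ s_m`, and `q s₁ ⋯ s_m` can be rewritten so as to expose
the first generator. -/
theorem exists_chain_dvd (ht : IsPath Γ t n) (hn : 0 < n) {q : ArtinMonoid Γ}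
    (hq : q ∈ parabolic Γ (t '' {i | 1 ≤ i ∧ i < n})) {c r : ArtinMonoid Γ}
    (h : atom Γ (t 0) * c = q * r) :
    ∃ m, 1 ≤ m ∧ m ≤ n ∧ chain Γ t 0 m ∣ r ∧
      ∃ x ∈ parabolic Γ (t '' {i | 1 ≤ i ∧ i < n}), ∃ y ∈ parabolic Γ (t '' {i | i + 1 < m}),
        q * chain Γ t 0 m = atom Γ (t 0) * (x * y) := by
  induction hq using Submonoid.closure_induction_right generalizing r with
  | one =>
    exact ⟨1, le_rfl, hn, ⟨c, by simpa [chain] using h.symm⟩, 1, one_mem _, 1, one_mem _,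
      by simp [chain]⟩
  | mul_right q hq s hs ih =>
    obtain ⟨_, ⟨j, ⟨hj, hjn⟩, rfl⟩, rfl⟩ := hs
    rw [mul_assoc] at h
    obtain ⟨m, hm, hmn, ⟨r', hr'⟩, x, hx, y, hy, he⟩ := ih h
    rcases lt_trichotomy j m with hjm | rfl | hjm
    · obtain ⟨i, rfl⟩ : ∃ i, j = i + 1 := ⟨j - 1, by omega⟩
      refine ⟨m, hm, hmn, ht.chain_dvd_of_mem (by omega) hj (by omega) hr', x, hx,
        y * atom Γ (t i), mul_mem hy (atom_mem_parabolic ⟨i, hjm, rfl⟩), ?_⟩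
      rw [mul_assoc, ← ht.chain_mul_atom (by omega) (by omega) (by omega), ← mul_assoc, he]
      simp only [mul_assoc]
    · obtain ⟨i, rfl⟩ : ∃ i, j = i + 1 := ⟨j - 1, by omega⟩
      have hcomm : Commute (atom Γ (t (i + 1))) y := by
        refine commute_of_mem_parabolic ?_ hy
        rintro _ ⟨k, hk, rfl⟩
        have hk' : k + 1 < i + 1 := hk
        exact ht.not_adj hjn (by omega) (by omega) (by omega)
      refine ⟨i + 1 + 1, by omega, hjn, ht.chain_succ_dvd hm (by omega) (by rwa [zero_add]),
        x * atom Γ (t (i + 1)), mul_mem hx (atom_mem_parabolic ⟨i + 1, ⟨hj, hjn⟩, rfl⟩),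
        y * atom Γ (t i), mul_mem (parabolic_mono (Set.image_mono ?_) hy)
          (atom_mem_parabolic ⟨i, Nat.lt_succ_self _, rfl⟩), ?_⟩
      · intro k (hk : k + 1 < i + 1)
        exact Nat.lt_succ_of_lt hk
      · rw [mul_assoc, ← ht.chain_mul_atom (by omega) (by omega) (by omega), chain_succ_right,
          ← mul_assoc, ← mul_assoc, he, zero_add]
        simp only [mul_assoc]
        rw [← mul_assoc y, ← hcomm.eq, mul_assoc]
    · have hcomm : Commute (atom Γ (t j)) y := by
        refine commute_of_mem_parabolic ?_ hy
        rintro _ ⟨k, hk, rfl⟩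
        have hk' : k + 1 < m := hk
        exact ht.not_adj hjn (by omega) (by omega) (by omega)
      refine ⟨m, hm, hmn, ht.chain_dvd_of_far (by omega) hjn (by omega) hr',
        x * atom Γ (t j), mul_mem hx (atom_mem_parabolic ⟨j, ⟨hj, hjn⟩, rfl⟩), y, hy, ?_⟩
      rw [mul_assoc, ht.commute_chain (by omega) hjn (by omega), ← mul_assoc, he]
      simp only [mul_assoc]
      rw [hcomm.eq]

theorem exists_factor_of_atom_mul_eq (ht : IsPath Γ t n) (hn : 0 < n) {a : S}
    {c q r : ArtinMonoid Γ}
    (hq : q ∈ parabolic Γ (t '' {i | 1 ≤ i ∧ i < n})) (h : atom Γ a * c = q * r) :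
    ∃ x ∈ parabolic Γ (t '' {i | 1 ≤ i ∧ i < n}), ∃ y ∈ parabolic Γ (t '' {i | i + 1 < n}),
      ∃ z r', c = x * (y * r') ∧ r = z * r' := by
  obtain ⟨i, hi, rfl⟩ := ht.surj a
  rcases Nat.eq_zero_or_pos i with rfl | hi₀
  · obtain ⟨m, -, hm, ⟨r', rfl⟩, x, hx, y, hy, he⟩ := ht.exists_chain_dvd hn hq h
    refine ⟨x, hx, y, parabolic_mono (Set.image_mono ?_) hy, _, r', ?_, rfl⟩
    · intro k (hk : k + 1 < m)
      exact lt_of_lt_of_le hk hm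
    · refine mul_left_cancel_of_triangleFree ht.triangleFree (x := atom Γ (t 0)) ?_
      rw [h, ← mul_assoc, he]
      simp only [mul_assoc]
  · obtain ⟨m, hm, ⟨x, rfl⟩, ⟨z, hz⟩, ⟨r', hr'⟩⟩ := exists_common_multiple_dvd ht.triangleFree
      (atom_mem_parabolic (Set.mem_image_of_mem t (And.intro hi₀ hi))) hq
      (Dvd.intro c rfl) (Dvd.intro r h.symm)
    refine ⟨x, (mul_mem_parabolic_iff.1 hm).2, 1, one_mem _, z, r', ?_, ?_⟩
    · refine mul_left_cancel_of_triangleFree ht.triangleFree (x := atom Γ (t i)) ?_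
      rw [hr', one_mul, mul_assoc]
    · refine mul_left_cancel_of_triangleFree ht.triangleFree (x := q) ?_
      rw [← h, hr', hz, mul_assoc]

end IsPath

end ArtinMonoid

open OreLocalization in
/-- A cancellative monoid in which any two elements have a common left multiple embeds in a
group. -/
theorem exists_injective_hom_units_of_common_left_multiple.{u} {A : Type u} [Monoid A]
    (left_cancel : ∀ x y z : A, x * y = x * z → y = z)
    (right_cancel : ∀ x y z : A, y * x = z * x → y = z)
    (ore : ∀ x y : A, ∃ u v, u * x = v * y) :
    ∃ (B : Type u) (_ : Monoid B) (f : A →* Bˣ), Function.Injective f := by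
  choose u v huv using ore
  let _ : OreSet (⊤ : Submonoid A) :=
    { ore_right_cancel := fun x y s h => ⟨1, by rw [right_cancel _ _ _ h]⟩
      oreNum := fun x s => v x s
      oreDenom := fun x s => ⟨u x s, trivial⟩
      ore_eq := fun x s => huv x s }
  refine ⟨OreLocalization (⊤ : Submonoid A) A, inferInstance,
    { toFun := fun x => numeratorUnit ⟨x, trivial⟩
      map_one' := Units.ext (numeratorHom (S := (⊤ : Submonoid A))).map_one
      map_mul' := fun x y => Units.ext ((numeratorHom (S := (⊤ : Submonoid A))).map_mul x y) },
    fun x y h => ?_⟩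
  obtain ⟨w, w', hx, hw⟩ := oreDiv_eq_iff.1 (congrArg Units.val h)
  have hw' : (w : A) = w' := by simpa using hw
  simp only [Submonoid.smul_def, smul_eq_mul, hw'] at hx
  exact (left_cancel _ _ _ hx).symm

namespace ArtinMonoid

variable {S : Type*} {Γ : SimpleGraph S}

namespace IsPath

variable {t : ℕ → S} {n : ℕ}

theorem chain_mul_chain (ht : IsPath Γ t n) {a m : ℕ} (hm : a + m < n) :
    chain Γ t 0 n * chain Γ t a m = chain Γ t (a + 1) m * chain Γ t 0 n := by
  induction m generalizing a with
  | zero => simp [chain]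
  | succ m ih =>
    rw [chain, chain, ← mul_assoc, ht.chain_mul_atom (by omega) (by omega) (by omega), mul_assoc,
      ih (by omega), mul_assoc]

theorem chain_pow_mul_atom (ht : IsPath Γ t n) {j k : ℕ} (hk : j + k < n) :
    chain Γ t 0 n ^ k * atom Γ (t j) = atom Γ (t (j + k)) * chain Γ t 0 n ^ k := by
  induction k generalizing j with
  | zero => simp
  | succ k ih =>
    rw [pow_succ, mul_assoc, ht.chain_mul_atom (by omega) (by omega) (by omega), ← mul_assoc,
      ih (by omega), mul_assoc, add_right_comm, add_assoc]

theorem chain_sq_mul_atom_last (ht : IsPath Γ t (n + 1)) :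
    chain Γ t 0 (n + 1) ^ 2 * atom Γ (t n) = atom Γ (t 0) * chain Γ t 0 (n + 1) ^ 2 := by
  have h := ht.chain_mul_chain (a := 0) (m := n) (by omega)
  have h₁ : chain Γ t 0 (n + 1) = chain Γ t 0 n * atom Γ (t n) := by
    simpa using chain_succ_right t 0 n
  have h₂ : chain Γ t 0 (n + 1) = atom Γ (t 0) * chain Γ t (0 + 1) n := rfl
  calc chain Γ t 0 (n + 1) ^ 2 * atom Γ (t n)
      = atom Γ (t 0) * (chain Γ t (0 + 1) n * chain Γ t 0 (n + 1)) * atom Γ (t n) := by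
        rw [sq, ← mul_assoc (atom Γ (t 0)), ← h₂]
    _ = atom Γ (t 0) * chain Γ t 0 (n + 1) ^ 2 := by
        rw [← h, sq, mul_assoc, mul_assoc, ← h₁]

theorem chain_pow_mul_comm (ht : IsPath Γ t n) (x : ArtinMonoid Γ) :
    chain Γ t 0 n ^ (n + 1) * x = x * chain Γ t 0 n ^ (n + 1) := by
  induction x using atom_induction with
  | one => simp
  | mul a x hx =>
    obtain ⟨i, hi, rfl⟩ := ht.surj a
    obtain ⟨k, rfl⟩ : ∃ k, n = i + k + 1 := ⟨n - i - 1, by omega⟩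
    have h : chain Γ t 0 (i + k + 1) ^ (i + k + 1 + 1) * atom Γ (t i) =
        atom Γ (t i) * chain Γ t 0 (i + k + 1) ^ (i + k + 1 + 1) := by
      rw [show i + k + 1 + 1 = i + 2 + k by omega, pow_add, pow_add, mul_assoc,
        ht.chain_pow_mul_atom (by omega), ← mul_assoc, mul_assoc (_ ^ i),
        ht.chain_sq_mul_atom_last, ← mul_assoc, ht.chain_pow_mul_atom (by omega), Nat.zero_add]
      simp only [mul_assoc]
    rw [← mul_assoc, h, mul_assoc, hx, mul_assoc]

theorem exists_mul_eq_chain_pow (ht : IsPath Γ t n) (x : ArtinMonoid Γ) :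
    ∃ y k, y * x = (chain Γ t 0 n ^ (n + 1)) ^ k := by
  induction x using atom_induction with
  | one => exact ⟨1, 0, by simp⟩
  | mul a x hx =>
    obtain ⟨y, k, hy⟩ := hx
    obtain ⟨i, hi, rfl⟩ := ht.surj a
    obtain ⟨m, rfl⟩ : ∃ m, n = i + m + 1 := ⟨n - i - 1, by omega⟩
    set δ := chain Γ t 0 (i + m + 1)
    obtain ⟨z, hz⟩ : ∃ z, z * atom Γ (t i) = δ ^ (i + m + 1 + 1) := by
      refine ⟨δ ^ (i + 1) * (chain Γ t 0 (i + m) * δ ^ m), ?_⟩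
      rw [mul_assoc, mul_assoc, ht.chain_pow_mul_atom (by omega), ← mul_assoc (chain _ _ _ _),
        show chain Γ t 0 (i + m) * atom Γ (t (i + m)) = δ by
          simpa using (chain_succ_right t 0 (i + m)).symm, ← pow_succ', ← pow_add]
      congr 1
      omega
    exact ⟨y * z, k + 1, by
      rw [mul_assoc, ← mul_assoc z, hz, ht.chain_pow_mul_comm, ← mul_assoc, hy, pow_succ _ k]⟩

theorem exists_mul_eq_mul (ht : IsPath Γ t n) (x y : ArtinMonoid Γ) : ∃ u v, u * x = v * y := by
  obtain ⟨v, k, hv⟩ := ht.exists_mul_eq_chain_pow y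
  refine ⟨(chain Γ t 0 n ^ (n + 1)) ^ k, x * v, ?_⟩
  rw [mul_assoc, hv]
  exact Commute.pow_left (ht.chain_pow_mul_comm x) k

end IsPath

end ArtinMonoid

open scoped Pointwise

/-- Products of `p` factors taken alternately from two submonoids, the last one from `X b`. -/
def alternating {A : Type*} [Monoid A] (X : Bool → Submonoid A) : ℕ → Bool → Set A
  | 0, _ => 1
  | p + 1, b => alternating X p (!b) * X b

/-- Products of `p` factors taken alternately from two submonoids, the first one from `X b`. -/
def alternatingFrom {A : Type*} [Monoid A] (X : Bool → Submonoid A) : ℕ → Bool → Set A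
  | 0, _ => 1
  | p + 1, b => X b * alternatingFrom X p (!b)

section alternating

variable {A : Type*} [Monoid A] {X : Bool → Submonoid A}

theorem alternating_odd (d : ℕ) (b : Bool) :
    alternating X (2 * d + 1) b = X b * ((X (!b) : Set A) * X b) ^ d := by
  induction d with
  | zero => simp [alternating]
  | succ d ih =>
    rw [show 2 * (d + 1) + 1 = 2 * d + 1 + 1 + 1 by omega, alternating, alternating, Bool.not_not,
      ih, pow_succ]
    simp only [mul_assoc]

theorem alternatingFrom_odd (d : ℕ) (b : Bool) :
    alternatingFrom X (2 * d + 1) b = ((X b : Set A) * X (!b)) ^ d * X b := by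
  induction d with
  | zero => simp [alternatingFrom]
  | succ d ih =>
    rw [show 2 * (d + 1) + 1 = 2 * d + 1 + 1 + 1 by omega, alternatingFrom, alternatingFrom,
      Bool.not_not, ih, pow_succ']
    simp only [mul_assoc]

theorem alternating_subset_succ (p : ℕ) (b : Bool) :
    alternating X p b ⊆ alternating X (p + 1) b := by
  induction p generalizing b with
  | zero => simp [alternating, one_mem]
  | succ p ih => exact Set.mul_subset_mul_right (ih (!b))

end alternating

/-- Depth equality reduces to comparing membership in the odd members of two increasing families. -/
theorem sInf_div_two_eq {P Q : ℕ → Prop} (hP : Monotone P) (hQ : Monotone Q)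
    (h : ∀ d, P (2 * d + 1) ↔ Q (2 * d + 1)) :
    sInf {p | 1 ≤ p ∧ P p} / 2 = sInf {p | 1 ≤ p ∧ Q p} / 2 := by
  have key : ∀ {P Q : ℕ → Prop}, Monotone P → Monotone Q →
      (∀ d, P (2 * d + 1) ↔ Q (2 * d + 1)) →
      sInf {p | 1 ≤ p ∧ P p} / 2 ≤ sInf {p | 1 ≤ p ∧ Q p} / 2 := by
    intro P Q hP hQ h
    rcases Set.eq_empty_or_nonempty {p | 1 ≤ p ∧ Q p} with he | hne
    · have hP' : {p | 1 ≤ p ∧ P p} = ∅ := by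
        refine Set.eq_empty_of_forall_notMem fun p hp => ?_
        have : 2 * p + 1 ∈ {p | 1 ≤ p ∧ Q p} :=
          ⟨by omega, (h p).1 (hP (by omega : p ≤ 2 * p + 1) hp.2)⟩
        simp [he] at this
      rw [he, hP']
    · have hq : Q (sInf {p | 1 ≤ p ∧ Q p}) := (Nat.sInf_mem hne).2
      set q := sInf {p | 1 ≤ p ∧ Q p}
      have : sInf {p | 1 ≤ p ∧ P p} ≤ 2 * (q / 2) + 1 :=
        Nat.sInf_le ⟨by omega, (h _).2 (hQ (by omega : q ≤ 2 * (q / 2) + 1) hq)⟩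
      omega
  exact (key hP hQ h).antisymm (key hQ hP fun d => (h d).symm)

namespace ArtinMonoid

variable {S : Type*} {Γ : SimpleGraph S} {I : Bool → Set S}

theorem rev_mem_alternating {p : ℕ} {b : Bool} {x : ArtinMonoid Γ}
    (h : x ∈ alternatingFrom (fun b => parabolic Γ (I b)) p b) :
    rev x ∈ alternating (fun b => parabolic Γ (I b)) p b := by
  induction p generalizing b x with
  | zero =>
    obtain rfl : x = 1 := h
    exact rev_one
  | succ p ih =>
    obtain ⟨u, hu, v, hv, rfl⟩ := h
    exact ⟨rev v, ih hv, rev u, rev_mem_parabolic hu, (rev_mul u v).symm⟩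

theorem rev_mem_alternatingFrom {p : ℕ} {b : Bool} {x : ArtinMonoid Γ}
    (h : x ∈ alternating (fun b => parabolic Γ (I b)) p b) :
    rev x ∈ alternatingFrom (fun b => parabolic Γ (I b)) p b := by
  induction p generalizing b x with
  | zero =>
    obtain rfl : x = 1 := h
    exact rev_one
  | succ p ih =>
    obtain ⟨u, hu, v, hv, rfl⟩ := h
    exact ⟨rev v, rev_mem_parabolic hv, rev u, ih hu, (rev_mul u v).symm⟩

theorem rev_mem_alternating_odd_iff {d : ℕ} {b : Bool} {x : ArtinMonoid Γ} :
    rev x ∈ alternating (fun b => parabolic Γ (I b)) (2 * d + 1) b ↔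
      x ∈ alternating (fun b => parabolic Γ (I b)) (2 * d + 1) b := by
  have h : alternatingFrom (fun b => parabolic Γ (I b)) (2 * d + 1) b =
      alternating (fun b => parabolic Γ (I b)) (2 * d + 1) b := by
    rw [alternating_odd, alternatingFrom_odd, mul_pow_mul]
  refine ⟨fun hx => ?_, fun hx => rev_mem_alternating (h ▸ hx)⟩
  rw [← rev_rev x]
  exact rev_mem_alternating (h ▸ hx)

/-- The exchange property of a pair of parabolic submonoids that makes the sets of alternating
products closed under divisors: cancelling a generator on the left of `q * r` costs at most one
extra factor from the other submonoid. -/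
def Exchange (Γ : SimpleGraph S) (I : Bool → Set S) : Prop :=
  ∀ (b : Bool) (a : S) (c q r : ArtinMonoid Γ), q ∈ parabolic Γ (I b) → atom Γ a * c = q * r →
    ∃ x ∈ parabolic Γ (I b), ∃ y ∈ parabolic Γ (I (!b)), ∃ z r', c = x * (y * r') ∧ r = z * r'

theorem Exchange.right_mem_alternatingFrom (hI : Exchange Γ I) {p : ℕ} {b : Bool}
    {x y : ArtinMonoid Γ} (h : x * y ∈ alternatingFrom (fun b => parabolic Γ (I b)) p b) :
    y ∈ alternatingFrom (fun b => parabolic Γ (I b)) p b := by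
  induction p generalizing b x y with
  | zero =>
    have h : length (x * y) = 0 := by rw [show x * y = 1 from h, length_one]
    rw [length_mul] at h
    exact eq_one_of_length_eq_zero (by omega)
  | succ p ih =>
    induction x using atom_induction generalizing y with
    | one => simpa using h
    | mul a x hx =>
      rw [mul_assoc] at h
      refine hx ?_
      obtain ⟨q, hq, r, hr, he⟩ := h
      cases p with
      | zero =>
        obtain rfl : r = 1 := hr
        have hq' : atom Γ a * (x * y) ∈ parabolic Γ (I b) := by
          rw [← he]
          simpa using hq
        exact ⟨x * y, (mul_mem_parabolic_iff.1 hq').2, 1, rfl, mul_one _⟩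
      | succ p =>
        obtain ⟨u, hu, v, hv, z, r', hc, rfl⟩ := hI b a (x * y) q r hq he.symm
        obtain ⟨w, hw, s, hs, rfl⟩ := ih hr
        exact ⟨u, hu, v * (w * s), ⟨v * w, mul_mem hv hw, s, hs, mul_assoc _ _ _⟩, hc.symm⟩

theorem Exchange.left_mem_alternating (hI : Exchange Γ I) {p : ℕ} {b : Bool}
    {x y : ArtinMonoid Γ} (h : x * y ∈ alternating (fun b => parabolic Γ (I b)) p b) :
    x ∈ alternating (fun b => parabolic Γ (I b)) p b := by
  have h := rev_mem_alternatingFrom h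
  rw [rev_mul] at h
  simpa using rev_mem_alternating (hI.right_mem_alternatingFrom h)

open GarsideOrder

variable {G : Type*} [Group G] {ι : ArtinMonoid Γ →* G}

theorem leR_map_iff (hι : Function.Injective ι) {x y : ArtinMonoid Γ} :
    leR ((⊤ : Submonoid (ArtinMonoid Γ)).map ι) (ι x) (ι y) ↔ ∃ w, y = w * x := by
  refine ⟨?_, ?_⟩
  · rintro ⟨w, -, hw⟩
    exact ⟨w, hι (by rw [map_mul, hw, inv_mul_cancel_right])⟩
  · rintro ⟨w, rfl⟩
    exact ⟨w, trivial, by simp⟩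

/-- Every element has a greatest right divisor in a parabolic submonoid. -/
theorem exists_greatest_right_divisor (hΓ : TriangleFree Γ) (J : Set S) (x : ArtinMonoid Γ) :
    ∃ t ∈ parabolic Γ J, (∃ w, x = w * t) ∧
      ∀ c ∈ parabolic Γ J, (∃ w, x = w * c) → ∃ w, t = w * c := by
  classical
  let P : ℕ → Prop := fun k => ∃ t ∈ parabolic Γ J, (∃ w, x = w * t) ∧ length t = k
  obtain ⟨t, ht, hxt, hlen⟩ : P (Nat.findGreatest P (length x)) :=
    Nat.findGreatest_spec (m := 0) (Nat.zero_le _) ⟨1, one_mem _, ⟨x, by simp⟩, length_one⟩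
  refine ⟨t, ht, hxt, fun c hc hxc => ?_⟩
  obtain ⟨m, hm, ⟨u, hu⟩, hmc, v, hv⟩ := exists_common_left_multiple hΓ ht hc hxt hxc
  have hle : length m ≤ Nat.findGreatest P (length x) :=
    Nat.le_findGreatest (by rw [hv, length_mul]; omega) ⟨m, hm, ⟨v, hv⟩, rfl⟩
  have hlm : length m = length u + length t := by rw [hu, length_mul]
  obtain rfl : u = 1 := eq_one_of_length_eq_zero (by omega)
  rwa [hu, one_mul] at hmc

theorem tail_map (hΓ : TriangleFree Γ) (hι : Function.Injective ι) (J : Set S)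
    (x : ArtinMonoid Γ) :
    ∃ t ∈ parabolic Γ J, tail ((⊤ : Submonoid (ArtinMonoid Γ)).map ι) ((parabolic Γ J).map ι)
      (ι x) = ι t ∧ (∃ w, x = w * t) ∧
        ∀ c ∈ parabolic Γ J, (∃ w, x = w * c) → ∃ w, t = w * c := by
  have hex : ∃ b : G, b ∈ (parabolic Γ J).map ι ∧
      {c : G | c ∈ (parabolic Γ J).map ι ∧
        leR ((⊤ : Submonoid (ArtinMonoid Γ)).map ι) c (ι x)} =
      {c : G | c ∈ (parabolic Γ J).map ι ∧
        leR ((⊤ : Submonoid (ArtinMonoid Γ)).map ι) c b} := by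
    obtain ⟨t, ht, ⟨u, rfl⟩, hmax⟩ := exists_greatest_right_divisor hΓ J x
    refine ⟨ι t, ⟨t, ht, rfl⟩, Set.ext fun c => and_congr_right ?_⟩
    rintro ⟨c, hc, rfl⟩
    rw [leR_map_iff hι, leR_map_iff hι]
    refine ⟨hmax c hc, ?_⟩
    rintro ⟨w, rfl⟩
    exact ⟨u * w, (mul_assoc _ _ _).symm⟩
  obtain ⟨⟨t, ht, htail⟩, hset⟩ := hex.choose_spec
  rw [← htail] at hset
  have hset' : ∀ c ∈ parabolic Γ J, (∃ w, x = w * c) ↔ ∃ w, t = w * c := fun c hc => by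
    have h := Set.ext_iff.1 hset (ι c)
    simpa only [Set.mem_ofPred_eq, leR_map_iff hι, Submonoid.mem_map_of_mem ι hc, true_and] using h
  refine ⟨t, ht, ?_, (hset' t ht).2 ⟨1, by simp⟩, fun c hc => (hset' c hc).1⟩
  rw [tail, dif_pos hex, htail]

theorem strip_map (hΓ : TriangleFree Γ) (hI : Exchange Γ I) (hι : Function.Injective ι)
    (x : ArtinMonoid Γ) (i : ℕ) :
    ∃ y, strip ((⊤ : Submonoid (ArtinMonoid Γ)).map ι) ((parabolic Γ (I true)).map ι)
        ((parabolic Γ (I false)).map ι) i (ι x) = ι y ∧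
      ∀ p, x ∈ alternating (fun b => parabolic Γ (I b)) (i + p) true ↔
        y ∈ alternating (fun b => parabolic Γ (I b)) p (decide (i % 2 = 0)) := by
  induction i with
  | zero => exact ⟨x, rfl, fun p => by simp⟩
  | succ i ih =>
    obtain ⟨y, hy, hxy⟩ := ih
    obtain ⟨t, ht, htail, ⟨w, rfl⟩, hmax⟩ := tail_map hΓ hι (I (decide (i % 2 = 0))) y
    refine ⟨w, ?_, fun p => ?_⟩
    · have hpar : (if i % 2 = 0 then (parabolic Γ (I true)).map ι
          else (parabolic Γ (I false)).map ι) =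
          (parabolic Γ (I (decide (i % 2 = 0)))).map ι := by
        split_ifs with h <;> simp [h]
      rw [strip, hy, hpar, htail, map_mul, mul_inv_cancel_right]
    · rw [add_assoc, add_comm 1 p, hxy,
        show decide ((i + 1) % 2 = 0) = !decide (i % 2 = 0) by
          rcases Nat.mod_two_eq_zero_or_one i with h | h <;> simp [Nat.add_mod, h]]
      refine ⟨?_, fun h => ⟨w, h, t, ht, rfl⟩⟩
      rintro ⟨u, hu, v, hv, he⟩
      obtain ⟨s, rfl⟩ := hmax v hv ⟨u, he.symm⟩
      obtain rfl : u = w * s := mul_right_cancel_of_triangleFree hΓ (x := v) <| by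
        rw [mul_assoc]
        exact he
      exact hI.left_mem_alternating hu

theorem strip_map_eq_one_iff (hΓ : TriangleFree Γ) (hI : Exchange Γ I)
    (hι : Function.Injective ι) (x : ArtinMonoid Γ) (p : ℕ) :
    strip ((⊤ : Submonoid (ArtinMonoid Γ)).map ι) ((parabolic Γ (I true)).map ι)
        ((parabolic Γ (I false)).map ι) p (ι x) = 1 ↔
      x ∈ alternating (fun b => parabolic Γ (I b)) p true := by
  obtain ⟨y, hy, hxy⟩ := strip_map hΓ hI hι x p
  rw [hy, map_eq_one_iff ι hι]
  exact (hxy 0).symm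

theorem dpt_map_rev (hΓ : TriangleFree Γ) (hI : Exchange Γ I) (hι : Function.Injective ι)
    (x : ArtinMonoid Γ) :
    dpt ((⊤ : Submonoid (ArtinMonoid Γ)).map ι) ((parabolic Γ (I true)).map ι)
        ((parabolic Γ (I false)).map ι) (ι (rev x)) =
      dpt ((⊤ : Submonoid (ArtinMonoid Γ)).map ι) ((parabolic Γ (I true)).map ι)
        ((parabolic Γ (I false)).map ι) (ι x) := by
  simp only [dpt, bh, strip_map_eq_one_iff hΓ hI hι]
  exact sInf_div_two_eq (monotone_nat_of_le_succ fun p h => alternating_subset_succ p _ h)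
    (monotone_nat_of_le_succ fun p h => alternating_subset_succ p _ h)
    fun d => rev_mem_alternating_odd_iff

end ArtinMonoid

namespace BraidOrder

open ArtinMonoid GarsideOrder

/-- The canonical map from the Artin monoid of the path on `n` vertices to the braid group. -/
def braidHom (n : ℕ) : ArtinMonoid (SimpleGraph.pathGraph n) →* Braid n :=
  ArtinMonoid.lift PresentedGroup.of
    (fun i j h => by
      have braid : ∀ i j : Fin n, (i : ℕ) + 1 = j →
          (PresentedGroup.of i * PresentedGroup.of j * PresentedGroup.of i : Braid n) =
            PresentedGroup.of j * PresentedGroup.of i * PresentedGroup.of j := fun i j h =>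
        mul_inv_eq_one.1 (PresentedGroup.one_of_mem (rels := braidRel n) ⟨i, j, Or.inl ⟨h, rfl⟩⟩)
      rcases SimpleGraph.pathGraph_adj.1 h with h | h
      exacts [braid i j h, (braid j i h).symm])
    (fun i j hne h => by
      have comm : ∀ i j : Fin n, (i : ℕ) + 2 ≤ j →
          (PresentedGroup.of i * PresentedGroup.of j : Braid n) =
            PresentedGroup.of j * PresentedGroup.of i := fun i j h =>
        mul_inv_eq_one.1 (PresentedGroup.one_of_mem (rels := braidRel n) ⟨i, j, Or.inr ⟨h, rfl⟩⟩)
      rw [SimpleGraph.pathGraph_adj] at h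
      have hne : (i : ℕ) ≠ j := Fin.val_ne_of_ne hne
      rcases le_total (i : ℕ) j with hij | hij
      exacts [comm i j (by omega), (comm j i (by omega)).symm])

theorem braidHom_atom {n : ℕ} (i : Fin n) :
    braidHom n (atom (SimpleGraph.pathGraph n) i) = gen n i := by
  rw [gen, dif_pos i.2]
  rfl

theorem isPath_ofNat (n : ℕ) :
    IsPath (SimpleGraph.pathGraph (n + 1)) (fun i => Fin.ofNat (n + 1) i) (n + 1) where
  adj i j hi hj := by
    simp [SimpleGraph.pathGraph_adj, Nat.mod_eq_of_lt hi, Nat.mod_eq_of_lt hj]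
  inj i j hi hj h := by
    simpa [Nat.mod_eq_of_lt hi, Nat.mod_eq_of_lt hj] using congrArg Fin.val h
  surj a := ⟨a, a.2, by simp⟩

theorem isPath_rev_ofNat (n : ℕ) :
    IsPath (SimpleGraph.pathGraph (n + 1)) (fun i => (Fin.ofNat (n + 1) i).rev) (n + 1) where
  adj i j hi hj := by
    simp only [SimpleGraph.pathGraph_adj, Fin.val_rev, Fin.val_ofNat, Nat.mod_eq_of_lt hi,
      Nat.mod_eq_of_lt hj]
    omega
  inj i j hi hj h := by
    simpa [Nat.mod_eq_of_lt hi, Nat.mod_eq_of_lt hj] using congrArg Fin.val (Fin.rev_injective h)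
  surj a := ⟨(a.rev : Fin (n + 1)), a.rev.2, by rw [Fin.ofNat_val_eq_self, Fin.rev_rev]⟩

/-- The positions of the generators of `M₁` (for `true`) and of `N` (for `false`). -/
def positions (n : ℕ) : Bool → Set (Fin n)
  | true => {i | 1 ≤ (i : ℕ)}
  | false => {i | (i : ℕ) + 1 < n}

theorem exchange_positions (n : ℕ) :
    Exchange (SimpleGraph.pathGraph (n + 1)) (positions (n + 1)) := by
  have h₁ : (fun i => Fin.ofNat (n + 1) i) '' {i | 1 ≤ i ∧ i < n + 1} =
      positions (n + 1) true := by
    ext i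
    refine ⟨?_, fun hi => ⟨i, ⟨hi, i.2⟩, by simp⟩⟩
    rintro ⟨j, ⟨hj, hjn⟩, rfl⟩
    simpa [positions, Nat.mod_eq_of_lt hjn] using hj
  have h₂ : (fun i => Fin.ofNat (n + 1) i) '' {i | i + 1 < n + 1} = positions (n + 1) false := by
    ext i
    refine ⟨?_, fun hi => ⟨i, hi, by simp⟩⟩
    rintro ⟨j, hj, rfl⟩
    simpa [positions, Nat.mod_eq_of_lt (Nat.lt_of_succ_lt hj)] using hj
  have h₃ : (fun i => (Fin.ofNat (n + 1) i).rev) '' {i | 1 ≤ i ∧ i < n + 1} =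
      positions (n + 1) false := by
    rw [← Set.image_image Fin.rev, h₁]
    ext i
    simp only [Set.mem_image, positions, Set.mem_ofPred_eq]
    refine ⟨?_, fun hi => ⟨i.rev, by rw [Fin.val_rev]; omega, Fin.rev_rev i⟩⟩
    rintro ⟨j, hj, rfl⟩
    rw [Fin.val_rev]
    omega
  have h₄ : (fun i => (Fin.ofNat (n + 1) i).rev) '' {i | i + 1 < n + 1} =
      positions (n + 1) true := by
    rw [← Set.image_image Fin.rev, h₂]
    ext i
    simp only [Set.mem_image, positions, Set.mem_ofPred_eq]
    refine ⟨?_, fun hi => ⟨i.rev, by rw [Fin.val_rev]; omega, Fin.rev_rev i⟩⟩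
    rintro ⟨j, hj, rfl⟩
    rw [Fin.val_rev]
    omega
  rintro (_ | _) a c q r hq h
  · have := (isPath_rev_ofNat n).exists_factor_of_atom_mul_eq (by omega) (h₃ ▸ hq) h
    rwa [h₃, h₄] at this
  · have := (isPath_ofNat n).exists_factor_of_atom_mul_eq (by omega) (h₁ ▸ hq) h
    rwa [h₁, h₂] at this

theorem braidHom_injective (n : ℕ) : Function.Injective (braidHom (n + 1)) := by
  have ht := isPath_ofNat n
  obtain ⟨B, _, f, hf⟩ := exists_injective_hom_units_of_common_left_multiple
    (fun _ _ _ => mul_left_cancel_of_triangleFree ht.triangleFree)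
    (fun _ _ _ => mul_right_cancel_of_triangleFree ht.triangleFree) ht.exists_mul_eq_mul
  have hrel : ∀ r ∈ braidRel (n + 1),
      FreeGroup.lift (fun i => f (atom (SimpleGraph.pathGraph (n + 1)) i)) r = 1 := by
    rintro _ ⟨i, j, ⟨h, rfl⟩ | ⟨h, rfl⟩⟩
    · have := atom_braid (SimpleGraph.pathGraph_adj.2 (Or.inl h))
      rw [map_mul, map_inv, mul_inv_eq_one]
      simpa using congrArg f this
    · have := atom_comm (Γ := SimpleGraph.pathGraph (n + 1)) (a := i) (b := j) <| by
        rw [SimpleGraph.pathGraph_adj]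
        omega
      rw [map_mul, map_inv, mul_inv_eq_one]
      simpa using congrArg f this
  have hcomp : ∀ x, PresentedGroup.toGroup hrel (braidHom (n + 1) x) = f x := fun x => by
    induction x using atom_induction with
    | one => simp
    | mul a x hx =>
      rw [map_mul, map_mul, hx, map_mul]
      congr 1
      exact PresentedGroup.toGroup.of hrel
  exact fun x y h => hf (by rw [← hcomp, ← hcomp, h])

theorem map_parabolic_braidHom {n : ℕ} {J : Set (Fin n)} {P : ℕ → Prop}
    (hJ : ∀ i : Fin n, i ∈ J ↔ P i) :
    (parabolic (SimpleGraph.pathGraph n) J).map (braidHom n) =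
      Submonoid.closure {x | ∃ i : ℕ, P i ∧ i < n ∧ x = gen n i} := by
  rw [parabolic, MonoidHom.map_mclosure]
  congr 1
  ext x
  constructor
  · rintro ⟨_, ⟨i, hi, rfl⟩, rfl⟩
    exact ⟨i, (hJ i).1 hi, i.2, braidHom_atom i⟩
  · rintro ⟨i, hi, hin, rfl⟩
    exact ⟨_, ⟨⟨i, hin⟩, (hJ ⟨i, hin⟩).2 hi, rfl⟩, braidHom_atom _⟩

theorem map_top_braidHom (n : ℕ) : (⊤ : Submonoid _).map (braidHom n) = Mb n := by
  have : (⊤ : Submonoid (ArtinMonoid (SimpleGraph.pathGraph n))) =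
      parabolic (SimpleGraph.pathGraph n) Set.univ := by
    refine (eq_top_iff.2 fun x _ => ?_).symm
    induction x using atom_induction with
    | one => exact one_mem _
    | mul a x hx => exact mul_mem (atom_mem_parabolic trivial) (hx trivial)
  rw [this, map_parabolic_braidHom (P := fun _ => True) (by simp), Mb]
  simp

theorem map_positions_true (n : ℕ) :
    (parabolic _ (positions n true)).map (braidHom n) = M₁b n :=
  map_parabolic_braidHom fun _ => Iff.rfl

theorem map_positions_false (n : ℕ) :
    (parabolic _ (positions n false)).map (braidHom n) = Nb n := by
  rw [map_parabolic_braidHom (J := positions n false) (P := fun i => i + 1 < n)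
    fun _ => Iff.rfl, Nb]
  congr! 5 with x i
  exact ⟨fun h => ⟨h.1, h.2.2⟩, fun h => ⟨h.1, by omega, h.2⟩⟩

theorem exists_braidHom_eq_prod {n : ℕ} (l : List ℕ) (hl : ∀ i ∈ l, i < n) :
    ∃ x, braidHom n x = (l.map (gen n)).prod ∧
      braidHom n (rev x) = (l.reverse.map (gen n)).prod := by
  induction l with
  | nil => exact ⟨1, by simp⟩
  | cons i l ih =>
    obtain ⟨x, hx, hrev⟩ := ih fun j hj => hl j (List.mem_cons_of_mem _ hj)
    refine ⟨atom _ ⟨i, hl i List.mem_cons_self⟩ * x, ?_, ?_⟩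
    · rw [map_mul, hx, braidHom_atom, List.map_cons, List.prod_cons]
    · rw [rev_mul, rev_atom, map_mul, hrev, braidHom_atom, List.reverse_cons, List.map_append,
        List.prod_append, List.map_singleton, List.prod_singleton]

end BraidOrder

open GarsideOrder BraidOrder in
/-- For every `a ∈ M`, `dpt (rev a) = dpt a`: for any expression of an element of the
positive braid monoid as a word in the generators, the reversed word has the same depth. -/
theorem statement13 (n : ℕ) (hn : 2 ≤ n) (l : List ℕ) (hl : ∀ i ∈ l, i < n) :
    dpt (Mb n) (M₁b n) (Nb n) ((l.reverse.map (gen n)).prod) =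
      dpt (Mb n) (M₁b n) (Nb n) ((l.map (gen n)).prod) := by
  obtain ⟨x, hx, hrev⟩ := exists_braidHom_eq_prod l hl
  obtain ⟨n, rfl⟩ : ∃ m, n = m + 1 := ⟨n - 1, by omega⟩
  rw [← hx, ← hrev, ← map_top_braidHom, ← map_positions_true, ← map_positions_false]
  exact ArtinMonoid.dpt_map_rev (isPath_ofNat n).triangleFree (exchange_positions n)
    (braidHom_injective n) x
end
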